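/- (Theorem 1.1, items 1–3.) Fix α ∈ [0,T) and a sector S with the ordering property. For ρ ∈ S̄ with |ρ| ≥ ρ_α and x ∈ [0,T] there exists a fundamental system of solutions {y_k(x,ρ)}_{k=1,…,n} of the equation y^{(n)} + Σ_{m=0}^{n−2} p_m(x) y^{(m)} = ρ^n y such that: (1) the functions y_k^{(ν)}(x,ρ), ν = 0,…,n−1, are continuous in (x,ρ) for x ∈ [0,T], ρ ∈ S̄, |ρ| ≥ ρ_α; (2) for each fixed x ∈ [0,T] the functions y_k^{(ν)}(x,ρ), ν = 0,…,n−1, are analytic in ρ on the open set {ρ ∈ S : |ρ| > ρ_α}; (3) uniformly in x ∈ [α,T], y_k^{(ν)}(x,ρ) = (ρR_k)^ν exp(ρR_k x) (1 + β_1(x)/(ρR_k) + o(1/ρ)) as |ρ| → ∞, ρ ∈ S̄, where β_1(x) = −(1/n)∫_α^x p_{n−2}(t) dt. -/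

import Mathlib

open MeasureTheory Set Finset

/-- `ρ_α := max_{0≤m≤n−2} (2∫_α^T |p_m(t)| dt)^{1/(n−1−m)}`. -/
noncomputable def rhoAlpha (n : ℕ) (T α : ℝ) (p : Fin (n - 1) → ℝ → ℂ) : ℝ :=
  ⨆ m : Fin (n - 1), (2 * ∫ t in α..T, ‖p m t‖) ^ (((n : ℝ) - 1 - (m : ℕ))⁻¹)

/-- `d : ℕ → ℝ → ℂ` is the derivative tower of a solution `y = d 0` of equation (1.1),
`y^{(n)} + Σ_{m=0}^{n−2} p_m(x) y^{(m)} = ρ^n y`, on `[0,T]`: `d ν` has derivative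
`d (ν+1)` on `[0,T]` for `ν < n−1`, `d (n−1)` is absolutely continuous with integrable
a.e. derivative `d n`, and the equation holds a.e. on `[0,T]`. -/
def IsSolutionODE (n : ℕ) (T : ℝ) (p : Fin (n - 1) → ℝ → ℂ) (ρ : ℂ)
    (d : ℕ → ℝ → ℂ) : Prop :=
  (∀ ν < n - 1, ∀ x ∈ Set.Icc (0 : ℝ) T,
      HasDerivWithinAt (d ν) (d (ν + 1) x) (Set.Icc (0 : ℝ) T) x) ∧
  IntervalIntegrable (d n) volume 0 T ∧
  (∀ x ∈ Set.Icc (0 : ℝ) T, d (n - 1) x = d (n - 1) 0 + ∫ t in (0 : ℝ)..x, d n t) ∧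
  (∀ᵐ x ∂(volume.restrict (Set.Icc (0 : ℝ) T)),
      d n x + ∑ m : Fin (n - 1), p m x * d (m : ℕ) x = ρ ^ n * d 0 x)

theorem sub_two_lt_sub_one {n : ℕ} (hn : 2 ≤ n) : n - 2 < n - 1 := by omega

theorem AbsolutelyContinuousOnInterval.of_dist_le {X Z : Type*} [PseudoMetricSpace X]
    [PseudoMetricSpace Z] {f : ℝ → X} {h : ℝ → Z} {a b K : ℝ}
    (hh : AbsolutelyContinuousOnInterval h a b)
    (hd : ∀ x ∈ uIcc a b, ∀ y ∈ uIcc a b, dist (f x) (f y) ≤ K * dist (h x) (h y)) :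
    AbsolutelyContinuousOnInterval f a b := by
  unfold AbsolutelyContinuousOnInterval at hh ⊢
  apply squeeze_zero' ?_ ?_ (by simpa using hh.const_mul K)
  · exact Filter.Eventually.of_forall fun _ => Finset.sum_nonneg fun i _ => dist_nonneg
  · rw [Filter.eventually_inf_principal]
    filter_upwards with (n, I) hnI
    rw [Finset.mul_sum]
    gcongr with i hi
    simp only [AbsolutelyContinuousOnInterval.disjWithin, mem_ofPred_eq] at hnI
    exact hd _ (hnI.left i hi).1 _ (hnI.left i hi).2

theorem IntervalIntegrable.mono_mem {E : Type*} [NormedAddCommGroup E] {g : ℝ → E} {a b : ℝ}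
    (hg : IntervalIntegrable g volume a b) {x y : ℝ}
    (hx : x ∈ uIcc a b) (hy : y ∈ uIcc a b) : IntervalIntegrable g volume x y :=
  hg.mono_set (uIcc_subset_uIcc hx hy)

theorem absolutelyContinuousOnInterval_integral {E : Type*} [NormedAddCommGroup E]
    [NormedSpace ℝ E] {g : ℝ → E} {a b c : ℝ}
    (hg : IntervalIntegrable g volume a b) (hc : c ∈ uIcc a b) :
    AbsolutelyContinuousOnInterval (fun x => ∫ t in c..x, g t) a b := by
  refine (hg.norm.absolutelyContinuousOnInterval_intervalIntegral hc).of_dist_le (K := 1) ?_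
  intro x hx y hy
  rw [dist_eq_norm, one_mul, Real.dist_eq,
    intervalIntegral.integral_interval_sub_left (hg.mono_mem hc hx) (hg.mono_mem hc hy),
    intervalIntegral.integral_interval_sub_left (hg.norm.mono_mem hc hx) (hg.norm.mono_mem hc hy)]
  exact intervalIntegral.norm_integral_le_abs_integral_norm

theorem AbsolutelyContinuousOnInterval.integral_eq_sub_of_ae_hasDerivAt {E : Type*}
    [NormedAddCommGroup E] [NormedSpace ℝ E] [CompleteSpace E] {f f' : ℝ → E} {a b : ℝ}
    (hf : AbsolutelyContinuousOnInterval f a b)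
    (hd : ∀ᵐ x, x ∈ uIcc a b → HasDerivAt f (f' x) x)
    (hf' : IntervalIntegrable f' volume a b) :
    ∫ x in a..b, f' x = f b - f a := by
  have h1 := absolutelyContinuousOnInterval_integral hf' (left_mem_uIcc)
  have h2 : ∀ᵐ x, x ∈ uIcc a b → HasDerivAt (fun x => f x - ∫ t in a..x, f' t) 0 x := by
    filter_upwards [hd, hf'.ae_hasDerivAt_integral] with x hx₁ hx₂ hx₃
    simpa using (hx₁ hx₃).fun_sub (hx₂ hx₃ a left_mem_uIcc)
  obtain ⟨C, hC⟩ := (hf.fun_sub h1).const_of_ae_hasDerivAt_zero h2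
  have ha := hC a left_mem_uIcc
  have hb := hC b right_mem_uIcc
  simp only [intervalIntegral.integral_same, sub_zero] at ha
  rw [ha, ← hb]; abel

theorem integral_mul_cosh_primitive {g : ℝ → ℝ} {a b c : ℝ}
    (hg : IntervalIntegrable g volume a b) (hc : c ∈ uIcc a b) {x : ℝ} (hx : x ∈ uIcc a b)
    {l : ℝ} (hl : l ≠ 0) :
    ∫ t in c..x, g t * Real.cosh (l * ∫ s in c..t, g s) =
      Real.sinh (l * ∫ s in c..x, g s) / l := by
  have hg' := hg.mono_mem hc hx
  have hG := absolutelyContinuousOnInterval_integral hg' left_mem_uIcc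
  obtain ⟨B, hB⟩ := hG.exists_bound
  have hsm : ContDiffOn ℝ 1 (fun y : ℝ => Real.sinh (l * y) / l) (Icc (-B) B) := by fun_prop
  obtain ⟨K, hK⟩ := hsm.exists_lipschitzOnWith (by decide) (convex_Icc _ _) isCompact_Icc
  have hmem : ∀ y ∈ uIcc c x, (∫ s in c..y, g s) ∈ Icc (-B) B := fun y hy => abs_le.1 (hB y hy)
  have hac : AbsolutelyContinuousOnInterval
      (fun t => Real.sinh (l * ∫ s in c..t, g s) / l) c x :=
    hG.of_dist_le (K := K) fun y hy z hz => hK.dist_le_mul _ (hmem y hy) _ (hmem z hz)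
  rw [hac.integral_eq_sub_of_ae_hasDerivAt]
  · simp
  · filter_upwards [hg'.ae_hasDerivAt_integral] with y hy hyx
    have := ((hy hyx c left_mem_uIcc).const_mul l).sinh.div_const l
    convert! this using 1
    field_simp
  · apply hg'.mul_continuousOn
    exact Real.continuous_cosh.comp_continuousOn (continuousOn_const.mul hG.continuousOn)

theorem exp_mul_sub_eq_integral {F g : ℝ → ℂ} {a b c : ℝ} (l : ℂ)
    (hg : IntervalIntegrable g volume a b) (hc : c ∈ uIcc a b)
    (hF : ∀ x ∈ uIcc a b, F x = F c + ∫ t in c..x, g t) {x : ℝ} (hx : x ∈ uIcc a b) :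
    Complex.exp (l * x) * F x - Complex.exp (l * c) * F c =
      ∫ t in c..x, Complex.exp (l * t) * (l * F t + g t) := by
  have hg' := hg.mono_mem hc hx
  set P : ℝ → ℂ := fun x => F c + ∫ t in c..x, g t with hP
  have hsub : uIcc c x ⊆ uIcc a b := uIcc_subset_uIcc hc hx
  have hPF : ∀ y ∈ uIcc c x, F y = P y := fun y hy => hF y (hsub hy)
  have hG : AbsolutelyContinuousOnInterval P c x :=
    (absolutelyContinuousOnInterval_integral hg' left_mem_uIcc).of_dist_le (K := 1)
      (fun y _ z _ => by simp [hP])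
  have hE : AbsolutelyContinuousOnInterval (fun t : ℝ => Complex.exp (l * t)) c x := by
    apply ContDiffOn.absolutelyContinuousOnInterval
    apply ContDiff.contDiffOn
    apply Complex.contDiff_exp.comp (𝕜 := ℝ)
    exact contDiff_const.mul Complex.ofRealCLM.contDiff
  have hac := hE.fun_smul hG
  have := hac.integral_eq_sub_of_ae_hasDerivAt
    (f' := fun t => Complex.exp (l * t) * (l * P t + g t)) ?_ ?_
  · rw [hPF x right_mem_uIcc, hPF c left_mem_uIcc]
    rw [smul_eq_mul, smul_eq_mul] at this
    rw [← this]
    apply intervalIntegral.integral_congr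
    intro t ht
    simp only [hPF t ht]
  · filter_upwards [hg'.ae_hasDerivAt_integral] with y hy hyx
    have h1 := (hy hyx c left_mem_uIcc).const_add (F c)
    have h2 : HasDerivAt (fun t : ℝ => Complex.exp (l * t)) (Complex.exp (l * y) * (l * 1)) y :=
      ((Complex.ofRealCLM.hasDerivAt (x := y)).const_mul l).cexp
    have := h2.mul h1
    simp only [smul_eq_mul]
    convert! this using 1
    ring
  · apply IntervalIntegrable.continuousOn_mul _ hE.continuousOn
    exact (continuousOn_const.mul hG.continuousOn).intervalIntegrable.add hg'

/-- The operator `u ↦ (x ↦ ∫ t in c..x, g t * u t)` on `C([0,T], ℂ)`. -/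
noncomputable def primOp {T : ℝ} (hT : 0 ≤ T) (c : Icc (0 : ℝ) T) (g : ℝ → ℂ)
    (hg : IntervalIntegrable g volume 0 T) : C(Icc (0 : ℝ) T, ℂ) →L[ℂ] C(Icc (0 : ℝ) T, ℂ) :=
  have hi : ∀ (u : C(Icc (0 : ℝ) T, ℂ)),
      IntervalIntegrable (fun t => g t * u (projIcc 0 T hT t)) volume 0 T := fun u =>
    hg.mul_continuousOn (u.continuous.comp continuous_projIcc).continuousOn
  have hm : ∀ x : Icc (0 : ℝ) T, (x : ℝ) ∈ uIcc 0 T := fun x => by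
    rw [uIcc_of_le hT]; exact x.2
  LinearMap.mkContinuous
    { toFun := fun u => ⟨fun x => ∫ t in (c : ℝ)..x, g t * u (projIcc 0 T hT t), by
        have h := (absolutelyContinuousOnInterval_integral (hi u) (hm c)).continuousOn
        exact h.comp_continuous continuous_subtype_val hm⟩
      map_add' := fun u v => by
        ext x
        simp only [ContinuousMap.coe_mk, ContinuousMap.add_apply, mul_add]
        exact intervalIntegral.integral_add ((hi u).mono_mem (hm c) (hm x))
          ((hi v).mono_mem (hm c) (hm x))
      map_smul' := fun r u => by
        ext x
        simp only [ContinuousMap.coe_mk, ContinuousMap.smul_apply, smul_eq_mul, RingHom.id_apply]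
        rw [← intervalIntegral.integral_const_mul]
        congr 1; ext t; ring }
    (∫ t in (0 : ℝ)..T, ‖g t‖) fun u => by
      have h0 : 0 ≤ ∫ t in (0 : ℝ)..T, ‖g t‖ :=
        intervalIntegral.integral_nonneg hT fun _ _ => norm_nonneg _
      rw [ContinuousMap.norm_le _ (by positivity)]
      intro x
      change ‖∫ t in (c : ℝ)..x, g t * u (projIcc 0 T hT t)‖ ≤ _
      have h1 : ‖∫ t in (c : ℝ)..x, g t * u (projIcc 0 T hT t)‖ ≤
          ∫ t in uIoc (c : ℝ) x, ‖g t‖ * ‖u‖ := by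
        refine (intervalIntegral.norm_integral_le_integral_norm_uIoc).trans ?_
        refine setIntegral_mono_on ?_ ?_ measurableSet_uIoc ?_
        · exact (intervalIntegrable_iff.1 ((hi u).mono_mem (hm c) (hm x))).norm
        · exact (intervalIntegrable_iff.1 ((hg.norm.mul_const _).mono_mem (hm c) (hm x)))
        · intro t _
          rw [norm_mul]
          gcongr
          exact u.norm_coe_le_norm _
      refine h1.trans ?_
      rw [← intervalIntegral.integral_mul_const, intervalIntegral.integral_of_le hT]
      refine setIntegral_mono_set ?_ ?_ ?_
      · exact (intervalIntegrable_iff_integrableOn_Ioc_of_le hT).1 (hg.norm.mul_const _)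
      · exact Filter.Eventually.of_forall fun t => by positivity
      · apply LE.le.eventuallyLE
        exact Ioc_subset_Ioc (le_min c.2.1 x.2.1) (max_le c.2.2 x.2.2)

theorem primOp_apply {T : ℝ} (hT : 0 ≤ T) (c : Icc (0 : ℝ) T) {g : ℝ → ℂ}
    (hg : IntervalIntegrable g volume 0 T) (u : C(Icc (0 : ℝ) T, ℂ)) (x : Icc (0 : ℝ) T) :
    primOp hT c g hg u x = ∫ t in (c : ℝ)..x, g t * u (projIcc 0 T hT t) := rfl

/-- Componentwise multiplication by a continuous function. -/
noncomputable def mulOp (n : ℕ) {T : ℝ} (w : C(Icc (0 : ℝ) T, ℂ)) :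
    (Fin n → C(Icc (0 : ℝ) T, ℂ)) →L[ℂ] (Fin n → C(Icc (0 : ℝ) T, ℂ)) :=
  ContinuousLinearMap.pi fun j =>
    (ContinuousLinearMap.mul ℂ C(Icc (0 : ℝ) T, ℂ) w).comp (ContinuousLinearMap.proj j)

theorem mulOp_apply (n : ℕ) {T : ℝ} (w : C(Icc (0 : ℝ) T, ℂ))
    (u : Fin n → C(Icc (0 : ℝ) T, ℂ)) (j : Fin n) : mulOp n w u j = w * u j := rfl

theorem mulOp_mul_mulOp (n : ℕ) {T : ℝ} {w w' : C(Icc (0 : ℝ) T, ℂ)} (h : w * w' = 1) :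
    mulOp n w * mulOp n w' = 1 := by
  ext u j x
  simp [mulOp_apply, ← mul_assoc, h]

theorem mul_one_sub_mul_mul_eq {A : Type*} [Ring A] {a b x : A} (h : a * b = 1) :
    a * (1 - b * x * a) * b = 1 - x := by
  calc a * (1 - b * x * a) * b = a * b - (a * b) * x * (a * b) := by noncomm_ring
    _ = 1 - x := by rw [h, one_mul, mul_one]

theorem isUnit_one_sub_of_volterra_bound {n : ℕ} {T : ℝ} (hT : 0 ≤ T) (c : Icc (0 : ℝ) T)
    {g : ℝ → ℝ} (hg : IntervalIntegrable g volume 0 T)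
    (J : (Fin n → C(Icc (0 : ℝ) T, ℂ)) →L[ℂ] (Fin n → C(Icc (0 : ℝ) T, ℂ)))
    (hJ : ∀ (u : Fin n → C(Icc (0 : ℝ) T, ℂ)) (h : ℝ → ℝ), ContinuousOn h (Icc 0 T) →
      (∀ i (t : Icc (0 : ℝ) T), ‖u i t‖ ≤ h t) →
      ∀ j (x : Icc (0 : ℝ) T), ‖J u j x‖ ≤ |∫ t in (c : ℝ)..x, g t * h t|) :
    IsUnit (1 - J) := by
  have hm : ∀ x : Icc (0 : ℝ) T, (x : ℝ) ∈ uIcc 0 T := fun x => by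
    rw [uIcc_of_le hT]; exact x.2
  set G : ℝ → ℝ := fun x => ∫ t in (c : ℝ)..x, g t with hGdef
  have hG : ContinuousOn G (Icc 0 T) := by
    have := (absolutelyContinuousOnInterval_integral hg (hm c)).continuousOn
    rwa [uIcc_of_le hT] at this
  have hch : ContinuousOn (fun x => Real.cosh (2 * G x)) (Icc 0 T) :=
    Real.continuous_cosh.comp_continuousOn (continuousOn_const.mul hG)
  have hch' := hch.comp_continuous continuous_subtype_val (fun x : Icc (0 : ℝ) T => x.2)
  set w : C(Icc (0 : ℝ) T, ℂ) := ⟨fun x => (Real.cosh (2 * G x) : ℂ),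
    Complex.continuous_ofReal.comp hch'⟩ with hw
  set w' : C(Icc (0 : ℝ) T, ℂ) := ⟨fun x => (((Real.cosh (2 * G x))⁻¹ : ℝ) : ℂ),
    Complex.continuous_ofReal.comp (hch'.inv₀ fun x => (Real.cosh_pos _).ne')⟩ with hw'
  have h1 : w' * w = 1 := by
    ext x
    simp only [hw, hw', ContinuousMap.mul_apply, ContinuousMap.coe_mk, ContinuousMap.one_apply,
      ← Complex.ofReal_mul]
    rw [inv_mul_cancel₀ (Real.cosh_pos _).ne', Complex.ofReal_one]
  have hm1 := mulOp_mul_mulOp n h1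
  have hm2 := mulOp_mul_mulOp n (mul_comm w' w ▸ h1)
  have hbound : ‖mulOp n w' * J * mulOp n w‖ ≤ 1 / 2 := by
    refine ContinuousLinearMap.opNorm_le_bound _ (by norm_num) fun u => ?_
    rw [pi_norm_le_iff_of_nonneg (by positivity)]
    intro j
    rw [ContinuousMap.norm_le _ (by positivity)]
    intro x
    have h2 := hJ (mulOp n w u) (fun t => Real.cosh (2 * G t) * ‖u‖)
      (hch.mul continuousOn_const) (fun i t => by
        rw [mulOp_apply, ContinuousMap.mul_apply, norm_mul]
        gcongr
        · simp only [hw, ContinuousMap.coe_mk, Complex.norm_real]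
          rw [Real.norm_eq_abs, abs_of_pos (Real.cosh_pos _)]
        · exact ((u i).norm_coe_le_norm t).trans (norm_le_pi_norm u i)) j x
    have h3 : (∫ t in (c : ℝ)..x, g t * (Real.cosh (2 * G t) * ‖u‖)) =
        Real.sinh (2 * G x) / 2 * ‖u‖ := by
      rw [← integral_mul_cosh_primitive hg (hm c) (hm x) two_ne_zero,
        ← intervalIntegral.integral_mul_const]
      congr 1; ext t; ring
    rw [h3, abs_mul, abs_norm, abs_div, abs_two] at h2
    have h4 : |Real.sinh (2 * G x)| ≤ Real.cosh (2 * G x) := by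
      rw [abs_le]
      constructor
      · have := Real.exp_pos (2 * G x)
        rw [← Real.cosh_add_sinh] at this; linarith
      · exact (Real.sinh_lt_cosh _).le
    change ‖(w' * (J (mulOp n w u) j)) x‖ ≤ _
    rw [ContinuousMap.mul_apply, norm_mul]
    have h5 : ‖w' x‖ = (Real.cosh (2 * G x))⁻¹ := by
      simp only [hw', ContinuousMap.coe_mk, Complex.norm_real]
      rw [Real.norm_eq_abs, abs_of_pos (inv_pos.2 (Real.cosh_pos _))]
    rw [h5]
    have hc0 := Real.cosh_pos (2 * G x)
    calc (Real.cosh (2 * G x))⁻¹ * ‖J (mulOp n w u) j x‖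
        ≤ (Real.cosh (2 * G x))⁻¹ * (Real.cosh (2 * G x) / 2 * ‖u‖) := by
          gcongr
          exact h2.trans (by gcongr)
      _ = 1 / 2 * ‖u‖ := by field_simp
  have hu := isUnit_one_sub_of_norm_lt_one
    (x := mulOp n w' * J * mulOp n w) (lt_of_le_of_lt hbound (by norm_num))
  have hU : IsUnit (mulOp n w) := ⟨⟨mulOp n w, mulOp n w', hm2, hm1⟩, rfl⟩
  have hU' : IsUnit (mulOp n w') := ⟨⟨mulOp n w', mulOp n w, hm1, hm2⟩, rfl⟩
  have := (hU.mul hu).mul hU'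
  rwa [mul_one_sub_mul_mul_eq hm2] at this

/-- The matrix Volterra operator `(J u)_j (x) = ∑ i, ∫ t in c..x, M j i t * u i t`. -/
noncomputable def volterra {n : ℕ} {T : ℝ} (hT : 0 ≤ T) (c : Icc (0 : ℝ) T)
    (M : Fin n → Fin n → ℝ → ℂ) (hM : ∀ j i, IntervalIntegrable (M j i) volume 0 T) :
    (Fin n → C(Icc (0 : ℝ) T, ℂ)) →L[ℂ] (Fin n → C(Icc (0 : ℝ) T, ℂ)) :=
  ContinuousLinearMap.pi fun j =>
    ∑ i, (primOp hT c (M j i) (hM j i)).comp (ContinuousLinearMap.proj i)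

theorem volterra_apply {n : ℕ} {T : ℝ} (hT : 0 ≤ T) (c : Icc (0 : ℝ) T)
    {M : Fin n → Fin n → ℝ → ℂ} (hM : ∀ j i, IntervalIntegrable (M j i) volume 0 T)
    (u : Fin n → C(Icc (0 : ℝ) T, ℂ)) (j : Fin n) (x : Icc (0 : ℝ) T) :
    volterra hT c M hM u j x =
      ∫ t in (c : ℝ)..x, ∑ i, M j i t * u i (projIcc 0 T hT t) := by
  have hm : ∀ x : Icc (0 : ℝ) T, (x : ℝ) ∈ uIcc 0 T := fun x => by
    rw [uIcc_of_le hT]; exact x.2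
  rw [intervalIntegral.integral_finsetSum]
  · simp [volterra, primOp_apply]
  · intro i _
    refine IntervalIntegrable.mono_mem ?_ (hm c) (hm x)
    exact (hM j i).mul_continuousOn ((u i).continuous.comp continuous_projIcc).continuousOn

theorem isUnit_one_sub_volterra {n : ℕ} {T : ℝ} (hT : 0 ≤ T) (c : Icc (0 : ℝ) T)
    {M : Fin n → Fin n → ℝ → ℂ} (hM : ∀ j i, IntervalIntegrable (M j i) volume 0 T) :
    IsUnit (1 - volterra hT c M hM) := by
  have hm : ∀ x : Icc (0 : ℝ) T, (x : ℝ) ∈ uIcc 0 T := fun x => by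
    rw [uIcc_of_le hT]; exact x.2
  have hgi : IntervalIntegrable (fun t => ∑ j, ∑ i, ‖M j i t‖) volume 0 T := by
    have e : (fun t => ∑ j, ∑ i, ‖M j i t‖) = ∑ j, ∑ i, fun t => ‖M j i t‖ := by
      ext t; simp
    rw [e]
    exact IntervalIntegrable.sum _ fun j _ => IntervalIntegrable.sum _ fun i _ => (hM j i).norm
  refine isUnit_one_sub_of_volterra_bound hT c hgi _ fun u h hh hu j x => ?_
  rw [volterra_apply]
  refine intervalIntegral.norm_integral_le_abs_of_norm_le ?_ ?_
  · refine (ae_restrict_mem measurableSet_uIoc).mono fun t ht => ?_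
    have ht' : t ∈ Icc 0 T := by
      have := uIcc_subset_uIcc (hm c) (hm x) (uIoc_subset_uIcc ht)
      rwa [uIcc_of_le hT] at this
    have h2 : ∀ i, ‖u i (projIcc 0 T hT t)‖ ≤ h t := fun i => by
      have := hu i (projIcc 0 T hT t)
      rwa [projIcc_of_mem hT ht'] at this ⊢
    refine (norm_sum_le _ _).trans ?_
    have h0 : 0 ≤ h t := (norm_nonneg _).trans (h2 j)
    calc ∑ i, ‖M j i t * u i (projIcc 0 T hT t)‖ ≤ ∑ i, ‖M j i t‖ * h t := by
          gcongr with i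
          rw [norm_mul]
          gcongr
          exact h2 i
      _ = (∑ i, ‖M j i t‖) * h t := by rw [Finset.sum_mul]
      _ ≤ _ := by
          refine mul_le_mul_of_nonneg_right ?_ h0
          exact Finset.single_le_sum (f := fun j => ∑ i, ‖M j i t‖)
            (fun j _ => Finset.sum_nonneg fun i _ => norm_nonneg _) (Finset.mem_univ j)
  · refine IntervalIntegrable.mono_mem ?_ (hm c) (hm x)
    exact hgi.mul_continuousOn (by rwa [uIcc_of_le hT])

/-- The function `x ↦ exp (s * x)` on `[0,T]`. -/
noncomputable def expFun (T : ℝ) (s : ℂ) : C(Icc (0 : ℝ) T, ℂ) :=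
  ⟨fun x => Complex.exp (s * (x : ℝ)), by fun_prop⟩

theorem differentiable_expFun (T : ℝ) : Differentiable ℂ (expFun T) := by
  set f : C(Icc (0 : ℝ) T, ℂ) := ⟨fun x => ((x : ℝ) : ℂ), by fun_prop⟩ with hf
  have h : expFun T = fun s : ℂ => NormedSpace.exp (s • f) := by
    funext s
    ext x
    have := NormedSpace.map_exp (ContinuousMap.evalAlgHom ℂ ℂ x)
      (by exact continuous_eval_const x) (s • f)
    change _ = ContinuousMap.evalAlgHom ℂ ℂ x (NormedSpace.exp (s • f))
    rw [this, ← Complex.exp_eq_exp_ℂ]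
    rfl
  rw [h]
  intro s
  exact (hasDerivAt_exp_smul_const f s).differentiableAt

/-- The matrix of the first-order system equivalent to `y⁽ⁿ⁾ + ∑ p_m y⁽ᵐ⁾ = τ y`. -/
def odeMat (n : ℕ) (p : Fin (n - 1) → ℝ → ℂ) (τ : ℂ) (j i : Fin n) (t : ℝ) : ℂ :=
  (if (j : ℕ) + 1 = i then 1 else
    if h : (j : ℕ) = n - 1 ∧ (i : ℕ) < n - 1 then -p ⟨i, h.2⟩ t else 0) +
  τ * (if (j : ℕ) = n - 1 ∧ (i : ℕ) = 0 then 1 else 0)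

theorem sum_odeMat_mul_of_lt {n : ℕ} (p : Fin (n - 1) → ℝ → ℂ) (τ : ℂ) (t : ℝ) (v : Fin n → ℂ)
    {j : Fin n} (hj : (j : ℕ) + 1 < n) :
    ∑ i, odeMat n p τ j i t * v i = v ⟨j + 1, hj⟩ := by
  rw [Finset.sum_eq_single ⟨j + 1, hj⟩]
  · simp [odeMat, show (j : ℕ) ≠ n - 1 by omega]
  · intro i _ hi
    have : (j : ℕ) + 1 ≠ i := fun h => hi (Fin.ext h.symm)
    simp [odeMat, show (j : ℕ) ≠ n - 1 by omega, this]
  · simp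

theorem sum_odeMat_mul_of_eq {n : ℕ} (hn : 2 ≤ n) (p : Fin (n - 1) → ℝ → ℂ) (τ : ℂ) (t : ℝ)
    (v : Fin n → ℂ) {j : Fin n} (hj : (j : ℕ) = n - 1) :
    ∑ i, odeMat n p τ j i t * v i =
      τ * v ⟨0, by omega⟩ - ∑ m : Fin (n - 1), p m t * v ⟨m, by omega⟩ := by
  obtain ⟨k, rfl⟩ : ∃ k, n = k + 2 := ⟨n - 2, by omega⟩
  have hj' : (j : ℕ) = k + 1 := hj
  have h2 : ∀ i : Fin (k + 2), odeMat (k + 2) p τ j i t =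
      (if h : (i : ℕ) < k + 1 then -p ⟨i, h⟩ t else 0) + τ * (if (i : ℕ) = 0 then 1 else 0) := by
    intro i
    have : (j : ℕ) + 1 ≠ i := by omega
    rw [odeMat, if_neg this]
    simp [hj']
  simp only [h2, add_mul, Finset.sum_add_distrib]
  rw [add_comm, sub_eq_add_neg, ← Finset.sum_neg_distrib]
  congr 1
  · rw [Finset.sum_eq_single ⟨0, by omega⟩]
    · simp
    · intro i _ hi
      have : (i : ℕ) ≠ 0 := fun h => hi (Fin.ext h)
      simp [this]
    · simp
  · rw [Fin.sum_univ_castSucc]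
    simp only [Fin.val_castSucc, Fin.val_last, lt_irrefl, dite_false, zero_mul, add_zero]
    refine Finset.sum_congr rfl fun m _ => ?_
    rw [dif_pos m.2, neg_mul]
    rfl

theorem intervalIntegrable_odeMat {n : ℕ} {T : ℝ} {p : Fin (n - 1) → ℝ → ℂ}
    (hp : ∀ m, IntervalIntegrable (p m) volume 0 T) (τ : ℂ) (j i : Fin n) :
    IntervalIntegrable (odeMat n p τ j i) volume 0 T := by
  unfold odeMat
  refine IntervalIntegrable.add ?_ intervalIntegrable_const
  by_cases h1 : (j : ℕ) + 1 = i
  · simp only [h1, if_true]; exact intervalIntegrable_const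
  · by_cases h2 : (j : ℕ) = n - 1 ∧ (i : ℕ) < n - 1
    · simp only [if_neg h1, dif_pos h2]; exact (hp _).neg
    · simp only [h1, h2, if_false, dite_false]; exact intervalIntegrable_const

theorem differentiableAt_const_sub_add_smul {F : Type*} [NormedAddCommGroup F] [NormedSpace ℂ F]
    (a b c : F) (τ : ℂ) : DifferentiableAt ℂ (fun τ : ℂ => a - (b + τ • c)) τ := by
  fun_prop

section
variable {n : ℕ} {T : ℝ} (hT : 0 ≤ T) (c : Icc (0 : ℝ) T) {p : Fin (n - 1) → ℝ → ℂ}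
  (hp : ∀ m, IntervalIntegrable (p m) volume 0 T)

/-- The Volterra operator of the first-order system with base point `c`. -/
noncomputable def odeOp (τ : ℂ) :
    (Fin n → C(Icc (0 : ℝ) T, ℂ)) →L[ℂ] (Fin n → C(Icc (0 : ℝ) T, ℂ)) :=
  volterra hT c (odeMat n p τ) (intervalIntegrable_odeMat hp τ)

theorem isUnit_one_sub_odeOp (τ : ℂ) : IsUnit (1 - odeOp hT c hp τ) :=
  isUnit_one_sub_volterra _ _ _

theorem odeOp_eq (τ : ℂ) :
    odeOp hT c hp τ = odeOp hT c hp 0 + τ • (odeOp hT c hp 1 - odeOp hT c hp 0) := by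
  have hm : ∀ x : Icc (0 : ℝ) T, (x : ℝ) ∈ uIcc 0 T := fun x => by
    rw [uIcc_of_le hT]; exact x.2
  have hi : ∀ (u : Fin n → C(Icc (0 : ℝ) T, ℂ)) (τ : ℂ) (j : Fin n) (x : Icc (0 : ℝ) T),
      IntervalIntegrable (fun t => ∑ i, odeMat n p τ j i t * u i (projIcc 0 T hT t)) volume c x := by
    intro u τ j x
    refine IntervalIntegrable.mono_mem ?_ (hm c) (hm x)
    have e : (fun t => ∑ i, odeMat n p τ j i t * u i (projIcc 0 T hT t)) =
      ∑ i, fun t => odeMat n p τ j i t * u i (projIcc 0 T hT t) := by ext t; simp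
    rw [e]
    exact IntervalIntegrable.sum _ fun i _ => (intervalIntegrable_odeMat hp τ j i).mul_continuousOn
      ((u i).continuous.comp continuous_projIcc).continuousOn
  ext u j x
  change odeOp hT c hp τ u j x = odeOp hT c hp 0 u j x +
    τ * (odeOp hT c hp 1 u j x - odeOp hT c hp 0 u j x)
  simp only [odeOp, volterra_apply]
  rw [← intervalIntegral.integral_sub (hi u 1 j x) (hi u 0 j x),
    ← intervalIntegral.integral_const_mul,
    ← intervalIntegral.integral_add (hi u 0 j x) (((hi u 1 j x).sub (hi u 0 j x)).const_mul τ)]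
  congr 1
  ext t
  rw [← Finset.sum_sub_distrib, Finset.mul_sum, ← Finset.sum_add_distrib]
  refine Finset.sum_congr rfl fun i _ => ?_
  simp only [odeMat]
  ring

/-- The embedding of constant vectors. -/
noncomputable def constVec (n : ℕ) (T : ℝ) :
    (Fin n → ℂ) →L[ℂ] (Fin n → C(Icc (0 : ℝ) T, ℂ)) :=
  LinearMap.toContinuousLinearMap
    { toFun := fun b j => ContinuousMap.const _ (b j)
      map_add' := fun _ _ => rfl
      map_smul' := fun _ _ => rfl }

theorem constVec_apply (b : Fin n → ℂ) (j : Fin n) (x : Icc (0 : ℝ) T) :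
    constVec n T b j x = b j := rfl

/-- The solution of the first-order system with data `b` at `c`. -/
noncomputable def odeSol (τ : ℂ) : (Fin n → ℂ) →L[ℂ] (Fin n → C(Icc (0 : ℝ) T, ℂ)) :=
  (Ring.inverse (1 - odeOp hT c hp τ)).comp (constVec n T)

theorem differentiable_odeSol : Differentiable ℂ (odeSol hT c hp) := by
  intro τ
  have h1 : DifferentiableAt ℂ (fun τ => 1 - odeOp hT c hp τ) τ := by
    have : (fun τ => 1 - odeOp hT c hp τ) = fun τ =>
        1 - (odeOp hT c hp 0 + τ • (odeOp hT c hp 1 - odeOp hT c hp 0)) := by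
      funext τ; rw [odeOp_eq]
    rw [this]
    exact differentiableAt_const_sub_add_smul 1 (odeOp hT c hp 0) _ τ
  exact (h1.inverse (isUnit_one_sub_odeOp hT c hp τ)).clm_comp (differentiableAt_const _)

theorem odeSol_eq_add_odeOp (τ : ℂ) (b : Fin n → ℂ) :
    odeSol hT c hp τ b = constVec n T b + odeOp hT c hp τ (odeSol hT c hp τ b) := by
  have h := Ring.mul_inverse_cancel _ (isUnit_one_sub_odeOp hT c hp τ)
  have h2 : ((1 - odeOp hT c hp τ) * Ring.inverse (1 - odeOp hT c hp τ)) (constVec n T b) =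
    constVec n T b := by rw [h]; rfl
  change odeSol hT c hp τ b - odeOp hT c hp τ (odeSol hT c hp τ b) = _ at h2
  rw [← h2]; abel

theorem odeSol_apply_of_lt (τ : ℂ) (b : Fin n → ℂ) {j : Fin n} (hj : (j : ℕ) + 1 < n)
    (x : Icc (0 : ℝ) T) :
    odeSol hT c hp τ b j x =
      b j + ∫ t in (c : ℝ)..x, odeSol hT c hp τ b ⟨j + 1, hj⟩ (projIcc 0 T hT t) := by
  conv_lhs => rw [odeSol_eq_add_odeOp]
  rw [Pi.add_apply, ContinuousMap.add_apply, constVec_apply, odeOp, volterra_apply]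
  simp only [sum_odeMat_mul_of_lt p τ _
    (fun i => odeSol hT c hp τ b i (projIcc 0 T hT _)) hj]

theorem odeSol_apply_of_eq (hn : 2 ≤ n) (τ : ℂ) (b : Fin n → ℂ) {j : Fin n}
    (hj : (j : ℕ) = n - 1) (x : Icc (0 : ℝ) T) :
    odeSol hT c hp τ b j x =
      b j + ∫ t in (c : ℝ)..x, (τ * odeSol hT c hp τ b ⟨0, by omega⟩ (projIcc 0 T hT t) -
        ∑ m : Fin (n - 1), p m t * odeSol hT c hp τ b ⟨m, by omega⟩ (projIcc 0 T hT t)) := by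
  conv_lhs => rw [odeSol_eq_add_odeOp]
  rw [Pi.add_apply, ContinuousMap.add_apply, constVec_apply, odeOp, volterra_apply]
  simp only [sum_odeMat_mul_of_eq hn p τ _
    (fun i => odeSol hT c hp τ b i (projIcc 0 T hT _)) hj]

theorem odeSol_apply_base (τ : ℂ) (b : Fin n → ℂ) (j : Fin n) :
    odeSol hT c hp τ b j c = b j := by
  rw [odeSol_eq_add_odeOp, Pi.add_apply, ContinuousMap.add_apply, constVec_apply, odeOp,
    volterra_apply]
  simp

theorem eq_zero_of_odeSol_apply_eq_zero (τ : ℂ) (b : Fin n → ℂ) (x₀ : Icc (0 : ℝ) T)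
    (h : ∀ j, odeSol hT c hp τ b j x₀ = 0) : b = 0 := by
  have hm : ∀ x : Icc (0 : ℝ) T, (x : ℝ) ∈ uIcc 0 T := fun x => by
    rw [uIcc_of_le hT]; exact x.2
  set u := odeSol hT c hp τ b with hu
  have hi : ∀ (j : Fin n) (x y : Icc (0 : ℝ) T),
      IntervalIntegrable (fun t => ∑ i, odeMat n p τ j i t * u i (projIcc 0 T hT t)) volume x y := by
    intro j x y
    refine IntervalIntegrable.mono_mem ?_ (hm x) (hm y)
    have e : (fun t => ∑ i, odeMat n p τ j i t * u i (projIcc 0 T hT t)) =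
      ∑ i, fun t => odeMat n p τ j i t * u i (projIcc 0 T hT t) := by ext t; simp
    rw [e]
    exact IntervalIntegrable.sum _ fun i _ => (intervalIntegrable_odeMat hp τ j i).mul_continuousOn
      ((u i).continuous.comp continuous_projIcc).continuousOn
  have h1 : ∀ j x, u j x = b j + odeOp hT c hp τ u j x := fun j x => by
    conv_lhs => rw [hu, odeSol_eq_add_odeOp, ← hu]
    rfl
  have h2 : (1 - odeOp hT x₀ hp τ) u = 0 := by
    ext j x
    change u j x - odeOp hT x₀ hp τ u j x = 0
    have e1 := h1 j x
    have e2 := h1 j x₀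
    rw [h j] at e2
    simp only [odeOp, volterra_apply] at e1 e2 ⊢
    have := intervalIntegral.integral_interval_sub_left (hi j c x) (hi j c x₀)
    rw [e1, ← this]
    linear_combination -e2
  have h3 : u = 0 := by
    have e := Ring.inverse_mul_cancel _ (isUnit_one_sub_odeOp hT x₀ hp τ)
    have : (Ring.inverse (1 - odeOp hT x₀ hp τ) * (1 - odeOp hT x₀ hp τ)) u = u := by rw [e]; rfl
    rw [← this]
    change Ring.inverse (1 - odeOp hT x₀ hp τ) ((1 - odeOp hT x₀ hp τ) u) = 0
    rw [h2, map_zero]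
  ext j
  rw [← odeSol_apply_base hT c hp τ b j, ← hu, h3]
  rfl

/-- The derivatives up to order `n` of the solution of `y⁽ⁿ⁾ + ∑ p_m y⁽ᵐ⁾ = τ y` with data `b`
at the point `c`. -/
noncomputable def odeTower (τ : ℂ) (b : Fin n → ℂ) (ν : ℕ) (x : ℝ) : ℂ :=
  if h : ν < n then odeSol hT c hp τ b ⟨ν, h⟩ (projIcc 0 T hT x) else
    τ * (if h : 0 < n then odeSol hT c hp τ b ⟨0, h⟩ (projIcc 0 T hT x) else 0) -
      ∑ m : Fin (n - 1), p m x * odeSol hT c hp τ b ⟨m, by omega⟩ (projIcc 0 T hT x)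

theorem odeTower_of_lt (τ : ℂ) (b : Fin n → ℂ) {ν : ℕ} (h : ν < n) (x : ℝ) :
    odeTower hT c hp τ b ν x = odeSol hT c hp τ b ⟨ν, h⟩ (projIcc 0 T hT x) := by
  rw [odeTower, dif_pos h]

theorem odeTower_self (hn : 2 ≤ n) (τ : ℂ) (b : Fin n → ℂ) (x : ℝ) :
    odeTower hT c hp τ b n x = 
      τ * odeSol hT c hp τ b ⟨0, by omega⟩ (projIcc 0 T hT x) -
      ∑ m : Fin (n - 1), p m x * odeSol hT c hp τ b ⟨m, by omega⟩ (projIcc 0 T hT x) := by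
  rw [odeTower, dif_neg (lt_irrefl _), dif_pos (by omega)]

theorem intervalIntegrable_odeTower (hn : 2 ≤ n) (τ : ℂ) (b : Fin n → ℂ) :
    IntervalIntegrable (odeTower hT c hp τ b n) volume 0 T := by
  have hc : ∀ j, Continuous fun t => odeSol hT c hp τ b j (projIcc 0 T hT t) :=
    fun j => (odeSol hT c hp τ b j).continuous.comp continuous_projIcc
  have e : odeTower hT c hp τ b n = (fun x => τ * odeSol hT c hp τ b ⟨0, by omega⟩
      (projIcc 0 T hT x)) - ∑ m : Fin (n - 1), fun x =>
        p m x * odeSol hT c hp τ b ⟨m, by omega⟩ (projIcc 0 T hT x) := by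
    ext x; rw [odeTower_self hT c hp hn]; simp
  rw [e]
  refine (continuous_const.mul (hc _)).intervalIntegrable _ _ |>.sub ?_
  exact IntervalIntegrable.sum _ fun m _ => (hp m).mul_continuousOn (hc _).continuousOn

theorem odeTower_pred_eq (hn : 2 ≤ n) (τ : ℂ) (b : Fin n → ℂ) {x : ℝ} (hx : x ∈ Icc 0 T) :
    odeTower hT c hp τ b (n - 1) x = b ⟨n - 1, by omega⟩ +
      ∫ t in (c : ℝ)..x, odeTower hT c hp τ b n t := by
  rw [odeTower_of_lt hT c hp τ b (by omega : n - 1 < n), odeSol_apply_of_eq hT c hp hn τ b rfl,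
    projIcc_of_mem hT hx]
  simp only [odeTower_self hT c hp hn]

theorem isSolutionODE_odeTower (hn : 2 ≤ n) (ρ : ℂ) (b : Fin n → ℂ) :
    IsSolutionODE n T p ρ (odeTower hT c hp (ρ ^ n) b) := by
  have hm : ∀ {x}, x ∈ Icc 0 T → x ∈ uIcc 0 T := fun {x} h => by
    rwa [uIcc_of_le hT]
  have hc : ∀ j, Continuous fun t => odeSol hT c hp (ρ ^ n) b j (projIcc 0 T hT t) :=
    fun j => (odeSol hT c hp (ρ ^ n) b j).continuous.comp continuous_projIcc
  refine ⟨?_, intervalIntegrable_odeTower hT c hp hn _ b, ?_, ?_⟩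
  · intro ν hν x hx
    rw [odeTower_of_lt hT c hp _ b (by omega : ν + 1 < n)]
    have := ((hc ⟨ν + 1, by omega⟩).integral_hasStrictDerivAt (c : ℝ) x).hasDerivAt.const_add
      (b ⟨ν, by omega⟩)
    refine this.hasDerivWithinAt.congr ?_ ?_ 
    · intro y hy
      rw [odeTower_of_lt hT c hp _ b (by omega : ν < n), odeSol_apply_of_lt hT c hp _ b
        (j := ⟨ν, by omega⟩) (by simp; omega), projIcc_of_mem hT hy]
    · rw [odeTower_of_lt hT c hp _ b (by omega : ν < n), odeSol_apply_of_lt hT c hp _ b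
        (j := ⟨ν, by omega⟩) (by simp; omega), projIcc_of_mem hT hx]
  · intro x hx
    have h0 : (0 : ℝ) ∈ Icc 0 T := ⟨le_rfl, hT⟩
    have hi := intervalIntegrable_odeTower hT c hp hn (ρ ^ n) b
    rw [odeTower_pred_eq hT c hp hn _ b hx, odeTower_pred_eq hT c hp hn _ b h0, add_assoc,
      intervalIntegral.integral_add_adjacent_intervals (hi.mono_mem (hm c.2) (hm h0))
        (hi.mono_mem (hm h0) (hm hx))]
  · refine Filter.Eventually.of_forall fun x => ?_
    rw [odeTower_self hT c hp hn, odeTower_of_lt hT c hp _ b (by omega : 0 < n)]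
    have : ∀ m : Fin (n - 1), odeTower hT c hp (ρ ^ n) b m x =
      odeSol hT c hp (ρ ^ n) b ⟨m, by omega⟩ (projIcc 0 T hT x) := fun m =>
        odeTower_of_lt hT c hp _ b _ x
    simp [this]

theorem det_odeTower_ne_zero (τ : ℂ) (b : Fin n → Fin n → ℂ)
    (hb : (Matrix.of fun ν k : Fin n => b k ν).det ≠ 0) (x : ℝ) :
    (Matrix.of fun ν k : Fin n => odeTower hT c hp τ (b k) (ν : ℕ) x).det ≠ 0 := by
  contrapose! hb
  obtain ⟨v, hv, h⟩ := Matrix.exists_mulVec_eq_zero_iff.2 hb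
  refine Matrix.exists_mulVec_eq_zero_iff.1 ⟨v, hv, ?_⟩
  have h1 : odeSol hT c hp τ (∑ k, v k • b k) = ∑ k, v k • odeSol hT c hp τ (b k) := by
    simp
  have h2 := eq_zero_of_odeSol_apply_eq_zero hT c hp τ (∑ k, v k • b k) (projIcc 0 T hT x) (by
    intro j
    rw [h1]
    have := congrFun h j
    simp only [Matrix.mulVec, dotProduct, Matrix.of_apply, Pi.zero_apply] at this
    rw [← this, Finset.sum_apply, ContinuousMap.sum_apply]
    refine Finset.sum_congr rfl fun k _ => ?_
    rw [odeTower_of_lt hT c hp _ _ j.2]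
    simp [mul_comm])
  ext ν
  have := congrFun h2 ν
  simp only [Matrix.mulVec, dotProduct, Matrix.of_apply]
  simpa [mul_comm] using this

theorem analyticAt_odeSol {b : ℂ → Fin n → ℂ} {ρ : ℂ} (hb : AnalyticAt ℂ b ρ) :
    AnalyticAt ℂ (fun ρ => odeSol hT c hp (ρ ^ n) (b ρ)) ρ := by
  have h := (hb.eventually_analyticAt).mono fun z hz => hz.differentiableAt
  rw [Complex.analyticAt_iff_eventually_differentiableAt]
  refine h.mono fun z hz => ?_
  have h1 : DifferentiableAt ℂ (fun ρ : ℂ => ρ ^ n) z := differentiableAt_pow n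
  have : DifferentiableAt ℂ (fun ρ => odeSol hT c hp (ρ ^ n)) z :=
    DifferentiableAt.comp (G := (Fin n → ℂ) →L[ℂ] Fin n → C(Icc (0 : ℝ) T, ℂ))
      (g := odeSol hT c hp) (f := fun ρ : ℂ => ρ ^ n) z (differentiable_odeSol hT c hp (z ^ n)) h1
  exact this.clm_apply hz

theorem analyticAt_odeTower {b : ℂ → Fin n → ℂ} {ρ : ℂ} (hb : AnalyticAt ℂ b ρ) {ν : ℕ}
    (hν : ν < n) (x : ℝ) : AnalyticAt ℂ (fun ρ => odeTower hT c hp (ρ ^ n) (b ρ) ν x) ρ := by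
  simp only [odeTower_of_lt hT c hp _ _ hν]
  exact ((ContinuousMap.evalCLM ℂ (projIcc 0 T hT x)).comp
    (ContinuousLinearMap.proj (R := ℂ) (φ := fun _ : Fin n => C(Icc (0 : ℝ) T, ℂ))
      ⟨ν, hν⟩)).analyticAt _ |>.comp (analyticAt_odeSol hT c hp hb)

theorem continuousOn_odeTower {b : ℂ → Fin n → ℂ} {D : Set ℂ}
    (hb : ∀ ρ ∈ D, AnalyticAt ℂ b ρ) {ν : ℕ} (hν : ν < n) (s : Set ℝ) :
    ContinuousOn (fun q : ℝ × ℂ => odeTower hT c hp (q.2 ^ n) (b q.2) ν q.1) (s ×ˢ D) := by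
  simp only [odeTower_of_lt hT c hp _ _ hν]
  have h1 : ContinuousOn (fun ρ => odeSol hT c hp (ρ ^ n) (b ρ) ⟨ν, hν⟩) D := fun ρ hρ =>
    ((continuous_apply (A := fun _ : Fin n => C(Icc (0 : ℝ) T, ℂ)) _).continuousAt.comp
      (analyticAt_odeSol hT c hp (hb ρ hρ)).continuousAt).continuousWithinAt
  have h2 := h1.comp (continuousOn_snd (s := s ×ˢ D)) fun q hq => hq.2
  exact h2.eval ((continuous_projIcc (h := hT)).comp continuous_fst).continuousOn
end

theorem DifferentiableAt.sum_smul_comp_comp_comp {ι E F : Type*} [NormedAddCommGroup E]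
    [NormedSpace ℂ E] [NormedAddCommGroup F] [NormedSpace ℂ F] (s : Finset ι) {c : ι → ℂ → ℂ}
    {A B : ℂ → F →L[ℂ] F} {z : ℂ} (hc : ∀ m, DifferentiableAt ℂ (c m) z)
    (hA : DifferentiableAt ℂ A z) (hB : DifferentiableAt ℂ B z) (P : ι → F →L[ℂ] F)
    (Q : ι → E →L[ℂ] F) :
    DifferentiableAt ℂ (fun μ => ∑ m ∈ s, c m μ • (A μ).comp ((P m).comp ((B μ).comp (Q m)))) z :=
  DifferentiableAt.fun_sum fun m _ => (hc m).fun_smul (hA.clm_comp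
    ((differentiableAt_const _).clm_comp (hB.clm_comp (differentiableAt_const _))))

theorem DifferentiableAt.sum_const_comp {ι E F G : Type*} [NormedAddCommGroup E]
    [NormedSpace ℂ E] [NormedAddCommGroup F] [NormedSpace ℂ F] [NormedAddCommGroup G]
    [NormedSpace ℂ G] (s : Finset ι) {A : ι → ℂ → E →L[ℂ] F} {z : ℂ}
    (hA : ∀ j, DifferentiableAt ℂ (A j) z) (P : ι → F →L[ℂ] G) :
    DifferentiableAt ℂ (fun μ => ∑ j ∈ s, (P j).comp (A j μ)) z :=
  DifferentiableAt.fun_sum fun j _ => (differentiableAt_const _).clm_comp (hA j)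

theorem DifferentiableAt.clm_const_apply {E F : Type*} [NormedAddCommGroup E] [NormedSpace ℂ E]
    [NormedAddCommGroup F] [NormedSpace ℂ F] (L : E →L[ℂ] F) {f : ℂ → E} {z : ℂ}
    (hf : DifferentiableAt ℂ f z) : DifferentiableAt ℂ (fun z => L (f z)) z :=
  L.differentiableAt.comp z hf

theorem analyticAt_inverse_one_sub_apply {E : Type*} [NormedAddCommGroup E] [NormedSpace ℂ E]
    [CompleteSpace E] {f : ℂ → E →L[ℂ] E} {z : ℂ} (hf : ∀ᶠ w in nhds z, DifferentiableAt ℂ f w)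
    (hu : IsUnit (1 - f z)) (b : E) : AnalyticAt ℂ (fun w => Ring.inverse (1 - f w) b) z := by
  have h2 : ∀ᶠ w in nhds z, IsUnit (1 - f w) :=
    (hf.self_of_nhds.const_sub 1).continuousAt.eventually (Units.isOpen.mem_nhds hu)
  rw [Complex.analyticAt_iff_eventually_differentiableAt]
  filter_upwards [hf, h2] with w hw1 hw2
  exact ((hw1.const_sub _).inverse hw2).clm_apply (differentiableAt_const _)

section
variable {n : ℕ} (R : Fin n → ℂ) {T : ℝ} (hT : 0 ≤ T) {q : Fin (n - 1) → ℝ → ℂ}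
  (hq : ∀ m, IntervalIntegrable (q m) volume 0 T) (k : Fin n)

/-- The base points of the integrations in the Birkhoff integral system. -/
noncomputable def birkBase (j : Fin n) : Icc (0 : ℝ) T :=
  if j ≤ k then ⟨0, le_rfl, hT⟩ else ⟨T, hT, le_rfl⟩

/-- The coefficients `-(R_j / n) μ^{-(n-1-m)}` of the diagonalised system. -/
noncomputable def birkCoeff (μ : ℂ) (j : Fin n) (m : Fin (n - 1)) : ℂ :=
  -(R j / n) * μ⁻¹ ^ (n - 1 - (m : ℕ))

/-- The functional `u ↦ ∑ i, R_i^m u_i`. -/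
noncomputable def rootSum (T : ℝ) (m : ℕ) :
    (Fin n → C(Icc (0 : ℝ) T, ℂ)) →L[ℂ] C(Icc (0 : ℝ) T, ℂ) :=
  ∑ i, R i ^ m • ContinuousLinearMap.proj (R := ℂ) (φ := fun _ : Fin n => C(Icc (0 : ℝ) T, ℂ)) i

theorem rootSum_apply (m : ℕ) (u : Fin n → C(Icc (0 : ℝ) T, ℂ)) (x : Icc (0 : ℝ) T) :
    rootSum R T m u x = ∑ i, R i ^ m * u i x := by
  simp [rootSum]

/-- One component of the Birkhoff integral operator. -/
noncomputable def birkComp (j : Fin n) (μ : ℂ) :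
    (Fin n → C(Icc (0 : ℝ) T, ℂ)) →L[ℂ] C(Icc (0 : ℝ) T, ℂ) :=
  ∑ m, birkCoeff R μ j m •
    (ContinuousLinearMap.mul ℂ C(Icc (0 : ℝ) T, ℂ) (expFun T ((R j - R k) * μ))).comp
      ((primOp hT (birkBase hT k j) (q m) (hq m)).comp
        ((ContinuousLinearMap.mul ℂ C(Icc (0 : ℝ) T, ℂ) (expFun T (-((R j - R k) * μ)))).comp
          (rootSum R T m)))

theorem birkComp_apply (j : Fin n) (μ : ℂ) (u : Fin n → C(Icc (0 : ℝ) T, ℂ))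
    (x : Icc (0 : ℝ) T) :
    birkComp R hT hq k j μ u x = ∑ m, birkCoeff R μ j m *
      (Complex.exp ((R j - R k) * μ * (x : ℝ)) * ∫ t in (birkBase hT k j : ℝ)..x, q m t *
        (Complex.exp (-((R j - R k) * μ) * t) *
          ∑ i, R i ^ (m : ℕ) * u i (projIcc 0 T hT t))) := by
  rw [birkComp, _root_.sum_apply, ContinuousMap.sum_apply]
  refine Finset.sum_congr rfl fun m _ => ?_
  change birkCoeff R μ j m * (expFun T ((R j - R k) * μ) x *
    primOp hT (birkBase hT k j) (q m) (hq m)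
      (expFun T (-((R j - R k) * μ)) * rootSum R T m u) x) = _
  rw [primOp_apply]
  congr 2
  apply intervalIntegral.integral_congr
  intro t ht
  have ht' : t ∈ Icc 0 T := by
    have := uIcc_subset_uIcc (a₂ := 0) (b₂ := T) (by rw [uIcc_of_le hT]; exact (birkBase hT k j).2)
      (by rw [uIcc_of_le hT]; exact x.2) ht
    rwa [uIcc_of_le hT] at this
  simp only [ContinuousMap.mul_apply, rootSum_apply]
  rw [expFun, ContinuousMap.coe_mk, projIcc_of_mem hT ht']

theorem differentiableAt_birkComp (j : Fin n) {μ : ℂ} (hμ : μ ≠ 0) :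
    DifferentiableAt ℂ (birkComp R hT hq k j) μ := by
  unfold birkComp
  have h1 : ∀ m, DifferentiableAt ℂ (fun μ => birkCoeff R μ j m) μ := fun m => by
    unfold birkCoeff
    exact ((differentiableAt_inv hμ).pow _).const_mul _
  have h2 : ∀ s : ℂ, DifferentiableAt ℂ (fun μ => ContinuousLinearMap.mul ℂ
      C(Icc (0 : ℝ) T, ℂ) (expFun T (s * μ))) μ := fun s =>
    DifferentiableAt.clm_const_apply (F := C(Icc (0 : ℝ) T, ℂ) →L[ℂ] C(Icc (0 : ℝ) T, ℂ))
      (ContinuousLinearMap.mul ℂ C(Icc (0 : ℝ) T, ℂ)) (f := fun μ => expFun T (s * μ)) <|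
      (differentiable_expFun T (s * μ)).comp (f := fun μ => s * μ) μ
        (differentiableAt_id.const_mul s)
  have h3 : DifferentiableAt ℂ (fun μ => ContinuousLinearMap.mul ℂ
      C(Icc (0 : ℝ) T, ℂ) (expFun T (-((R j - R k) * μ)))) μ := by
    simpa only [neg_mul] using h2 (-(R j - R k))
  exact DifferentiableAt.sum_smul_comp_comp_comp _ h1 (h2 _) h3 _ _

/-- The Birkhoff integral operator attached to the `k`-th exponential. -/
noncomputable def birkOp (μ : ℂ) :
    (Fin n → C(Icc (0 : ℝ) T, ℂ)) →L[ℂ] (Fin n → C(Icc (0 : ℝ) T, ℂ)) :=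
  ∑ j, (ContinuousLinearMap.single ℂ (fun _ : Fin n => C(Icc (0 : ℝ) T, ℂ)) j).comp
    (birkComp R hT hq k j μ)

theorem birkOp_apply (μ : ℂ) (u : Fin n → C(Icc (0 : ℝ) T, ℂ)) (j : Fin n) :
    birkOp R hT hq k μ u j = birkComp R hT hq k j μ u := by
  simp [birkOp, Finset.sum_apply, Pi.single_apply]

theorem differentiableAt_birkOp {μ : ℂ} (hμ : μ ≠ 0) :
    DifferentiableAt ℂ (birkOp R hT hq k) μ := by
  unfold birkOp
  exact DifferentiableAt.sum_const_comp _ (fun j => differentiableAt_birkComp R hT hq k j hμ) _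

/-- `μ` satisfies the ordering conditions up to the constant `C` and the contraction condition for
a potential with norms `P m`. -/
structure BirkGood (T : ℝ) (P : Fin (n - 1) → ℝ) (C : ℝ) (μ : ℂ) : Prop where
  ne_zero : μ ≠ 0
  nonneg : 0 ≤ C
  order : ∀ j l : Fin n, j < l → (μ * (R j - R l)).re ≤ C
  small : Real.exp (C * T) * ∑ m, P m * ‖μ⁻¹‖ ^ (n - 1 - (m : ℕ)) ≤ 1 / 2

variable {R} in
theorem BirkGood.re_le {P : Fin (n - 1) → ℝ} {C : ℝ} {μ : ℂ} (h : BirkGood R T P C μ) (j : Fin n)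
    {x t : ℝ} (hx : x ∈ Icc 0 T) (ht : t ∈ uIcc (birkBase hT k j : ℝ) x) :
    ((R j - R k) * μ * (x - t)).re ≤ C * T := by
  have hC := h.nonneg
  have e : ((R j - R k) * μ * (x - t)).re = (μ * (R j - R k)).re * (x - t) := by
    rw [← Complex.ofReal_sub, Complex.re_mul_ofReal, mul_comm μ]
  rw [e]
  rcases lt_trichotomy j k with hjk | rfl | hjk
  · have h1 := h.order j k hjk
    rw [birkBase, if_pos hjk.le] at ht
    rw [uIcc_of_le hx.1] at ht
    nlinarith [ht.1, ht.2, hx.1, hx.2, mul_nonneg (sub_nonneg.2 h1) (sub_nonneg.2 ht.2)]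
  · simp only [sub_self, mul_zero, Complex.zero_re, zero_mul]
    positivity
  · have h1 := h.order k j hjk
    rw [birkBase, if_neg (not_le.2 hjk)] at ht
    rw [uIcc_of_ge hx.2] at ht
    have e2 : (μ * (R j - R k)).re = -(μ * (R k - R j)).re := by
      rw [← Complex.neg_re]; congr 1; ring
    rw [e2]
    nlinarith [ht.1, ht.2, hx.1, hx.2, mul_nonneg (sub_nonneg.2 h1) (sub_nonneg.2 ht.1)]

theorem norm_birkCoeff (hR : ∀ j, ‖R j‖ = 1) (μ : ℂ) (j : Fin n) (m : Fin (n - 1)) :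
    ‖birkCoeff R μ j m‖ = ‖μ⁻¹‖ ^ (n - 1 - (m : ℕ)) / n := by
  rw [birkCoeff, norm_mul, norm_neg, norm_div, hR, norm_pow, Complex.norm_natCast]
  ring

theorem birkComp_apply' (j : Fin n) (μ : ℂ) (u : Fin n → C(Icc (0 : ℝ) T, ℂ))
    (x : Icc (0 : ℝ) T) :
    birkComp R hT hq k j μ u x = ∑ m, birkCoeff R μ j m *
      ∫ t in (birkBase hT k j : ℝ)..x, q m t * Complex.exp ((R j - R k) * μ * (x - t)) *
          ∑ i, R i ^ (m : ℕ) * u i (projIcc 0 T hT t) := by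
  rw [birkComp_apply]
  refine Finset.sum_congr rfl fun m _ => ?_
  rw [← intervalIntegral.integral_const_mul]
  congr 2
  ext t
  have e : (R j - R k) * μ * ((x : ℝ) - t) =
    (R j - R k) * μ * (x : ℝ) + -((R j - R k) * μ) * t := by ring
  rw [e, Complex.exp_add]
  ring

variable {R} in
theorem BirkGood.norm_birkOp_apply_le {P : Fin (n - 1) → ℝ} {C : ℝ} {μ : ℂ}
    (h : BirkGood R T P C μ) (hR : ∀ j, ‖R j‖ = 1)
    (hP : ∀ m, ∫ t in (0 : ℝ)..T, ‖q m t‖ ≤ P m) (u : Fin n → C(Icc (0 : ℝ) T, ℂ)) :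
    ‖birkOp R hT hq k μ u‖ ≤
      Real.exp (C * T) * (∑ m, P m * ‖μ⁻¹‖ ^ (n - 1 - (m : ℕ))) * ‖u‖ := by
  have hn : (0 : ℝ) < n := by
    have : 0 < n := k.pos
    exact_mod_cast this
  have hP0 : ∀ m, 0 ≤ P m := fun m =>
    (intervalIntegral.integral_nonneg hT fun _ _ => norm_nonneg _).trans (hP m)
  have h00 : 0 ≤ ∑ m, P m * ‖μ⁻¹‖ ^ (n - 1 - (m : ℕ)) :=
    Finset.sum_nonneg fun m _ => mul_nonneg (hP0 m) (by positivity)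
  rw [pi_norm_le_iff_of_nonneg (by positivity)]
  intro j
  rw [ContinuousMap.norm_le _ (by positivity)]
  intro x
  rw [birkOp_apply, birkComp_apply', Finset.mul_sum, Finset.sum_mul]
  refine (norm_sum_le _ _).trans (Finset.sum_le_sum fun m _ => ?_)
  rw [norm_mul, norm_birkCoeff R hR]
  have h1 : ‖∫ t in (birkBase hT k j : ℝ)..x, q m t * Complex.exp ((R j - R k) * μ * (x - t)) *
          ∑ i, R i ^ (m : ℕ) * u i (projIcc 0 T hT t)‖ ≤
      |∫ t in (birkBase hT k j : ℝ)..x, ‖q m t‖ * (Real.exp (C * T) * (n * ‖u‖))| := by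
    refine intervalIntegral.norm_integral_le_abs_of_norm_le ?_ ?_
    · refine (ae_restrict_mem measurableSet_uIoc).mono fun t ht => ?_
      rw [norm_mul, norm_mul, mul_assoc]
      refine mul_le_mul_of_nonneg_left ?_ (norm_nonneg _)
      refine mul_le_mul ?_ ?_ (norm_nonneg _) (Real.exp_pos _).le
      · rw [Complex.norm_exp]
        exact Real.exp_le_exp.2 (h.re_le hT k j x.2 (uIoc_subset_uIcc ht))
      · refine (norm_sum_le_of_le _ (fun i _ => ?_)).trans_eq
          (b := ∑ _i : Fin n, ‖u‖) (by simp)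
        rw [norm_mul, norm_pow, hR, one_pow, one_mul]
        exact ((u i).norm_coe_le_norm _).trans (norm_le_pi_norm u i)
    · refine IntervalIntegrable.mono_mem (a := 0) (b := T) ((hq m).norm.mul_const _) ?_ ?_
      · rw [uIcc_of_le hT]; exact (birkBase hT k j).2
      · rw [uIcc_of_le hT]; exact x.2
  have h2 : |∫ t in (birkBase hT k j : ℝ)..x, ‖q m t‖ * (Real.exp (C * T) * (n * ‖u‖))| ≤
      P m * (Real.exp (C * T) * (n * ‖u‖)) := by
    rw [intervalIntegral.integral_mul_const, abs_mul, abs_of_nonneg (a := Real.exp (C * T) * _)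
      (by positivity)]
    refine mul_le_mul_of_nonneg_right ?_ (by positivity)
    refine le_trans ?_ (hP m)
    rw [intervalIntegral.abs_integral_eq_abs_integral_uIoc, abs_of_nonneg
      (integral_nonneg fun _ => norm_nonneg _), intervalIntegral.integral_of_le hT]
    refine setIntegral_mono_set ?_ ?_ ?_
    · exact (intervalIntegrable_iff_integrableOn_Ioc_of_le hT).1 (hq m).norm
    · exact Filter.Eventually.of_forall fun t => norm_nonneg _
    · apply LE.le.eventuallyLE
      exact Ioc_subset_Ioc (le_min (birkBase hT k j).2.1 x.2.1) (max_le (birkBase hT k j).2.2 x.2.2)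
  calc _ ≤ ‖μ⁻¹‖ ^ (n - 1 - (m : ℕ)) / n * (P m * (Real.exp (C * T) * (n * ‖u‖))) := by
        gcongr
        exact h1.trans h2
    _ = _ := by field_simp

variable {R} in
theorem BirkGood.norm_birkOp_le {P : Fin (n - 1) → ℝ} {C : ℝ} {μ : ℂ}
    (h : BirkGood R T P C μ) (hR : ∀ j, ‖R j‖ = 1)
    (hP : ∀ m, ∫ t in (0 : ℝ)..T, ‖q m t‖ ≤ P m) : ‖birkOp R hT hq k μ‖ ≤ 1 / 2 := by
  refine ContinuousLinearMap.opNorm_le_bound _ (by norm_num) fun u => ?_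
  refine (h.norm_birkOp_apply_le hT hq k hR hP u).trans ?_
  gcongr
  exact h.small

/-- The solution of the Birkhoff integral system. -/
noncomputable def birkSol (μ : ℂ) : Fin n → C(Icc (0 : ℝ) T, ℂ) :=
  Ring.inverse (1 - birkOp R hT hq k μ) (Pi.single k 1)

variable {R} {P : Fin (n - 1) → ℝ} {C : ℝ} {μ : ℂ}

theorem BirkGood.isUnit (h : BirkGood R T P C μ) (hR : ∀ j, ‖R j‖ = 1)
    (hP : ∀ m, ∫ t in (0 : ℝ)..T, ‖q m t‖ ≤ P m) : IsUnit (1 - birkOp R hT hq k μ) :=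
  isUnit_one_sub_of_norm_lt_one (x := birkOp R hT hq k μ)
    (lt_of_le_of_lt (h.norm_birkOp_le hT hq k hR hP) (by norm_num))

theorem BirkGood.birkSol_eq (h : BirkGood R T P C μ) (hR : ∀ j, ‖R j‖ = 1)
    (hP : ∀ m, ∫ t in (0 : ℝ)..T, ‖q m t‖ ≤ P m) :
    birkSol R hT hq k μ = Pi.single k 1 + birkOp R hT hq k μ (birkSol R hT hq k μ) := by
  have e := Ring.mul_inverse_cancel _ (h.isUnit hT hq k hR hP)
  have h2 : ((1 - birkOp R hT hq k μ) * Ring.inverse (1 - birkOp R hT hq k μ))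
    (Pi.single k 1) = Pi.single k 1 := by rw [e]; rfl
  change birkSol R hT hq k μ - birkOp R hT hq k μ (birkSol R hT hq k μ) = _ at h2
  rw [← h2]; abel

theorem norm_single_one_le : ‖(Pi.single k 1 : Fin n → C(Icc (0 : ℝ) T, ℂ))‖ ≤ 1 := by
  rw [pi_norm_le_iff_of_nonneg zero_le_one]
  intro j
  rw [Pi.single_apply]
  split_ifs
  · rw [ContinuousMap.norm_le _ zero_le_one]
    intro x; simp
  · simp

theorem BirkGood.norm_birkSol_le (h : BirkGood R T P C μ) (hR : ∀ j, ‖R j‖ = 1)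
    (hP : ∀ m, ∫ t in (0 : ℝ)..T, ‖q m t‖ ≤ P m) : ‖birkSol R hT hq k μ‖ ≤ 2 := by
  have e : ‖birkSol R hT hq k μ‖ ≤ 1 + 1 / 2 * ‖birkSol R hT hq k μ‖ := by
    conv_lhs => rw [h.birkSol_eq hT hq k hR hP]
    refine (norm_add_le _ _).trans (add_le_add (norm_single_one_le k) ?_)
    exact ContinuousLinearMap.le_of_opNorm_le _ (h.norm_birkOp_le hT hq k hR hP) _
  linarith

theorem BirkGood.analyticAt_birkSol (h : BirkGood R T P C μ) (hR : ∀ j, ‖R j‖ = 1)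
    (hP : ∀ m, ∫ t in (0 : ℝ)..T, ‖q m t‖ ≤ P m) :
    AnalyticAt ℂ (birkSol R hT hq k) μ := by
  have h1 : ∀ᶠ z in nhds μ, z ≠ 0 := isOpen_ne.mem_nhds h.ne_zero
  exact analyticAt_inverse_one_sub_apply
    (h1.mono fun z hz => differentiableAt_birkOp R hT hq k hz) (h.isUnit hT hq k hR hP) _

theorem BirkGood.birkSol_apply (h : BirkGood R T P C μ) (hR : ∀ j, ‖R j‖ = 1)
    (hP : ∀ m, ∫ t in (0 : ℝ)..T, ‖q m t‖ ≤ P m) (j : Fin n) (x : Icc (0 : ℝ) T) :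
    birkSol R hT hq k μ j x = (if j = k then 1 else 0) + ∑ m, birkCoeff R μ j m *
      (Complex.exp ((R j - R k) * μ * (x : ℝ)) * ∫ t in (birkBase hT k j : ℝ)..x, q m t *
        (Complex.exp (-((R j - R k) * μ) * t) *
          ∑ i, R i ^ (m : ℕ) * birkSol R hT hq k μ i (projIcc 0 T hT t))) := by
  conv_lhs => rw [h.birkSol_eq hT hq k hR hP]
  rw [Pi.add_apply, ContinuousMap.add_apply, birkOp_apply, birkComp_apply]
  congr 1
  rw [Pi.single_apply]
  split_ifs <;> rfl

theorem BirkGood.birkSol_apply_eq_single (h : BirkGood R T P C μ) (hR : ∀ j, ‖R j‖ = 1)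
    (hP : ∀ m, ∫ t in (0 : ℝ)..T, ‖q m t‖ ≤ P m) {a : Icc (0 : ℝ) T}
    (ha : ∀ m, ∀ t < (a : ℝ), q m t = 0) {j : Fin n} (hj : j ≤ k) :
    birkSol R hT hq k μ j a = if j = k then 1 else 0 := by
  rw [h.birkSol_apply hT hq k hR hP, add_eq_left]
  refine Finset.sum_eq_zero fun m _ => ?_
  have : (birkBase hT k j : ℝ) = 0 := by rw [birkBase, if_pos hj]
  rw [this, intervalIntegral.integral_of_le a.2.1, integral_Ioc_eq_integral_Ioo,
    setIntegral_eq_zero_of_forall_eq_zero, mul_zero, mul_zero]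
  intro t ht
  rw [ha m t ht.2, zero_mul]

theorem BirkGood.exp_mul_birkSol_sub (h : BirkGood R T P C μ) (hR : ∀ j, ‖R j‖ = 1)
    (hP : ∀ m, ∫ t in (0 : ℝ)..T, ‖q m t‖ ≤ P m) (j : Fin n) (a x : Icc (0 : ℝ) T) :
    Complex.exp (-((R j - R k) * μ) * (x : ℝ)) * birkSol R hT hq k μ j x -
      Complex.exp (-((R j - R k) * μ) * (a : ℝ)) * birkSol R hT hq k μ j a =
      ∑ m, birkCoeff R μ j m * ∫ t in (a : ℝ)..x, q m t *
        (Complex.exp (-((R j - R k) * μ) * t) *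
          ∑ i, R i ^ (m : ℕ) * birkSol R hT hq k μ i (projIcc 0 T hT t)) := by
  have hm : ∀ x : Icc (0 : ℝ) T, (x : ℝ) ∈ uIcc 0 T := fun x => by
    rw [uIcc_of_le hT]; exact x.2
  have key : ∀ x : Icc (0 : ℝ) T,
      Complex.exp (-((R j - R k) * μ) * (x : ℝ)) * birkSol R hT hq k μ j x =
      (if j = k then 1 else 0) + ∑ m, birkCoeff R μ j m *
        ∫ t in (birkBase hT k j : ℝ)..x, q m t * (Complex.exp (-((R j - R k) * μ) * t) *
          ∑ i, R i ^ (m : ℕ) * birkSol R hT hq k μ i (projIcc 0 T hT t)) := by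
    intro x
    rw [h.birkSol_apply hT hq k hR hP, mul_add, Finset.mul_sum]
    congr 1
    · split_ifs with hjk
      · simp [hjk]
      · simp
    · refine Finset.sum_congr rfl fun m _ => ?_
      have : Complex.exp (-((R j - R k) * μ) * (x : ℝ)) *
        Complex.exp ((R j - R k) * μ * (x : ℝ)) = 1 := by
        rw [← Complex.exp_add, neg_mul, neg_add_cancel, Complex.exp_zero]
      rw [mul_left_comm, ← mul_assoc (Complex.exp _) (Complex.exp _), this, one_mul]
  have hi : ∀ m (x y : Icc (0 : ℝ) T), IntervalIntegrable (fun t => q m t *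
        (Complex.exp (-((R j - R k) * μ) * t) *
          ∑ i, R i ^ (m : ℕ) * birkSol R hT hq k μ i (projIcc 0 T hT t))) volume x y := by
    intro m x y
    refine IntervalIntegrable.mono_mem ?_ (hm x) (hm y)
    refine (hq m).mul_continuousOn (Continuous.continuousOn ?_)
    refine Continuous.mul (by fun_prop) (continuous_finsetSum _ fun i _ => continuous_const.mul ?_)
    exact (birkSol R hT hq k μ i).continuous.comp continuous_projIcc
  rw [key x, key a, add_sub_add_left_eq_sub, ← Finset.sum_sub_distrib]
  refine Finset.sum_congr rfl fun m _ => ?_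
  rw [← mul_sub, intervalIntegral.integral_interval_sub_left (hi m _ _) (hi m _ _)]
end

theorem exists_contDiff_integral_norm_sub_le {q : ℝ → ℂ} {T : ℝ} (hT : 0 ≤ T)
    (hq : IntervalIntegrable q volume 0 T) {ε : ℝ} (hε : 0 < ε) :
    ∃ g : ℝ → ℂ, ContDiff ℝ 1 g ∧ ∫ t in (0 : ℝ)..T, ‖q t - g t‖ ≤ ε := by
  have hq' : Integrable q (volume.restrict (Ioc 0 T)) :=
    (intervalIntegrable_iff_integrableOn_Ioc_of_le hT).1 hq
  obtain ⟨g, hg1, hg2, hg3⟩ := (memLp_one_iff_integrable.2 hq').exist_eLpNorm_sub_le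
    ENNReal.one_ne_top le_rfl hε
  refine ⟨g, hg2.of_le (by exact_mod_cast le_top), ?_⟩
  have hg' : Integrable g (volume.restrict (Ioc 0 T)) :=
    hg2.continuous.integrable_of_hasCompactSupport hg1
  rw [intervalIntegral.integral_of_le hT]
  have := integral_norm_eq_lintegral_enorm (hq'.sub hg').aestronglyMeasurable
  simp only [Pi.sub_apply] at this
  rw [this]
  rw [eLpNorm_one_eq_lintegral_enorm] at hg3
  exact ENNReal.toReal_le_of_le_ofReal hε.le hg3

theorem abs_integral_le_of_mem_Icc {g : ℝ → ℝ} {T : ℝ} (hT : 0 ≤ T)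
    (hg : IntervalIntegrable g volume 0 T) (hg0 : ∀ t, 0 ≤ g t) {c x : ℝ} (hc : c ∈ Icc 0 T)
    (hx : x ∈ Icc 0 T) : |∫ t in c..x, g t| ≤ ∫ t in (0 : ℝ)..T, g t := by
  rw [intervalIntegral.abs_integral_eq_abs_integral_uIoc, abs_of_nonneg
    (integral_nonneg fun _ => hg0 _), intervalIntegral.integral_of_le hT]
  refine setIntegral_mono_set ?_ ?_ ?_
  · exact (intervalIntegrable_iff_integrableOn_Ioc_of_le hT).1 hg
  · exact Filter.Eventually.of_forall fun t => hg0 _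
  · apply LE.le.eventuallyLE
    exact Ioc_subset_Ioc (le_min hc.1 hx.1) (max_le hc.2 hx.2)

/-- A Riemann–Lebesgue lemma which is uniform in the endpoints and in the growth direction. -/
theorem eventually_norm_integral_mul_exp_le {q : ℝ → ℂ} {T : ℝ} (hT : 0 ≤ T)
    (hq : IntervalIntegrable q volume 0 T) (B : ℝ) {ε : ℝ} (hε : 0 < ε) :
    ∀ᶠ N : ℝ in Filter.atTop, ∀ s : ℂ, N ≤ ‖s‖ → ∀ c ∈ Icc 0 T, ∀ x ∈ Icc 0 T,
      (∀ t ∈ uIcc c x, (s * (x - t)).re ≤ B) →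
      ‖∫ t in c..x, q t * Complex.exp (s * (x - t))‖ ≤ ε := by
  have hm : ∀ {x}, x ∈ Icc 0 T → x ∈ uIcc 0 T := fun {x} h => by
    rwa [uIcc_of_le hT]
  obtain ⟨g, hg, hqg⟩ := exists_contDiff_integral_norm_sub_le hT hq
    (ε := ε / 2 * Real.exp (-B)) (by positivity)
  have hg' : Continuous (deriv g) := hg.continuous_deriv le_rfl
  obtain ⟨G, hG⟩ := isCompact_Icc.exists_bound_of_continuousOn (hg.continuous.continuousOn (s := Icc 0 T))
  obtain ⟨G', hG'⟩ := isCompact_Icc.exists_bound_of_continuousOn (hg'.continuousOn (s := Icc 0 T))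
  have hG0 : 0 ≤ G := (norm_nonneg _).trans (hG 0 ⟨le_rfl, hT⟩)
  have hG0' : 0 ≤ G' := (norm_nonneg _).trans (hG' 0 ⟨le_rfl, hT⟩)
  filter_upwards [Filter.eventually_ge_atTop (2 * Real.exp B * (2 * G + T * G') / ε),
    Filter.eventually_gt_atTop 0] with N hN hN0 s hs c hc x hx hB
  have hs0 : 0 < ‖s‖ := hN0.trans_le hs
  have hs0' : s ≠ 0 := norm_pos_iff.1 hs0
  have hexp : ∀ t ∈ uIcc c x, ‖Complex.exp (s * (x - t))‖ ≤ Real.exp B := fun t ht => by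
    rw [Complex.norm_exp]; exact Real.exp_le_exp.2 (hB t ht)
  have hec : Continuous fun t : ℝ => Complex.exp (s * (x - t)) := by fun_prop
  have hsub : uIcc c x ⊆ Icc 0 T := by
    have := uIcc_subset_uIcc (hm hc) (hm hx); rwa [uIcc_of_le hT] at this
  have hi1 : IntervalIntegrable (fun t => (q t - g t) * Complex.exp (s * (x - t))) volume c x :=
    ((hq.mono_mem (hm hc) (hm hx)).sub (hg.continuous.intervalIntegrable _ _)).mul_continuousOn
      hec.continuousOn
  have hi2 : IntervalIntegrable (fun t => g t * Complex.exp (s * (x - t))) volume c x :=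
    (hg.continuous.mul hec).intervalIntegrable _ _
  have e1 : ∫ t in c..x, q t * Complex.exp (s * (x - t)) =
      (∫ t in c..x, (q t - g t) * Complex.exp (s * (x - t))) +
        ∫ t in c..x, g t * Complex.exp (s * (x - t)) := by
    rw [← intervalIntegral.integral_add hi1 hi2]
    congr 1; ext t; ring
  have b1 : ‖∫ t in c..x, (q t - g t) * Complex.exp (s * (x - t))‖ ≤ ε / 2 := by
    have : ‖∫ t in c..x, (q t - g t) * Complex.exp (s * (x - t))‖ ≤
        |∫ t in c..x, ‖q t - g t‖ * Real.exp B| := by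
      refine intervalIntegral.norm_integral_le_abs_of_norm_le ?_ ?_
      · refine (ae_restrict_mem measurableSet_uIoc).mono fun t ht => ?_
        rw [norm_mul]
        exact mul_le_mul_of_nonneg_left (hexp t (uIoc_subset_uIcc ht)) (norm_nonneg _)
      · exact ((hq.sub (hg.continuous.intervalIntegrable _ _)).norm.mono_mem
          (hm hc) (hm hx)).mul_const _
    refine this.trans ?_
    rw [intervalIntegral.integral_mul_const, abs_mul, abs_of_pos (Real.exp_pos B)]
    have h2 := abs_integral_le_of_mem_Icc hT
      (hq.sub (hg.continuous.intervalIntegrable _ _)).norm (fun t => norm_nonneg _) hc hx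
    calc _ ≤ ε / 2 * Real.exp (-B) * Real.exp B := by
          gcongr
          exact h2.trans hqg
      _ = ε / 2 := by rw [mul_assoc, ← Real.exp_add, neg_add_cancel, Real.exp_zero, mul_one]
  have hv : ∀ t ∈ uIcc c x, HasDerivAt (fun t : ℝ => -(Complex.exp (s * (x - t)) / s))
      (Complex.exp (s * (x - t))) t := by
    intro t _
    have h := ((((Complex.ofRealCLM.hasDerivAt (x := t)).const_sub (x : ℂ)).const_mul
      s).cexp.div_const s).fun_neg
    convert! h using 1
    simp only [Complex.ofRealCLM_apply, Complex.ofReal_one]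
    field_simp
  have e2 := intervalIntegral.integral_mul_deriv_eq_deriv_mul (a := c) (b := x) (u := g)
    (u' := deriv g) (fun t _ => (hg.differentiable one_ne_zero t).hasDerivAt) hv
    (hg'.intervalIntegrable _ _) (hec.intervalIntegrable _ _)
  have b2 : ‖∫ t in c..x, g t * Complex.exp (s * (x - t))‖ ≤
      Real.exp B * (2 * G + T * G') / ‖s‖ := by
    rw [e2]
    have hve : ∀ t ∈ uIcc c x, ‖-(Complex.exp (s * (x - t)) / s)‖ ≤ Real.exp B / ‖s‖ :=
      fun t ht => by
        rw [norm_neg, norm_div]; gcongr; exact hexp t ht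
    have c1 : ‖g x * -(Complex.exp (s * (x - x)) / s)‖ ≤ G * (Real.exp B / ‖s‖) := by
      rw [norm_mul]; exact mul_le_mul (hG x hx) (hve x right_mem_uIcc) (norm_nonneg _) hG0
    have c2 : ‖g c * -(Complex.exp (s * (x - c)) / s)‖ ≤ G * (Real.exp B / ‖s‖) := by
      rw [norm_mul]; exact mul_le_mul (hG c hc) (hve c left_mem_uIcc) (norm_nonneg _) hG0
    have c3 : ‖∫ t in c..x, deriv g t * -(Complex.exp (s * (x - t)) / s)‖ ≤
        G' * (Real.exp B / ‖s‖) * |x - c| := by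
      refine intervalIntegral.norm_integral_le_of_norm_le_const fun t ht => ?_
      rw [norm_mul]
      have ht' := uIoc_subset_uIcc ht
      exact mul_le_mul (hG' t (hsub ht')) (hve t ht') (norm_nonneg _) hG0'
    have c4 : |x - c| ≤ T := by rw [abs_le]; constructor <;> linarith [hx.1, hx.2, hc.1, hc.2]
    have c5 : G' * (Real.exp B / ‖s‖) * |x - c| ≤ G' * (Real.exp B / ‖s‖) * T := by gcongr
    refine (norm_sub_le _ _).trans ((add_le_add (norm_sub_le _ _) le_rfl).trans ?_)
    calc _ ≤ G * (Real.exp B / ‖s‖) + G * (Real.exp B / ‖s‖) + G' * (Real.exp B / ‖s‖) * T :=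
          add_le_add (add_le_add c1 c2) (c3.trans c5)
      _ = _ := by ring
  have b3 : Real.exp B * (2 * G + T * G') / ‖s‖ ≤ ε / 2 := by
    rw [div_le_iff₀ hs0]
    rw [div_le_iff₀ hε] at hN
    nlinarith
  rw [e1]
  exact (norm_add_le _ _).trans (by linarith)

section
variable {n : ℕ} (R : Fin n → ℂ) {T : ℝ} (hT : 0 ≤ T) {q : Fin (n - 1) → ℝ → ℂ}
  (hq : ∀ m, IntervalIntegrable (q m) volume 0 T) (k : Fin n)

/-- The Cauchy data at `a` of the solution described by the Birkhoff system. -/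
noncomputable def birkData (a : Icc (0 : ℝ) T) (μ : ℂ) (ν : Fin n) : ℂ :=
  Complex.exp (μ * R k * (a : ℝ)) * ∑ j, (μ * R j) ^ (ν : ℕ) * birkSol R hT hq k μ j a

variable {R} {P : Fin (n - 1) → ℝ} {C : ℝ} {μ : ℂ}

theorem BirkGood.analyticAt_birkData (h : BirkGood R T P C μ) (hR : ∀ j, ‖R j‖ = 1)
    (hP : ∀ m, ∫ t in (0 : ℝ)..T, ‖q m t‖ ≤ P m) (a : Icc (0 : ℝ) T) :
    AnalyticAt ℂ (birkData R hT hq k a) μ := by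
  have h1 := h.analyticAt_birkSol hT hq k hR hP
  refine AnalyticAt.pi fun ν => ?_
  unfold birkData
  have h2 : ∀ j, AnalyticAt ℂ (fun μ => birkSol R hT hq k μ j a) μ := fun j =>
    (((ContinuousMap.evalCLM ℂ a).comp (ContinuousLinearMap.proj (R := ℂ)
      (φ := fun _ : Fin n => C(Icc (0 : ℝ) T, ℂ)) j)).analyticAt _).comp h1
  have h3 : ∀ j, AnalyticAt ℂ (fun μ : ℂ => μ * R j) μ := fun j =>
    analyticAt_id.mul analyticAt_const
  refine AnalyticAt.mul ((h3 k).mul analyticAt_const).cexp ?_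
  exact Finset.analyticAt_fun_sum _ fun j _ => ((h3 j).pow _).mul (h2 j)

theorem BirkGood.det_birkData_ne_zero (h : BirkGood R T P C μ) (hR : ∀ j, ‖R j‖ = 1)
    (hinj : Function.Injective R) (hP : ∀ m, ∫ t in (0 : ℝ)..T, ‖q m t‖ ≤ P m)
    {a : Icc (0 : ℝ) T} (ha : ∀ m, ∀ t < (a : ℝ), q m t = 0) :
    (Matrix.of fun ν k : Fin n => birkData R hT hq k a μ ν).det ≠ 0 := by
  have e : (Matrix.of fun ν k : Fin n => birkData R hT hq k a μ ν) =
      (Matrix.vandermonde fun j => μ * R j).transpose *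
        (Matrix.of fun j k => birkSol R hT hq k μ j a) *
        Matrix.diagonal fun k => Complex.exp (μ * R k * (a : ℝ)) := by
    ext ν k
    rw [Matrix.mul_diagonal, Matrix.mul_apply, mul_comm]
    simp [birkData, Matrix.vandermonde_apply]
  rw [e, Matrix.det_mul, Matrix.det_mul, Matrix.det_transpose, Matrix.det_diagonal]
  have ht : (Matrix.of fun j k => birkSol R hT hq k μ j a).IsLowerTriangular := by
    intro j k hjk
    have hjk' : j < k := hjk
    rw [Matrix.of_apply, h.birkSol_apply_eq_single hT hq k hR hP ha hjk'.le, if_neg hjk'.ne]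
  rw [Matrix.det_of_isLowerTriangular _ ht]
  refine mul_ne_zero (mul_ne_zero ?_ ?_) ?_
  · rw [Matrix.det_vandermonde_ne_zero_iff]
    exact fun i j hij => hinj (mul_left_cancel₀ h.ne_zero hij)
  · refine Finset.prod_ne_zero_iff.2 fun j _ => ?_
    rw [Matrix.of_apply, h.birkSol_apply_eq_single hT hq j hR hP ha le_rfl, if_pos rfl]
    exact one_ne_zero
  · exact Finset.prod_ne_zero_iff.2 fun j _ => Complex.exp_ne_zero _

theorem pow_sub_le_self (hμ : 1 ≤ ‖μ‖) (m : Fin (n - 1)) :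
    ‖μ⁻¹‖ ^ (n - 1 - (m : ℕ)) ≤ ‖μ‖⁻¹ := by
  rw [norm_inv]
  have h1 : ‖μ‖⁻¹ ≤ 1 := inv_le_one_of_one_le₀ hμ
  exact pow_le_of_le_one (by positivity) h1 (by have := m.2; omega)

theorem BirkGood.norm_birkOp_apply_le_inv (h : BirkGood R T P C μ) (hR : ∀ j, ‖R j‖ = 1)
    (hP : ∀ m, ∫ t in (0 : ℝ)..T, ‖q m t‖ ≤ P m) (hμ : 1 ≤ ‖μ‖)
    (u : Fin n → C(Icc (0 : ℝ) T, ℂ)) :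
    ‖birkOp R hT hq k μ u‖ ≤ Real.exp (C * T) * (∑ m, P m) * ‖μ‖⁻¹ * ‖u‖ := by
  have hP0 : ∀ m, 0 ≤ P m := fun m =>
    (intervalIntegral.integral_nonneg hT fun _ _ => norm_nonneg _).trans (hP m)
  refine (h.norm_birkOp_apply_le hT hq k hR hP u).trans ?_
  refine mul_le_mul_of_nonneg_right ?_ (norm_nonneg u)
  rw [mul_assoc, Finset.sum_mul]
  refine mul_le_mul_of_nonneg_left (Finset.sum_le_sum fun m _ => ?_) (Real.exp_pos _).le
  exact mul_le_mul_of_nonneg_left (pow_sub_le_self hμ m) (hP0 m)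

theorem BirkGood.norm_birkSol_sub_le (h : BirkGood R T P C μ) (hR : ∀ j, ‖R j‖ = 1)
    (hP : ∀ m, ∫ t in (0 : ℝ)..T, ‖q m t‖ ≤ P m) (hμ : 1 ≤ ‖μ‖) :
    ‖birkSol R hT hq k μ - (Pi.single k 1 + birkOp R hT hq k μ (Pi.single k 1))‖ ≤
      2 * (Real.exp (C * T) * (∑ m, P m)) ^ 2 * ‖μ‖⁻¹ ^ 2 := by
  have hP0 : ∀ m, 0 ≤ P m := fun m =>
    (intervalIntegral.integral_nonneg hT fun _ _ => norm_nonneg _).trans (hP m)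
  have hA : 0 ≤ Real.exp (C * T) * (∑ m, P m) :=
    mul_nonneg (Real.exp_pos _).le (Finset.sum_nonneg fun m _ => hP0 m)
  set A := Real.exp (C * T) * (∑ m, P m)
  have e : birkSol R hT hq k μ - (Pi.single k 1 + birkOp R hT hq k μ (Pi.single k 1)) =
      birkOp R hT hq k μ (birkOp R hT hq k μ (birkSol R hT hq k μ)) := by
    have e1 := h.birkSol_eq hT hq k hR hP
    have e2 : birkOp R hT hq k μ (birkSol R hT hq k μ) = birkSol R hT hq k μ - Pi.single k 1 :=
      (sub_eq_of_eq_add' e1).symm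
    conv_rhs => rw [e2, map_sub, e2]
    abel
  rw [e]
  calc _ ≤ A * ‖μ‖⁻¹ * (A * ‖μ‖⁻¹ * 2) := by
        refine (h.norm_birkOp_apply_le_inv hT hq k hR hP hμ _).trans ?_
        gcongr
        refine (h.norm_birkOp_apply_le_inv hT hq k hR hP hμ _).trans ?_
        gcongr
        exact h.norm_birkSol_le hT hq k hR hP
    _ = _ := by ring

theorem birkOp_single_apply (j : Fin n) (x : Icc (0 : ℝ) T) :
    birkOp R hT hq k μ (Pi.single k 1) j x = ∑ m, birkCoeff R μ j m * (R k ^ (m : ℕ) *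
      ∫ t in (birkBase hT k j : ℝ)..x, q m t * Complex.exp ((R j - R k) * μ * (x - t))) := by
  rw [birkOp_apply, birkComp_apply']
  refine Finset.sum_congr rfl fun m _ => ?_
  rw [← intervalIntegral.integral_const_mul (R k ^ (m : ℕ))]
  congr 1
  refine intervalIntegral.integral_congr fun t _ => ?_
  have : ∑ i, R i ^ (m : ℕ) * (Pi.single k 1 : Fin n → C(Icc (0 : ℝ) T, ℂ)) i
      (projIcc 0 T hT t) = R k ^ (m : ℕ) := by
    rw [Finset.sum_eq_single k]
    · simp
    · intro i _ hi; simp [hi]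
    · simp
  simp only [this]
  ring

theorem norm_birkOp_single_sub_le (hn : 2 ≤ n) (hroot : ∀ j, R j ^ n = 1) (hR : ∀ j, ‖R j‖ = 1)
    (hP : ∀ m, ∫ t in (0 : ℝ)..T, ‖q m t‖ ≤ P m) (hμ : 1 ≤ ‖μ‖) {a : Icc (0 : ℝ) T}
    (ha : ∀ m, ∀ t < (a : ℝ), q m t = 0) (x : Icc (0 : ℝ) T) :
    ‖birkOp R hT hq k μ (Pi.single k 1) k x -
      (-(1 / (n : ℂ)) * ∫ t in (a : ℝ)..x, q ⟨n - 2, sub_two_lt_sub_one hn⟩ t) / (μ * R k)‖ ≤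
      (∑ m, P m) * ‖μ‖⁻¹ ^ 2 := by
  have hP0 : ∀ m, 0 ≤ P m := fun m =>
    (intervalIntegral.integral_nonneg hT fun _ _ => norm_nonneg _).trans (hP m)
  have hm : ∀ x : Icc (0 : ℝ) T, (x : ℝ) ∈ uIcc 0 T := fun x => by
    rw [uIcc_of_le hT]; exact x.2
  have hn1 : (1 : ℝ) ≤ n := by exact_mod_cast (by omega : 1 ≤ n)
  have hb : (birkBase hT k k : ℝ) = 0 := by rw [birkBase, if_pos le_rfl]
  have h0 : ∫ t in (0 : ℝ)..a, q ⟨n - 2, sub_two_lt_sub_one hn⟩ t = 0 := by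
    rw [intervalIntegral.integral_of_le a.2.1, integral_Ioc_eq_integral_Ioo,
      setIntegral_eq_zero_of_forall_eq_zero]
    exact fun t ht => ha _ t ht.2
  have h1 : ∫ t in (a : ℝ)..x, q ⟨n - 2, sub_two_lt_sub_one hn⟩ t =
      ∫ t in (0 : ℝ)..x, q ⟨n - 2, sub_two_lt_sub_one hn⟩ t := by
    rw [← intervalIntegral.integral_add_adjacent_intervals
      ((hq _).mono_mem left_mem_uIcc (hm a)) ((hq _).mono_mem (hm a) (hm x)), h0, zero_add]
  rw [birkOp_single_apply, hb, h1]
  simp only [sub_self, zero_mul, Complex.exp_zero, mul_one]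
  rw [← Finset.add_sum_erase _ _ (Finset.mem_univ (⟨n - 2, sub_two_lt_sub_one hn⟩ : Fin (n - 1)))]
  have hμ0 : μ ≠ 0 := norm_pos_iff.1 (by linarith)
  have hRk : R k ≠ 0 := norm_pos_iff.1 (by rw [hR]; exact one_pos)
  have e : birkCoeff R μ k ⟨n - 2, sub_two_lt_sub_one hn⟩ * (R k ^ (n - 2) *
      ∫ t in (0 : ℝ)..x, q ⟨n - 2, sub_two_lt_sub_one hn⟩ t) =
      (-(1 / (n : ℂ)) * ∫ t in (0 : ℝ)..x, q ⟨n - 2, sub_two_lt_sub_one hn⟩ t) / (μ * R k) := by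
    have e1 : R k ^ (n - 2) * (R k * R k) = 1 := by
      rw [← hroot k, ← pow_two, ← pow_add]; congr 1; omega
    have e2 : n - 1 - (n - 2) = 1 := by omega
    rw [birkCoeff, e2, pow_one]
    have hn0 : (n : ℂ) ≠ 0 := by exact_mod_cast (by omega : n ≠ 0)
    field_simp
    linear_combination (-(∫ t in (0 : ℝ)..x, q ⟨n - 2, sub_two_lt_sub_one hn⟩ t)) * e1
  rw [e, add_sub_cancel_left]
  refine (norm_sum_le _ _).trans ?_
  rw [Finset.sum_mul]
  refine (Finset.sum_le_sum (g := fun m => P m * ‖μ‖⁻¹ ^ 2) fun m hm1 => ?_).trans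
    (Finset.sum_le_sum_of_subset_of_nonneg (Finset.erase_subset _ _) fun m _ _ =>
      mul_nonneg (hP0 m) (by positivity))
  rw [norm_mul, norm_mul, norm_birkCoeff R hR, norm_pow, hR, one_pow, one_mul, mul_comm]
  have hm2 : (m : ℕ) ≠ n - 2 := fun h => (Finset.mem_erase.1 hm1).1 (Fin.ext h)
  have hm3 := m.2
  refine mul_le_mul ?_ ?_ (by positivity) (hP0 m)
  · refine le_trans ?_ (hP m)
    refine (intervalIntegral.norm_integral_le_abs_integral_norm).trans ?_
    exact abs_integral_le_of_mem_Icc hT (hq m).norm (fun _ => norm_nonneg _) ⟨le_rfl, hT⟩ x.2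
  · refine (div_le_self (by positivity) hn1).trans ?_
    rw [norm_inv]
    exact pow_le_pow_of_le_one (by positivity) (inv_le_one_of_one_le₀ hμ) (by omega)

theorem norm_birkOp_single_le (hR : ∀ j, ‖R j‖ = 1) (hμ : 1 ≤ ‖μ‖) {j : Fin n} {ε : ℝ}
    (hε0 : 0 ≤ ε) (x : Icc (0 : ℝ) T) (hε : ∀ m, ‖∫ t in (birkBase hT k j : ℝ)..x,
      q m t * Complex.exp ((R j - R k) * μ * (x - t))‖ ≤ ε) :
    ‖birkOp R hT hq k μ (Pi.single k 1) j x‖ ≤ ε * ‖μ‖⁻¹ := by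
  have hn1 : (1 : ℝ) ≤ n := by exact_mod_cast (by have := k.2; omega : 1 ≤ n)
  rw [birkOp_single_apply]
  have hn0 : (0 : ℝ) < n := by linarith
  refine (norm_sum_le_of_le _ (f := _) (n := fun _ => ε * ‖μ‖⁻¹ / n) fun m _ => ?_).trans ?_
  · rw [norm_mul, norm_mul, norm_birkCoeff R hR, norm_pow, hR, one_pow, one_mul]
    calc _ ≤ ‖μ‖⁻¹ / n * ε := by
          gcongr
          · exact pow_sub_le_self hμ m
          · exact hε m
      _ = _ := by ring
  · rw [Finset.sum_const, Finset.card_univ, Fintype.card_fin, nsmul_eq_mul]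
    have : ((n - 1 : ℕ) : ℝ) ≤ n := by exact_mod_cast Nat.sub_le _ _
    calc _ ≤ (n : ℝ) * (ε * ‖μ‖⁻¹ / n) := by gcongr
      _ = _ := by field_simp

theorem eventually_norm_birkSol_sub_le (hn : 2 ≤ n) (hinj : Function.Injective R)
    (hroot : ∀ j, R j ^ n = 1) (hR : ∀ j, ‖R j‖ = 1)
    (hP : ∀ m, ∫ t in (0 : ℝ)..T, ‖q m t‖ ≤ P m) (C : ℝ) {a : Icc (0 : ℝ) T}
    (ha : ∀ m, ∀ t < (a : ℝ), q m t = 0) {ε : ℝ} (hε : 0 < ε) :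
    ∀ᶠ N in Filter.atTop, ∀ μ, BirkGood R T P C μ → N ≤ ‖μ‖ → ∀ k j, ∀ x : Icc (0 : ℝ) T,
      ‖birkSol R hT hq k μ j x - (if j = k then
        1 + (-(1 / (n : ℂ)) * ∫ t in (a : ℝ)..x, q ⟨n - 2, sub_two_lt_sub_one hn⟩ t) / (μ * R k) else 0)‖ ≤
      ε / ‖μ‖ := by
  have hP0 : ∀ m, 0 ≤ P m := fun m =>
    (intervalIntegral.integral_nonneg hT fun _ _ => norm_nonneg _).trans (hP m)
  set A := 2 * (Real.exp (C * T) * (∑ m, P m)) ^ 2 with hA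
  have hA0 : 0 ≤ A := by positivity
  have hB0 : 0 ≤ ∑ m, P m := Finset.sum_nonneg fun m _ => hP0 m
  have h1 : ∀ᶠ N in Filter.atTop, ∀ k j, k ≠ j → ∀ m, ∀ s : ℂ, ‖R j - R k‖ * N ≤ ‖s‖ →
      ∀ c ∈ Icc 0 T, ∀ x ∈ Icc 0 T, (∀ t ∈ uIcc c x, (s * (x - t)).re ≤ C * T) →
      ‖∫ t in c..x, q m t * Complex.exp (s * (x - t))‖ ≤ ε / 2 := by
    simp only [Filter.eventually_all]
    intro k j hkj m
    have hd : 0 < ‖R j - R k‖ := norm_pos_iff.2 (sub_ne_zero.2 fun e => hkj (hinj e).symm)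
    exact (Filter.tendsto_id.const_mul_atTop hd).eventually
      (eventually_norm_integral_mul_exp_le hT (hq m) (C * T) (half_pos hε))
  filter_upwards [h1, Filter.eventually_ge_atTop 1,
    Filter.eventually_ge_atTop (2 * (A + ∑ m, P m) / ε)] with N hN hN1 hN2 μ hμ hNμ k j x
  have hμ1 : 1 ≤ ‖μ‖ := hN1.trans hNμ
  have hμ0 : 0 < ‖μ‖ := by linarith
  have hAB : (A + ∑ m, P m) * ‖μ‖⁻¹ ^ 2 ≤ ε / 2 * ‖μ‖⁻¹ := by
    have : 2 * (A + ∑ m, P m) ≤ ‖μ‖ * ε := (div_le_iff₀ hε).1 (hN2.trans hNμ)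
    have h3 : (A + ∑ m, P m) * ‖μ‖⁻¹ ≤ ε / 2 := by
      rw [← div_eq_mul_inv, div_le_iff₀ hμ0]; linarith
    calc _ = (A + ∑ m, P m) * ‖μ‖⁻¹ * ‖μ‖⁻¹ := by ring
      _ ≤ _ := by gcongr
  have h2 : ‖birkSol R hT hq k μ j x -
      ((if j = k then 1 else 0) + birkOp R hT hq k μ (Pi.single k 1) j x)‖ ≤ A * ‖μ‖⁻¹ ^ 2 := by
    refine le_trans ?_ (hμ.norm_birkSol_sub_le hT hq k hR hP hμ1)
    refine le_trans (le_of_eq ?_) ((ContinuousMap.norm_coe_le_norm ((birkSol R hT hq k μ -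
      (Pi.single k 1 + birkOp R hT hq k μ (Pi.single k 1)) : Fin n → C(Icc (0 : ℝ) T, ℂ)) j)
      x).trans (norm_le_pi_norm _ j))
    rw [Pi.sub_apply, ContinuousMap.sub_apply, Pi.add_apply, ContinuousMap.add_apply,
      Pi.single_apply]
    split_ifs <;> rfl
  have h3 : ‖birkOp R hT hq k μ (Pi.single k 1) j x - (if j = k then
        (-(1 / (n : ℂ)) * ∫ t in (a : ℝ)..x, q ⟨n - 2, sub_two_lt_sub_one hn⟩ t) / (μ * R k) else 0)‖ ≤
      ε / 2 * ‖μ‖⁻¹ + (∑ m, P m) * ‖μ‖⁻¹ ^ 2 := by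
    split_ifs with hjk
    · subst hjk
      refine (norm_birkOp_single_sub_le hT hq j hn hroot hR hP hμ1 ha x).trans ?_
      have : 0 ≤ ε / 2 * ‖μ‖⁻¹ := by positivity
      linarith
    · rw [sub_zero]
      refine (norm_birkOp_single_le hT hq k hR hμ1 (half_pos hε).le x fun m => ?_).trans
        (le_add_of_nonneg_right (by positivity))
      refine hN k j (fun e => hjk e.symm) m ((R j - R k) * μ) ?_ _ (birkBase hT k j).2 _ x.2 ?_
      · rw [norm_mul]; gcongr
      · exact fun t ht => hμ.re_le hT k j x.2 ht
  have e : birkSol R hT hq k μ j x - (if j = k then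
        1 + (-(1 / (n : ℂ)) * ∫ t in (a : ℝ)..x, q ⟨n - 2, sub_two_lt_sub_one hn⟩ t) / (μ * R k) else 0) =
      (birkSol R hT hq k μ j x -
        ((if j = k then 1 else 0) + birkOp R hT hq k μ (Pi.single k 1) j x)) +
      (birkOp R hT hq k μ (Pi.single k 1) j x - (if j = k then
        (-(1 / (n : ℂ)) * ∫ t in (a : ℝ)..x, q ⟨n - 2, sub_two_lt_sub_one hn⟩ t) / (μ * R k) else 0)) := by
    split_ifs <;> ring
  rw [e]
  calc _ ≤ A * ‖μ‖⁻¹ ^ 2 + (ε / 2 * ‖μ‖⁻¹ + (∑ m, P m) * ‖μ‖⁻¹ ^ 2) :=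
        (norm_add_le _ _).trans (add_le_add h2 h3)
    _ = (A + ∑ m, P m) * ‖μ‖⁻¹ ^ 2 + ε / 2 * ‖μ‖⁻¹ := by ring
    _ ≤ ε / 2 * ‖μ‖⁻¹ + ε / 2 * ‖μ‖⁻¹ := by gcongr
    _ = ε / ‖μ‖ := by rw [div_eq_mul_inv]; ring
end

theorem le_of_forall_le_add_mul_of_compact {X : Type*} [TopologicalSpace X] [CompactSpace X]
    {f : X → ℝ} (hf : Continuous f) {A : ℝ}
    (h : ∀ M, (∀ x, f x ≤ M) → ∀ x, f x ≤ A + 3 / 4 * M) (x : X) : f x ≤ 4 * A := by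
  obtain ⟨y, -, hy⟩ := isCompact_univ.exists_isMaxOn ⟨x, mem_univ x⟩ hf.continuousOn
  have hy' : ∀ z, f z ≤ f y := fun z => hy (mem_univ z)
  have := h _ hy' y
  linarith [hy' x]

theorem norm_le_of_exp_mul_sub_eq_integral {n : ℕ} {a T : ℝ} (haT : a ≤ T) {D H : Fin n → ℝ → ℂ}
    (hD : ∀ j, ContinuousOn (D j) (Icc a T)) {s : Fin n → ℂ} {g : ℝ} (hs : ∀ j, (s j).re ≤ g)
    (hg : 0 ≤ g) (hDH : ∀ j, ∀ x ∈ Icc a T, Complex.exp (-s j * x) * D j x -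
      Complex.exp (-s j * a) * D j a = ∫ t in a..x, Complex.exp (-s j * t) * H j t)
    {κ : ℝ} {K : ℝ → ℝ} (hκ : 0 ≤ κ) (hK : IntervalIntegrable K volume a T) (hK0 : ∀ t, 0 ≤ K t)
    (hH : ∀ M, ∀ t ∈ Icc a T, (∀ i, ‖D i t‖ ≤ M) → ∀ j, ‖H j t‖ ≤ κ * (M + 2) + K t * M)
    (hκT : (T - a) * κ ≤ 1 / 4) (hKT : ∫ t in a..T, K t ≤ 1 / 2) {δ : ℝ}
    (hδ : ∀ j, ‖D j a‖ ≤ δ) (j : Fin n) {x : ℝ} (hx : x ∈ Icc a T) :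
    ‖D j x‖ ≤ 4 * (δ + 2 * ((T - a) * κ)) * Real.exp (g * (x - a)) := by
  let f : Fin n × Icc a T → ℝ := fun z => Real.exp (-(g * (z.2 - a))) * ‖D z.1 z.2‖
  have hf : Continuous f := by
    rw [continuous_prod_of_discrete_left]
    intro i
    refine Continuous.mul (by fun_prop) ?_
    exact (continuousOn_iff_continuous_domRestrict.1 (hD i)).norm
  have main : f (j, ⟨x, hx⟩) ≤ 4 * (δ + 2 * ((T - a) * κ)) := by
    refine le_of_forall_le_add_mul_of_compact hf ?_ _
    rintro M hM ⟨i, y, hy⟩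
    have hM0 : 0 ≤ M := le_trans (by positivity) (hM (i, ⟨y, hy⟩))
    have hDM : ∀ i, ∀ t ∈ Icc a T, ‖D i t‖ ≤ M * Real.exp (g * (t - a)) := fun i t ht => by
      have := hM (i, ⟨t, ht⟩)
      simp only [f, Real.exp_neg] at this
      rwa [inv_mul_le_iff₀ (Real.exp_pos _), mul_comm] at this
    have hyI : IntervalIntegrable K volume a y := hK.mono_mem left_mem_uIcc
      (by rw [uIcc_of_le haT]; exact hy)
    have e : D i y = Complex.exp (s i * (y - a)) * D i a +
        ∫ t in a..y, Complex.exp (s i * (y - t)) * H i t := by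
      have h1 := hDH i y hy
      have h2 : ∀ t : ℝ, Complex.exp (s i * (y - t)) =
          Complex.exp (s i * y) * Complex.exp (-s i * t) := fun t => by
        rw [← Complex.exp_add]; congr 1; ring
      have h3 : Complex.exp (s i * y) * Complex.exp (-s i * y) = 1 := by
        rw [← h2, sub_self, mul_zero, Complex.exp_zero]
      simp only [h2, mul_assoc, intervalIntegral.integral_const_mul]
      rw [← h1]
      linear_combination (-D i y) * h3
    have hexp : ∀ t ≤ y, ‖Complex.exp (s i * (y - t))‖ ≤ Real.exp (g * (y - t)) := fun t ht => by
      rw [Complex.norm_exp, ← Complex.ofReal_sub, Complex.re_mul_ofReal]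
      exact Real.exp_le_exp.2 (mul_le_mul_of_nonneg_right (hs i) (sub_nonneg.2 ht))
    have hI : ‖∫ t in a..y, Complex.exp (s i * (y - t)) * H i t‖ ≤
        ∫ t in a..y, Real.exp (g * (y - a)) * (κ * (M + 2) + K t * M) := by
      refine intervalIntegral.norm_integral_le_of_norm_le hy.1 ?_ ?_
      · refine Filter.Eventually.of_forall fun t ht => ?_
        have ht' : t ∈ Icc a T := ⟨ht.1.le, ht.2.trans hy.2⟩
        have h1 := hH _ t ht' (fun i => hDM i t ht') i
        have h5 : 1 ≤ Real.exp (g * (t - a)) :=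
          Real.one_le_exp (mul_nonneg hg (sub_nonneg.2 ht.1.le))
        have h6 : Real.exp (g * (y - a)) = Real.exp (g * (y - t)) * Real.exp (g * (t - a)) := by
          rw [← Real.exp_add]; congr 1; ring
        rw [norm_mul, h6, mul_assoc]
        refine mul_le_mul (hexp t ht.2) (h1.trans ?_) (norm_nonneg _) (Real.exp_pos _).le
        nlinarith [mul_nonneg hκ (sub_nonneg.2 h5)]
      · exact ((intervalIntegrable_const).add (hyI.mul_const _)).const_mul _
    have hKy : ∫ t in a..y, K t ≤ 1 / 2 := by
      refine le_trans ?_ hKT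
      rw [← intervalIntegral.integral_add_adjacent_intervals hyI
        (hK.mono_mem (by rw [uIcc_of_le haT]; exact hy) right_mem_uIcc)]
      exact le_add_of_nonneg_right (intervalIntegral.integral_nonneg hy.2 fun t _ => hK0 t)
    rw [intervalIntegral.integral_const_mul, intervalIntegral.integral_add
      intervalIntegrable_const (hyI.mul_const _), intervalIntegral.integral_const,
      intervalIntegral.integral_mul_const, smul_eq_mul] at hI
    simp only [f, Real.exp_neg]
    rw [inv_mul_le_iff₀ (Real.exp_pos _), e]
    calc _ ≤ Real.exp (g * (y - a)) * δ + Real.exp (g * (y - a)) *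
            ((y - a) * (κ * (M + 2)) + (∫ t in a..y, K t) * M) := by
          refine (norm_add_le _ _).trans (add_le_add ?_ hI)
          rw [norm_mul]
          exact mul_le_mul (hexp a hy.1) (hδ i) (norm_nonneg _) (Real.exp_pos _).le
      _ = Real.exp (g * (y - a)) * (δ + ((y - a) * κ * (M + 2) + (∫ t in a..y, K t) * M)) := by
          ring
      _ ≤ _ := by
          refine mul_le_mul_of_nonneg_left ?_ (Real.exp_pos _).le
          have h7 : (y - a) * κ ≤ (T - a) * κ :=
            mul_le_mul_of_nonneg_right (by linarith [hy.2]) hκ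
          have h8 := mul_le_mul_of_nonneg_right hKy hM0
          have h9 := mul_le_mul_of_nonneg_right h7 (by linarith : 0 ≤ M + 2)
          have h10 := mul_le_mul_of_nonneg_right hκT hM0
          linarith
  simp only [f, Real.exp_neg] at main
  rwa [inv_mul_le_iff₀ (Real.exp_pos _), mul_comm] at main

section
variable {n : ℕ} {l : Fin n → ℂ} {L : ℂ}

theorem sum_inv_pow_mul_pow_eq_ite (hl : Function.Injective l) (h0 : ∀ j, l j ≠ 0)
    (hL : ∀ j, l j ^ n = L) (i j : Fin n) :
    ∑ ν : Fin n, (l i)⁻¹ ^ (ν : ℕ) / n * l j ^ (ν : ℕ) = if i = j then 1 else 0 := by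
  have hn : (n : ℂ) ≠ 0 := by exact_mod_cast i.pos.ne'
  have e : ∑ ν : Fin n, (l i)⁻¹ ^ (ν : ℕ) / n * l j ^ (ν : ℕ) =
      (∑ ν ∈ Finset.range n, (l j / l i) ^ ν) / n := by
    rw [← Fin.sum_univ_eq_sum_range (fun ν => (l j / l i) ^ ν) n, Finset.sum_div]
    refine Finset.sum_congr rfl fun ν _ => ?_
    rw [div_pow, inv_pow]; ring
  rw [e]
  split_ifs with hij
  · subst hij
    simp [div_self (h0 i), hn]
  · have h1 : l j / l i ≠ 1 := fun h => hij (hl ((div_eq_one_iff_eq (h0 i)).1 h)).symm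
    rw [geom_sum_eq h1, div_pow, hL, hL, div_self, sub_self, zero_div, zero_div]
    rw [← hL i]; exact pow_ne_zero _ (h0 i)

theorem sum_pow_mul_sum_inv_pow (hl : Function.Injective l) (h0 : ∀ j, l j ≠ 0)
    (hL : ∀ j, l j ^ n = L) (u : Fin n → ℂ) (ν : Fin n) :
    ∑ j, l j ^ (ν : ℕ) * ∑ κ : Fin n, (l j)⁻¹ ^ (κ : ℕ) / n * u κ = u ν := by
  let V : Matrix (Fin n) (Fin n) ℂ := .of fun ν j => l j ^ (ν : ℕ)
  let W : Matrix (Fin n) (Fin n) ℂ := .of fun j ν => (l j)⁻¹ ^ (ν : ℕ) / n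
  have h : W * V = 1 := by
    ext i j
    rw [Matrix.mul_apply, Matrix.one_apply]
    exact sum_inv_pow_mul_pow_eq_ite hl h0 hL i j
  have h' : V.mulVec (W.mulVec u) = u := by
    rw [Matrix.mulVec_mulVec, mul_eq_one_comm.1 h, Matrix.one_mulVec]
  exact congrFun h' ν
end

theorem sum_inv_pow_mul_sum_odeMat {n : ℕ} (hn : 2 ≤ n) (p : Fin (n - 1) → ℝ → ℂ) (τ : ℂ) (t : ℝ)
    (v : Fin n → ℂ) {l : ℂ} (hl : l ≠ 0) :
    ∑ ν : Fin n, l⁻¹ ^ (ν : ℕ) / n * ∑ i, odeMat n p τ ν i t * v i =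
      l * ∑ ν : Fin n, l⁻¹ ^ (ν : ℕ) / n * v ν + l / (n * l ^ n) * ((τ - l ^ n) * v ⟨0, by omega⟩ -
        ∑ m : Fin (n - 1), p m t * v ⟨m, by omega⟩) := by
  obtain ⟨k, rfl⟩ : ∃ k, n = k + 2 := ⟨n - 2, by omega⟩
  rw [Fin.sum_univ_castSucc, Fin.sum_univ_succ (fun ν : Fin (k + 2) => l⁻¹ ^ (ν : ℕ) / _ * v ν),
    sum_odeMat_mul_of_eq hn p τ t v (j := Fin.last (k + 1)) rfl]
  have h1 : ∀ i : Fin (k + 1), l⁻¹ ^ ((i.castSucc : Fin (k + 2)) : ℕ) / ((k + 2 : ℕ) : ℂ) *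
      ∑ i_1, odeMat (k + 2) p τ i.castSucc i_1 t * v i_1 =
      l * (l⁻¹ ^ ((i.succ : Fin (k + 2)) : ℕ) / ((k + 2 : ℕ) : ℂ) * v i.succ) := fun i => by
    rw [sum_odeMat_mul_of_lt p τ t v (j := i.castSucc)
      (by simp only [Fin.val_castSucc]; omega)]
    have : (⟨(i.castSucc : Fin (k + 2)) + 1, by simp only [Fin.val_castSucc]; omega⟩ :
      Fin (k + 2)) = i.succ := Fin.ext (by simp)
    rw [this, Fin.val_castSucc, Fin.val_succ, pow_succ]
    field_simp
  rw [Finset.sum_congr rfl fun i _ => h1 i, ← Finset.mul_sum]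
  have hn0 : ((k + 2 : ℕ) : ℂ) ≠ 0 := by exact_mod_cast (by omega : k + 2 ≠ 0)
  have hz : (⟨0, by omega⟩ : Fin (k + 2)) = 0 := rfl
  rw [hz]
  simp only [Fin.val_last, Fin.val_zero, pow_zero]
  generalize ∑ m : Fin (k + 2 - 1), p m t * v ⟨m, _⟩ = A
  generalize ∑ i : Fin (k + 1), l⁻¹ ^ ((i.succ : Fin (k + 2)) : ℕ) / ((k + 2 : ℕ) : ℂ) *
    v i.succ = B
  have h2 : l⁻¹ ^ (k + 1) = l / l ^ (k + 2) := by
    rw [inv_pow]; field_simp; ring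
  rw [h2]
  field_simp
  ring

theorem intervalIntegrable_sum_odeMat {n : ℕ} {T : ℝ} {p : Fin (n - 1) → ℝ → ℂ}
    (hp : ∀ m, IntervalIntegrable (p m) volume 0 T) (τ : ℂ) (j : Fin n) {u : Fin n → ℝ → ℂ}
    (hu : ∀ i, Continuous (u i)) :
    IntervalIntegrable (fun t => ∑ i, odeMat n p τ j i t * u i t) volume 0 T := by
  rw [← Finset.sum_fn]
  exact IntervalIntegrable.sum _ fun i _ =>
    (intervalIntegrable_odeMat hp τ j i).mul_continuousOn (hu i).continuousOn

section
variable {n : ℕ} {R : Fin n → ℂ} {T : ℝ} (hT : 0 ≤ T) {p q : Fin (n - 1) → ℝ → ℂ}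
  (hp : ∀ m, IntervalIntegrable (p m) volume 0 T) (hq : ∀ m, IntervalIntegrable (q m) volume 0 T)
  (k : Fin n) {P : Fin (n - 1) → ℝ} {C : ℝ} {μ : ℂ}

theorem exp_mul_sum_inv_pow_odeSol_sub (hn : 2 ≤ n) (a : Icc (0 : ℝ) T) (τ : ℂ) (b : Fin n → ℂ)
    {l : ℂ} (hl : l ≠ 0) (x : Icc (0 : ℝ) T) {w : ℝ → ℂ} (hw : ∀ x, w x =
      ∑ ν : Fin n, l⁻¹ ^ (ν : ℕ) / n * odeSol hT a hp τ b ν (projIcc 0 T hT x)) :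
    Complex.exp (-l * (x : ℝ)) * w x - Complex.exp (-l * (a : ℝ)) * w a =
      ∫ t in (a : ℝ)..x, Complex.exp (-l * t) * (l / (n * l ^ n) *
        ((τ - l ^ n) * odeSol hT a hp τ b ⟨0, by omega⟩ (projIcc 0 T hT t) -
          ∑ m : Fin (n - 1), p m t * odeSol hT a hp τ b ⟨m, by omega⟩ (projIcc 0 T hT t))) := by
  have hm : ∀ x : Icc (0 : ℝ) T, (x : ℝ) ∈ uIcc 0 T := fun x => by
    rw [uIcc_of_le hT]; exact x.2
  set u := odeSol hT a hp τ b with hu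
  have hc : ∀ i, Continuous fun t => u i (projIcc 0 T hT t) := fun i =>
    (u i).continuous.comp continuous_projIcc
  have hI := fun j : Fin n => intervalIntegrable_sum_odeMat hp τ j hc
  set g : ℝ → ℂ := fun t => ∑ ν : Fin n, l⁻¹ ^ (ν : ℕ) / n *
    ∑ i, odeMat n p τ ν i t * u i (projIcc 0 T hT t) with hgdef
  have hg : IntervalIntegrable g volume 0 T := by
    rw [hgdef, ← Finset.sum_fn]
    exact IntervalIntegrable.sum _ fun i _ => (hI i).const_mul _
  have hF : ∀ y ∈ uIcc 0 T, w y = w a + ∫ t in (a : ℝ)..y, g t := by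
    intro y hy
    have hyI : ∀ j : Fin n, IntervalIntegrable (fun t => ∑ i, odeMat n p τ j i t *
      u i (projIcc 0 T hT t)) volume a y := fun j => (hI j).mono_mem (hm a) hy
    rw [uIcc_of_le hT] at hy
    rw [hw, hw, intervalIntegral.integral_finsetSum (fun j _ => (hyI j).const_mul _),
      ← Finset.sum_add_distrib]
    refine Finset.sum_congr rfl fun ν _ => ?_
    rw [intervalIntegral.integral_const_mul, ← mul_add]
    congr 1
    rw [projIcc_val, projIcc_of_mem hT hy, odeSol_apply_base]
    conv_lhs => rw [hu, odeSol_eq_add_odeOp]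
    rw [Pi.add_apply, ContinuousMap.add_apply, constVec_apply, odeOp, volterra_apply]
  rw [exp_mul_sub_eq_integral (-l) hg (hm a) hF (hm x)]
  refine intervalIntegral.integral_congr fun t _ => ?_
  simp only [hgdef]
  rw [sum_inv_pow_mul_sum_odeMat hn p τ t _ hl, hw]
  ring
end

section
variable {n : ℕ} {R : Fin n → ℂ} {T : ℝ} (hT : 0 ≤ T) {p q : Fin (n - 1) → ℝ → ℂ}
  (hp : ∀ m, IntervalIntegrable (p m) volume 0 T) (hq : ∀ m, IntervalIntegrable (q m) volume 0 T)
  (k : Fin n) {P : Fin (n - 1) → ℝ} {C : ℝ} {μ : ℂ}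

theorem BirkGood.exists_odeSol_eq (h : BirkGood R T P C μ) (hn : 2 ≤ n)
    (hinj : Function.Injective R) (hroot : ∀ j, R j ^ n = 1) (hR : ∀ j, ‖R j‖ = 1)
    (hP : ∀ m, ∫ t in (0 : ℝ)..T, ‖q m t‖ ≤ P m) {a : Icc (0 : ℝ) T}
    (hpq : ∀ m, ∀ t ∈ Icc (a : ℝ) T, q m t = p m t) {g : ℝ} (hg : 0 ≤ g)
    (hgR : ∀ j, (μ * (R j - R k)).re ≤ g) {τ : ℂ}
    (hτ : (T - a) * (‖μ⁻¹‖ ^ (n - 1) * ‖τ - μ ^ n‖) ≤ 1 / 4) {d b : Fin n → ℂ} {δ : ℝ}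
    (hd : ∀ j, ‖d j‖ ≤ δ)
    (hb : ∀ ν : Fin n, b ν = Complex.exp (μ * R k * (a : ℝ)) *
      ∑ j, (μ * R j) ^ (ν : ℕ) * (birkSol R hT hq k μ j a + d j)) :
    ∃ D : Fin n → ℝ → ℂ, (∀ ν : Fin n, ∀ x : Icc (0 : ℝ) T, odeSol hT a hp τ b ν x =
      Complex.exp (μ * R k * (x : ℝ)) * ∑ j, (μ * R j) ^ (ν : ℕ) *
        (birkSol R hT hq k μ j x + D j x)) ∧
      ∀ j, ∀ x ∈ Icc (a : ℝ) T, ‖D j x‖ ≤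
        4 * (δ + 2 * ((T - a) * (‖μ⁻¹‖ ^ (n - 1) * ‖τ - μ ^ n‖))) * Real.exp (g * (x - a)) := by
  have hm : ∀ x : Icc (0 : ℝ) T, (x : ℝ) ∈ uIcc 0 T := fun x => by
    rw [uIcc_of_le hT]; exact x.2
  have hn0 : (n : ℂ) ≠ 0 := by exact_mod_cast (by omega : n ≠ 0)
  have hnr : (0 : ℝ) < n := by exact_mod_cast (by omega : 0 < n)
  have hμ := h.ne_zero
  have hR0 : ∀ j, R j ≠ 0 := fun j => norm_pos_iff.1 (by rw [hR]; exact one_pos)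
  set l : Fin n → ℂ := fun j => μ * R j with hldef
  have hl0 : ∀ j, l j ≠ 0 := fun j => mul_ne_zero hμ (hR0 j)
  have hlinj : Function.Injective l := fun i j hij => hinj (mul_left_cancel₀ hμ hij)
  have hL : ∀ j, l j ^ n = μ ^ n := fun j => by rw [hldef]; simp [mul_pow, hroot]
  set u := odeSol hT a hp τ b with hu
  set v := birkSol R hT hq k μ with hv
  set w : Fin n → ℝ → ℂ := fun j x =>
    ∑ ν : Fin n, (l j)⁻¹ ^ (ν : ℕ) / n * u ν (projIcc 0 T hT x) with hw
  have hwu : ∀ (ν : Fin n) x, ∑ j, l j ^ (ν : ℕ) * w j x = u ν (projIcc 0 T hT x) :=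
    fun ν x => sum_pow_mul_sum_inv_pow hlinj hl0 hL (fun ν => u ν (projIcc 0 T hT x)) ν
  set D : Fin n → ℝ → ℂ := fun j x =>
    Complex.exp (-l k * x) * w j x - v j (projIcc 0 T hT x) with hD
  have hwD : ∀ j x, w j x = Complex.exp (l k * x) * (v j (projIcc 0 T hT x) + D j x) := by
    intro j x
    have : Complex.exp (l k * x) * Complex.exp (-l k * x) = 1 := by
      rw [← Complex.exp_add]; simp
    rw [hD]
    linear_combination (-w j x) * this
  have hwc : ∀ j, Continuous (w j) := fun j => by
    refine continuous_finsetSum _ fun ν _ => continuous_const.mul ?_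
    exact (u ν).continuous.comp continuous_projIcc
  have hvc : ∀ j, Continuous fun x => v j (projIcc 0 T hT x) := fun j =>
    (v j).continuous.comp continuous_projIcc
  have hDc : ∀ j, Continuous (D j) := fun j => by
    refine Continuous.sub (Continuous.mul (by fun_prop) (hwc j)) (hvc j)
  refine ⟨D, fun ν x => ?_, fun j x hx => ?_⟩
  · have := hwu ν x
    rw [projIcc_val] at this
    rw [← this, Finset.mul_sum]
    refine Finset.sum_congr rfl fun j _ => ?_
    rw [hwD, projIcc_val]; ring
  · set κ := ‖μ⁻¹‖ ^ (n - 1) * ‖τ - μ ^ n‖ with hκ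
    set s : Fin n → ℂ := fun j => (R j - R k) * μ with hs
    let H : Fin n → ℝ → ℂ := fun j t => l j / (n * μ ^ n) * (τ - μ ^ n) *
      (∑ i, (v i (projIcc 0 T hT t) + D i t)) +
      ∑ m, birkCoeff R μ j m * (q m t * ∑ i, R i ^ (m : ℕ) * D i t)
    let K : ℝ → ℝ := fun t => ∑ m : Fin (n - 1), ‖μ⁻¹‖ ^ (n - 1 - (m : ℕ)) * ‖q m t‖
    refine norm_le_of_exp_mul_sub_eq_integral (D := D) (H := H) (s := s) (κ := κ) (K := K)
      a.2.2 (fun j => (hDc j).continuousOn) (fun j => ?_) hg ?_ ?_ ?_ ?_ ?_ hτ ?_ ?_ j hx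
    · have := hgR j; rwa [mul_comm] at this
    · intro j x hx
      have hx' : x ∈ Icc 0 T := ⟨a.2.1.trans hx.1, hx.2⟩
      have eA := exp_mul_sum_inv_pow_odeSol_sub hT hp hn a τ b (hl0 j) ⟨x, hx'⟩ (w := w j)
        fun _ => rfl
      have eB := h.exp_mul_birkSol_sub hT hq k hR hP j a ⟨x, hx'⟩
      have hE : ∀ y : ℝ, Complex.exp (-s j * y) * Complex.exp (-l k * y) =
          Complex.exp (-l j * y) := fun y => by
        rw [← Complex.exp_add]; congr 1; simp only [hs, hldef]; ring
      have hE' : ∀ y : ℝ, Complex.exp (-l j * y) * Complex.exp (l k * y) =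
          Complex.exp (-s j * y) := fun y => by
        rw [← Complex.exp_add]; congr 1; simp only [hs, hldef]; ring
      have e1 : Complex.exp (-s j * x) * D j x - Complex.exp (-s j * (a : ℝ)) * D j a =
          (Complex.exp (-l j * x) * w j x - Complex.exp (-l j * (a : ℝ)) * w j a) -
          (Complex.exp (-s j * x) * v j ⟨x, hx'⟩ - Complex.exp (-s j * (a : ℝ)) * v j a) := by
        simp only [hD]
        rw [projIcc_val, projIcc_of_mem hT hx', ← hE, ← hE]
        ring
      have hi2 : ∀ m, IntervalIntegrable (fun t => birkCoeff R μ j m * (q m t *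
          (Complex.exp (-s j * t) * ∑ i, R i ^ (m : ℕ) * v i (projIcc 0 T hT t)))) volume a x := by
        intro m
        refine (IntervalIntegrable.mono_mem ?_ (hm a) (hm ⟨x, hx'⟩)).const_mul _
        refine (hq m).mul_continuousOn (Continuous.continuousOn ?_)
        exact Continuous.mul (by fun_prop)
          (continuous_finsetSum _ fun i _ => continuous_const.mul (hvc i))
      have hi1 : IntervalIntegrable (fun t => Complex.exp (-l j * t) * (l j / (n * l j ^ n) *
          ((τ - l j ^ n) * u ⟨0, by omega⟩ (projIcc 0 T hT t) -
          ∑ m : Fin (n - 1), p m t * u ⟨m, by omega⟩ (projIcc 0 T hT t)))) volume a x := by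
        have huc : ∀ i, Continuous fun x => u i (projIcc 0 T hT x) := fun j =>
          (u j).continuous.comp continuous_projIcc
        refine IntervalIntegrable.mono_mem ?_ (hm a) (hm ⟨x, hx'⟩)
        refine IntervalIntegrable.continuousOn_mul (IntervalIntegrable.const_mul ?_ _)
          (Continuous.continuousOn (by fun_prop))
        refine IntervalIntegrable.sub
          (continuous_const.mul (huc _)).continuousOn.intervalIntegrable ?_
        rw [← Finset.sum_fn]
        exact IntervalIntegrable.sum _ fun m _ => (hp m).mul_continuousOn (huc _).continuousOn
      rw [e1, eA, eB]
      simp only [← intervalIntegral.integral_const_mul]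
      rw [← intervalIntegral.integral_finsetSum fun m _ => hi2 m,
        ← intervalIntegral.integral_sub hi1]
      · refine intervalIntegral.integral_congr fun t ht => ?_
        rw [uIcc_of_le hx.1] at ht
        have ht' : t ∈ Icc (a : ℝ) T := ⟨ht.1, ht.2.trans hx.2⟩
        have hum : ∀ m : Fin n, u m (projIcc 0 T hT t) = Complex.exp (l k * t) * (μ ^ (m : ℕ) *
            (∑ i, R i ^ (m : ℕ) * v i (projIcc 0 T hT t) + ∑ i, R i ^ (m : ℕ) * D i t)) := by
          intro m
          rw [← hwu, ← Finset.sum_add_distrib, Finset.mul_sum, Finset.mul_sum]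
          refine Finset.sum_congr rfl fun i _ => ?_
          rw [hwD]; simp only [hldef, mul_pow]; ring
        have hc : ∀ m : Fin (n - 1), birkCoeff R μ j m = -(l j / (n * μ ^ n) * μ ^ (m : ℕ)) := by
          intro m
          have e3 : μ ^ n = μ * μ ^ (m : ℕ) * μ ^ (n - 1 - (m : ℕ)) := by
            rw [← pow_succ', ← pow_add]; congr 1; omega
          rw [birkCoeff, e3, inv_pow]
          simp only [hldef]
          field_simp
        simp only [H, hum, hL, ← hpq _ t ht', pow_zero, one_mul, Finset.sum_add_distrib, ← hE']
        rw [mul_add (Complex.exp _ * _), Finset.mul_sum (s := Finset.univ)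
          (a := Complex.exp _ * _), mul_sub, mul_sub, Finset.mul_sum, Finset.mul_sum, sub_sub,
          sub_eq_add_neg]
        congr 1
        · ring
        · rw [← Finset.sum_add_distrib, ← Finset.sum_neg_distrib]
          refine Finset.sum_congr rfl fun m _ => ?_
          rw [hc]
          ring
      · rw [← Finset.sum_fn]
        exact IntervalIntegrable.sum _ fun m _ => hi2 m
    · positivity
    · simp only [K]
      rw [← Finset.sum_fn]
      exact IntervalIntegrable.sum _ fun m _ =>
        ((hq m).norm.const_mul _).mono_mem (hm a) right_mem_uIcc
    · intro t; positivity
    · intro M t ht hM j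
      have hv2 : ∀ i, ‖v i (projIcc 0 T hT t)‖ ≤ 2 := fun i =>
        (((v i).norm_coe_le_norm _).trans (norm_le_pi_norm v i)).trans
          (h.norm_birkSol_le hT hq k hR hP)
      have hM0 : 0 ≤ M := (norm_nonneg _).trans (hM k)
      have e1 : ‖l j / (n * μ ^ n)‖ = ‖μ⁻¹‖ ^ (n - 1) / n := by
        have e3 : μ ^ n = μ * μ ^ (n - 1) := by rw [← pow_succ']; congr 1; omega
        rw [e3]
        simp only [hldef, norm_div, norm_mul, norm_inv, norm_pow, hR, Complex.norm_natCast,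
          inv_pow]
        have := norm_pos_iff.2 hμ
        field_simp
      have e2 : ‖∑ i, (v i (projIcc 0 T hT t) + D i t)‖ ≤ n * (M + 2) := by
        refine (norm_sum_le_of_le _ (n := fun _ => M + 2) fun i _ => ?_).trans_eq (by simp; ring)
        exact (norm_add_le _ _).trans (by linarith [hv2 i, hM i])
      have e3 : ∀ m : Fin (n - 1), ‖∑ i, R i ^ (m : ℕ) * D i t‖ ≤ n * M := fun m => by
        refine (norm_sum_le_of_le _ (n := fun _ => M) fun i _ => ?_).trans_eq (by simp)
        rw [norm_mul, norm_pow, hR, one_pow, one_mul]; exact hM i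
      refine (norm_add_le _ _).trans (add_le_add ?_ ?_)
      · rw [norm_mul, norm_mul, e1]
        calc _ ≤ ‖μ⁻¹‖ ^ (n - 1) / n * ‖τ - μ ^ n‖ * (n * (M + 2)) := by gcongr
          _ = _ := by rw [hκ]; field_simp
      · rw [Finset.sum_mul]
        refine norm_sum_le_of_le _ fun m _ => ?_
        rw [norm_mul, norm_mul, norm_birkCoeff R hR]
        calc _ ≤ ‖μ⁻¹‖ ^ (n - 1 - (m : ℕ)) / n * (‖q m t‖ * (n * M)) := by gcongr; exact e3 m
          _ = _ := by field_simp
    · have hP0 : ∀ m, 0 ≤ P m := fun m =>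
        (intervalIntegral.integral_nonneg hT fun _ _ => norm_nonneg _).trans (hP m)
      simp only [K]
      rw [intervalIntegral.integral_finsetSum fun m _ =>
        ((hq m).norm.const_mul _).mono_mem (hm a) right_mem_uIcc]
      simp only [intervalIntegral.integral_const_mul]
      refine le_trans ?_ h.small
      have h00 : 0 ≤ ∑ m, P m * ‖μ⁻¹‖ ^ (n - 1 - (m : ℕ)) :=
        Finset.sum_nonneg fun m _ => mul_nonneg (hP0 m) (by positivity)
      refine le_trans ?_ (le_mul_of_one_le_left h00
        (Real.one_le_exp (mul_nonneg h.nonneg hT)))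
      refine Finset.sum_le_sum fun m _ => ?_
      rw [mul_comm]
      refine mul_le_mul_of_nonneg_right ?_ (by positivity)
      refine le_trans ?_ (hP m)
      rw [← intervalIntegral.integral_add_adjacent_intervals
        ((hq m).norm.mono_mem left_mem_uIcc (hm a)) ((hq m).norm.mono_mem (hm a) right_mem_uIcc)]
      exact le_add_of_nonneg_left
        (intervalIntegral.integral_nonneg a.2.1 fun _ _ => norm_nonneg _)
    · intro j
      have : D j a = d j := by
        have e1 : w j a = Complex.exp (l k * (a : ℝ)) * (v j a + d j) := by
          simp only [hw, projIcc_val, hu, odeSol_apply_base, hb]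
          have e2 : ∀ ν : Fin n, (l j)⁻¹ ^ (ν : ℕ) / n * (Complex.exp (μ * R k * (a : ℝ)) *
              ∑ i, (μ * R i) ^ (ν : ℕ) * (birkSol R hT hq k μ i a + d i)) =
              ∑ i, Complex.exp (μ * R k * (a : ℝ)) * (birkSol R hT hq k μ i a + d i) *
              ((l j)⁻¹ ^ (ν : ℕ) / n * l i ^ (ν : ℕ)) := fun ν => by
            rw [Finset.mul_sum, Finset.mul_sum]
            refine Finset.sum_congr rfl fun i _ => ?_
            simp only [hldef]; ring
          rw [Finset.sum_congr rfl fun ν _ => e2 ν, Finset.sum_comm]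
          simp only [← Finset.mul_sum, sum_inv_pow_mul_pow_eq_ite hlinj hl0 hL]
          simp [hldef, hv]
        have e3 : Complex.exp (-l k * (a : ℝ)) * Complex.exp (l k * (a : ℝ)) = 1 := by
          rw [← Complex.exp_add]; simp
        simp only [hD]
        rw [e1, projIcc_val, ← mul_assoc, e3]; ring
      rw [this]; exact hd j
end

theorem norm_one_add_pow_sub_one_le {y : ℂ} (hy : ‖y‖ ≤ 1) (ν : ℕ) :
    ‖(1 + y) ^ ν - 1‖ ≤ (2 ^ ν - 1) * ‖y‖ := by
  induction ν with
  | zero => simp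
  | succ ν ih =>
    have e : (1 + y) ^ (ν + 1) - 1 = ((1 + y) ^ ν - 1) * (1 + y) + y := by ring
    have h2 : ‖1 + y‖ ≤ 2 := (norm_add_le _ _).trans (by rw [norm_one]; linarith)
    rw [e]
    calc _ ≤ ‖(1 + y) ^ ν - 1‖ * ‖1 + y‖ + ‖y‖ := (norm_add_le _ _).trans (by rw [norm_mul])
      _ ≤ (2 ^ ν - 1) * ‖y‖ * 2 + ‖y‖ := by
          gcongr
          exact mul_nonneg (sub_nonneg.2 (one_le_pow₀ one_le_two)) (norm_nonneg _)
      _ = _ := by ring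

/-- The exponential monomial `(ρ r) ^ ν * exp (ρ r x)` changes by a factor `1 + O(‖μ - ρ‖)` when
`ρ` is replaced by a nearby `μ`. -/
theorem exists_pow_mul_exp_eq {r ρ μ : ℂ} (hr : ‖r‖ = 1) (hρ : 1 ≤ ‖ρ‖) (hs : ‖μ - ρ‖ ≤ 1)
    {T x : ℝ} (hsT : ‖μ - ρ‖ * T ≤ 1) (hx : x ∈ Icc 0 T) {ν n : ℕ} (hν : ν < n) :
    ∃ F : ℂ, (μ * r) ^ ν * Complex.exp (μ * r * x) =
      (ρ * r) ^ ν * Complex.exp (ρ * r * x) * F ∧ ‖F‖ ≤ 3 * 2 ^ n ∧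
      ‖F - 1‖ ≤ 2 ^ n * (2 * T + 1) * ‖μ - ρ‖ := by
  have hρ0 : ρ ≠ 0 := norm_pos_iff.1 (by linarith)
  set y : ℂ := (μ - ρ) / ρ with hy
  set z : ℂ := (μ - ρ) * r * x with hz
  have hyn : ‖y‖ ≤ ‖μ - ρ‖ := by
    rw [hy, norm_div]; exact div_le_self (norm_nonneg _) hρ
  have hzn : ‖z‖ ≤ ‖μ - ρ‖ * T := by
    rw [hz, norm_mul, norm_mul, hr, mul_one, Complex.norm_real, Real.norm_of_nonneg hx.1]
    exact mul_le_mul_of_nonneg_left hx.2 (norm_nonneg _)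
  have hE := Complex.norm_exp_sub_one_le (hzn.trans hsT)
  have hA := norm_one_add_pow_sub_one_le (hyn.trans hs) ν
  have h2 : (2 : ℝ) ^ ν ≤ 2 ^ n := pow_le_pow_right₀ one_le_two hν.le
  have hA2 : ‖(1 + y) ^ ν‖ ≤ 2 ^ n := by
    rw [norm_pow]
    refine le_trans (pow_le_pow_left₀ (norm_nonneg _) ?_ ν) h2
    exact (norm_add_le _ _).trans (by rw [norm_one]; linarith [hyn.trans hs])
  have hE2 : ‖Complex.exp z‖ ≤ 3 := by
    calc ‖Complex.exp z‖ = ‖(Complex.exp z - 1) + 1‖ := by rw [sub_add_cancel]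
      _ ≤ ‖Complex.exp z - 1‖ + 1 := (norm_add_le _ _).trans (by rw [norm_one])
      _ ≤ 3 := by linarith [hzn.trans hsT]
  refine ⟨(1 + y) ^ ν * Complex.exp z, ?_, ?_, ?_⟩
  · have e1 : μ * r = ρ * r * (1 + y) := by rw [hy]; field_simp; ring
    have e2 : μ * r * x = ρ * r * x + z := by rw [hz]; ring
    rw [e2, e1, mul_pow, Complex.exp_add]; ring
  · rw [norm_mul, mul_comm]; gcongr
  · have e : (1 + y) ^ ν * Complex.exp z - 1 =
        (1 + y) ^ ν * (Complex.exp z - 1) + ((1 + y) ^ ν - 1) := by ring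
    rw [e]
    calc _ ≤ ‖(1 + y) ^ ν‖ * ‖Complex.exp z - 1‖ + ‖(1 + y) ^ ν - 1‖ :=
          (norm_add_le _ _).trans (by rw [norm_mul])
      _ ≤ 2 ^ n * (2 * (‖μ - ρ‖ * T)) + 2 ^ n * ‖μ - ρ‖ := by
          refine add_le_add (mul_le_mul hA2 (by linarith) (norm_nonneg _) (by positivity))
            (hA.trans (mul_le_mul (by linarith) hyn (norm_nonneg _) (by positivity)))
      _ = _ := by ring

theorem norm_exp_mul_sum_sub_le {n : ℕ} {R : Fin n → ℂ} (hR : ∀ j, ‖R j‖ = 1) {ρ μ : ℂ}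
    (hρ : 1 ≤ ‖ρ‖) (hμ : 1 ≤ ‖μ‖) (hs : ‖μ - ρ‖ ≤ 1) {T x : ℝ} (hT : 0 ≤ T)
    (hsT : ‖μ - ρ‖ * T ≤ 1) (hx : x ∈ Icc 0 T) {ν : ℕ} (hν : ν < n) {k : Fin n} {β : ℂ} {B : ℝ}
    (hβ : ‖β‖ ≤ B) {v D : Fin n → ℂ} {ε₁ ε₂ : ℝ}
    (hv : ∀ j, ‖v j - (if j = k then 1 + β / (μ * R k) else 0)‖ ≤ ε₁) (hD : ∀ j, ‖D j‖ ≤ ε₂) :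
    ‖Complex.exp (μ * R k * x) * ∑ j, (μ * R j) ^ ν * (v j + D j) -
      (ρ * R k) ^ ν * Complex.exp (ρ * R k * x) * (1 + β / (ρ * R k))‖ ≤
    ‖(ρ * R k) ^ ν * Complex.exp (ρ * R k * x)‖ * (3 * 2 ^ n * (n * (ε₁ + ε₂)) +
      (2 ^ n * (2 * T + 1) * (1 + B) + B) * ‖μ - ρ‖) := by
  obtain ⟨F, hF, hF3, hF1⟩ := exists_pow_mul_exp_eq (hR k) hρ hs hsT hx hν
  have hR0 : ∀ j, R j ≠ 0 := fun j => norm_pos_iff.1 (by rw [hR]; exact one_pos)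
  have hρ0 : ρ ≠ 0 := norm_pos_iff.1 (by linarith)
  have hμ0 : μ ≠ 0 := norm_pos_iff.1 (by linarith)
  set G := (ρ * R k) ^ ν * Complex.exp (ρ * R k * x) with hG
  set m : Fin n → ℂ := fun j => if j = k then 1 + β / (μ * R k) else 0 with hm
  have e0 : Complex.exp (μ * R k * x) * ∑ j, (μ * R j) ^ ν * m j =
      G * F * (1 + β / (μ * R k)) := by
    rw [Finset.sum_eq_single k (fun j _ hj => by simp [hm, hj]) (by simp), ← hF]
    simp only [hm, if_true]; ring
  have e1 : Complex.exp (μ * R k * x) * ∑ j, (μ * R j) ^ ν * (v j + D j) =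
      G * F * (1 + β / (μ * R k)) + G * F * ∑ j, (R j / R k) ^ ν * (v j - m j + D j) := by
    rw [← e0, ← hF, Finset.mul_sum, Finset.mul_sum, Finset.mul_sum, ← Finset.sum_add_distrib]
    refine Finset.sum_congr rfl fun j _ => ?_
    have : (μ * R k) ^ ν * (R j / R k) ^ ν = (μ * R j) ^ ν := by
      rw [← mul_pow]; congr 1; field_simp [hR0 k]
    linear_combination (-(Complex.exp (μ * R k * x) * (v j - m j + D j))) * this
  have e2 : G * F * (1 + β / (μ * R k)) + G * F * ∑ j, (R j / R k) ^ ν * (v j - m j + D j) -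
      G * (1 + β / (ρ * R k)) = G * (F * (∑ j, (R j / R k) ^ ν * (v j - m j + D j)) +
        ((F - 1) * (1 + β / (μ * R k)) + β * (-(μ - ρ) / (μ * ρ * R k)))) := by
    have : β / (μ * R k) - β / (ρ * R k) = β * (-(μ - ρ) / (μ * ρ * R k)) := by
      field_simp [hR0 k]; ring
    rw [← this]; ring
  rw [e1, e2, norm_mul]
  refine mul_le_mul_of_nonneg_left ?_ (norm_nonneg G)
  have hB : 0 ≤ B := (norm_nonneg _).trans hβ
  have hsum : ‖∑ j, (R j / R k) ^ ν * (v j - m j + D j)‖ ≤ n * (ε₁ + ε₂) := by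
    refine (norm_sum_le_of_le _ (n := fun _ => ε₁ + ε₂) fun j _ => ?_).trans_eq (by simp; ring)
    rw [norm_mul, norm_pow, norm_div, hR, hR, div_one, one_pow, one_mul]
    exact (norm_add_le _ _).trans (add_le_add (hv j) (hD j))
  have h1 : ‖1 + β / (μ * R k)‖ ≤ 1 + B := by
    refine (norm_add_le _ _).trans ?_
    rw [norm_one, norm_div, norm_mul, hR, mul_one]
    gcongr
    exact (div_le_self (norm_nonneg _) hμ).trans hβ
  have h2 : ‖β * (-(μ - ρ) / (μ * ρ * R k))‖ ≤ B * ‖μ - ρ‖ := by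
    rw [norm_mul, norm_div, norm_neg, norm_mul, norm_mul, hR, mul_one]
    have : ‖μ - ρ‖ / (‖μ‖ * ‖ρ‖) ≤ ‖μ - ρ‖ :=
      div_le_self (norm_nonneg _) (one_le_mul_of_one_le_of_one_le hμ hρ)
    exact mul_le_mul hβ this (by positivity) hB
  have h3 : 0 ≤ 2 ^ n * (2 * T + 1) * ‖μ - ρ‖ := by positivity
  calc _ ≤ ‖F‖ * ‖∑ j, (R j / R k) ^ ν * (v j - m j + D j)‖ +
        (‖F - 1‖ * ‖1 + β / (μ * R k)‖ + ‖β * (-(μ - ρ) / (μ * ρ * R k))‖) := by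
        refine (norm_add_le _ _).trans ?_
        rw [norm_mul]
        gcongr
        exact (norm_add_le _ _).trans (by rw [norm_mul])
    _ ≤ 3 * 2 ^ n * (n * (ε₁ + ε₂)) +
        (2 ^ n * (2 * T + 1) * ‖μ - ρ‖ * (1 + B) + B * ‖μ - ρ‖) := by gcongr
    _ = _ := by ring

section
variable {n : ℕ} {R : Fin n → ℂ} {T : ℝ} (hT : 0 ≤ T) {p q : Fin (n - 1) → ℝ → ℂ}
  (hp : ∀ m, IntervalIntegrable (p m) volume 0 T) (hq : ∀ m, IntervalIntegrable (q m) volume 0 T)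
  {P : Fin (n - 1) → ℝ} {C : ℝ}

open Filter Topology in
theorem eventually_norm_odeTower_sub_le (hn : 2 ≤ n)
    (hinj : Function.Injective R) (hroot : ∀ j, R j ^ n = 1) (hR : ∀ j, ‖R j‖ = 1)
    (hP : ∀ m, ∫ t in (0 : ℝ)..T, ‖q m t‖ ≤ P m) {a : Icc (0 : ℝ) T}
    (hpq : ∀ m, ∀ t ∈ Icc (a : ℝ) T, q m t = p m t) (ha : ∀ m, ∀ t < (a : ℝ), q m t = 0)
    {l : Filter ℂ} (hl : Tendsto (fun ρ : ℂ => ‖ρ‖) l atTop) {φ : ℂ → ℂ}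
    {b d : Fin n → ℂ → Fin n → ℂ} {g δ : Fin n → ℂ → ℝ}
    (hgood : ∀ᶠ ρ in l, BirkGood R T P C (φ ρ))
    (hφ : Tendsto (fun ρ => ‖ρ‖ * ‖φ ρ - ρ‖) l (𝓝 0))
    (hev : ∀ k, ∀ᶠ ρ in l, 0 ≤ g k ρ ∧ (∀ j, (φ ρ * (R j - R k)).re ≤ g k ρ) ∧
      (∀ j, ‖d k ρ j‖ ≤ δ k ρ) ∧ ∀ ν : Fin n, b k ρ ν = Complex.exp (φ ρ * R k * (a : ℝ)) *
        ∑ j, (φ ρ * R j) ^ (ν : ℕ) * (birkSol R hT hq k (φ ρ) j a + d k ρ j))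
    (hδ : ∀ k, Tendsto (fun ρ => ‖ρ‖ * (Real.exp (g k ρ * T) * (δ k ρ + ‖ρ ^ n - φ ρ ^ n‖)))
      l (𝓝 0)) {ε : ℝ} (hε : 0 < ε) :
    ∀ᶠ ρ in l, ∀ k : Fin n, ∀ ν < n, ∀ x ∈ Icc (a : ℝ) T,
      ‖odeTower hT a hp (ρ ^ n) (b k ρ) ν x - (ρ * R k) ^ ν * Complex.exp (ρ * R k * x) *
        (1 + (-(1 / (n : ℂ)) * ∫ t in (a : ℝ)..x, p ⟨n - 2, sub_two_lt_sub_one hn⟩ t) / (ρ * R k))‖ ≤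
      ε * ‖(ρ * R k) ^ ν * Complex.exp (ρ * R k * x)‖ / ‖ρ‖ := by
  rw [eventually_all]
  intro k
  have hn1 : (1 : ℝ) ≤ n := by exact_mod_cast (by omega : 1 ≤ n)
  have hm : ∀ x : Icc (0 : ℝ) T, (x : ℝ) ∈ uIcc 0 T := fun x => by
    rw [uIcc_of_le hT]; exact x.2
  set B := P ⟨n - 2, sub_two_lt_sub_one hn⟩ with hB
  have hB0 : 0 ≤ B :=
    (intervalIntegral.integral_nonneg hT fun _ _ => norm_nonneg _).trans (hP _)
  set K := 2 ^ n * (2 * T + 1) * (1 + B) + B with hK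
  have hK0 : 0 ≤ K := by positivity
  set A : ℝ := 3 * 2 ^ n * n with hA
  have hA0 : 0 < A := by positivity
  set ε' := ε / (6 * A) with hε'
  have hε'0 : 0 < ε' := by positivity
  set η := ε / (3 * A * (4 * (1 + 2 * T))) with hη
  have hη0 : 0 < η := by positivity
  set ζ := ε / (3 * (K + 1)) with hζ
  have hζ0 : 0 < ζ := by positivity
  obtain ⟨N, hN⟩ := (eventually_norm_birkSol_sub_le (R := R) hT hq hn hinj hroot hR hP C ha
    hε'0).exists
  filter_upwards [hgood, hev k, hl.eventually_ge_atTop (2 * N), hl.eventually_ge_atTop 2,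
    hφ.eventually_le_const hζ0, hφ.eventually_le_const one_pos,
    hφ.eventually_le_const (show (0 : ℝ) < 1 / (T + 1) by positivity),
    (hδ k).eventually_le_const hη0,
    (hδ k).eventually_le_const (show (0 : ℝ) < 1 / (4 * (T + 1)) by positivity)]
    with ρ hg ⟨hg0, hgR, hd, hb⟩ hρN hρ2 hφζ hφ1 hφT hδη hδT ν hν x hx
  have hρ0 : 0 < ‖ρ‖ := by linarith
  have hx' : x ∈ Icc 0 T := ⟨a.2.1.trans hx.1, hx.2⟩
  set μ := φ ρ with hμdef
  set s := ‖μ - ρ‖ with hs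
  have hs0 : 0 ≤ s := norm_nonneg _
  have hsρ : s ≤ ‖ρ‖ * s := le_mul_of_one_le_left hs0 (by linarith)
  have hs1 : s ≤ 1 := hsρ.trans hφ1
  have hsT : s * T ≤ 1 := by
    have : s ≤ 1 / (T + 1) := hsρ.trans hφT
    rw [le_div_iff₀ (by linarith)] at this
    linarith
  have hμρ : ‖ρ‖ / 2 ≤ ‖μ‖ := by
    have := norm_sub_norm_le ρ μ
    rw [norm_sub_rev, ← hs] at this
    linarith
  have hμ1 : 1 ≤ ‖μ‖ := by linarith
  set X := ‖ρ ^ n - μ ^ n‖ with hX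
  set Eg := Real.exp (g k ρ * T) with hEg
  have hEg1 : 1 ≤ Eg := Real.one_le_exp (by positivity)
  have hδ0 : 0 ≤ δ k ρ := (norm_nonneg _).trans (hd k)
  have hX0 : 0 ≤ X := norm_nonneg _
  set W := Eg * (δ k ρ + X) with hW
  have hW0 : 0 ≤ W := by positivity
  have hWρ : W ≤ ‖ρ‖ * W := le_mul_of_one_le_left hW0 (by linarith)
  have hXW : X ≤ W := by
    rw [hW]; exact le_trans (by linarith) (le_mul_of_one_le_left (by positivity) hEg1)
  have hpow : ‖μ⁻¹‖ ^ (n - 1) ≤ 1 := by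
    refine pow_le_one₀ (norm_nonneg _) ?_
    rw [norm_inv]; exact inv_le_one_of_one_le₀ hμ1
  have hκX : (T - a) * (‖μ⁻¹‖ ^ (n - 1) * X) ≤ T * X := by
    refine mul_le_mul (by linarith [a.2.1]) (mul_le_of_le_one_left hX0 hpow) (by positivity) hT
  have hτ : (T - a) * (‖μ⁻¹‖ ^ (n - 1) * X) ≤ 1 / 4 := by
    refine hκX.trans ?_
    have h1 : X ≤ 1 / (4 * (T + 1)) := hXW.trans (hWρ.trans hδT)
    rw [le_div_iff₀ (by linarith)] at h1
    nlinarith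
  obtain ⟨D, hDsol, hD⟩ := hg.exists_odeSol_eq hT hp hq k hn hinj hroot hR hP hpq hg0 hgR hτ hd hb
  have hint : ∫ t in (a : ℝ)..x, q ⟨n - 2, sub_two_lt_sub_one hn⟩ t =
      ∫ t in (a : ℝ)..x, p ⟨n - 2, sub_two_lt_sub_one hn⟩ t := by
    refine intervalIntegral.integral_congr fun t ht => ?_
    rw [uIcc_of_le hx.1] at ht
    exact hpq _ t ⟨ht.1, ht.2.trans hx.2⟩
  have hβ : ‖-(1 / (n : ℂ)) * ∫ t in (a : ℝ)..x, p ⟨n - 2, sub_two_lt_sub_one hn⟩ t‖ ≤ B := by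
    rw [norm_mul, norm_neg, norm_div, norm_one, Complex.norm_natCast, ← hint]
    refine (mul_le_of_le_one_left (norm_nonneg _) ((div_le_one (by linarith)).2 hn1)).trans ?_
    refine (intervalIntegral.norm_integral_le_integral_norm hx.1).trans (le_trans ?_ (hP _))
    refine intervalIntegral.integral_mono_interval a.2.1 hx.1 hx.2
      (Eventually.of_forall fun _ => norm_nonneg _) (hq _).norm
  have hv : ∀ j, ‖birkSol R hT hq k μ j ⟨x, hx'⟩ - (if j = k then
      1 + (-(1 / (n : ℂ)) * ∫ t in (a : ℝ)..x, p ⟨n - 2, sub_two_lt_sub_one hn⟩ t) / (μ * R k) else 0)‖ ≤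
      ε' / ‖μ‖ := fun j => by
    rw [← hint]; exact hN μ hg (by linarith) k j ⟨x, hx'⟩
  have hD' : ∀ j, ‖D j x‖ ≤ 4 * (1 + 2 * T) * W := fun j => by
    refine (hD j x hx).trans ?_
    have h1 : Real.exp (g k ρ * (x - a)) ≤ Eg :=
      Real.exp_le_exp.2 (mul_le_mul_of_nonneg_left (by linarith [hx.2, a.2.1]) hg0)
    calc _ ≤ 4 * (δ k ρ + 2 * (T * X)) * Eg := by
          refine mul_le_mul ?_ h1 (Real.exp_pos _).le (by positivity)
          linarith
      _ ≤ 4 * ((1 + 2 * T) * (δ k ρ + X)) * Eg := by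
          gcongr
          nlinarith [mul_nonneg hT hδ0]
      _ = _ := by rw [hW]; ring
  have hfin := norm_exp_mul_sum_sub_le hR (by linarith : 1 ≤ ‖ρ‖) hμ1 hs1 hT hsT hx' hν hβ hv hD'
  rw [odeTower_of_lt hT a hp (ρ ^ n) (b k ρ) hν x, projIcc_of_mem hT hx', hDsol]
  refine hfin.trans ?_
  rw [mul_comm ε, mul_div_assoc]
  refine mul_le_mul_of_nonneg_left ?_ (norm_nonneg _)
  rw [le_div_iff₀ hρ0]
  have t1 : A * (ε' / ‖μ‖) * ‖ρ‖ ≤ ε / 3 := by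
    have : ‖ρ‖ / ‖μ‖ ≤ 2 := by rw [div_le_iff₀ (by linarith)]; linarith
    calc A * (ε' / ‖μ‖) * ‖ρ‖ = A * ε' * (‖ρ‖ / ‖μ‖) := by ring
      _ ≤ A * ε' * 2 := by gcongr
      _ = ε / 3 := by rw [hε']; field_simp; norm_num
  have t2 : A * (4 * (1 + 2 * T) * W) * ‖ρ‖ ≤ ε / 3 := by
    calc A * (4 * (1 + 2 * T) * W) * ‖ρ‖ = A * (4 * (1 + 2 * T)) * (‖ρ‖ * W) := by ring
      _ ≤ A * (4 * (1 + 2 * T)) * η := by gcongr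
      _ = ε / 3 := by rw [hη]; field_simp
  have t3 : K * s * ‖ρ‖ ≤ ε / 3 := by
    calc K * s * ‖ρ‖ = K * (‖ρ‖ * s) := by ring
      _ ≤ (K + 1) * ζ := by gcongr; linarith
      _ = ε / 3 := by rw [hζ]; field_simp
  calc _ = A * (ε' / ‖μ‖) * ‖ρ‖ + A * (4 * (1 + 2 * T) * W) * ‖ρ‖ + K * s * ‖ρ‖ := by
        rw [hA]; ring
    _ ≤ ε := by linarith

end

section roots
variable {n : ℕ} {R : Fin n → ℂ}

theorem sum_eq_zero_of_pow_eq_one (hn : 2 ≤ n) (hinj : Function.Injective R)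
    (hroot : ∀ j, R j ^ n = 1) : ∑ j, R j = 0 := by
  have hR0 : ∀ j, R j ≠ 0 := fun j h => by
    have := hroot j; rw [h, zero_pow (by omega)] at this; exact zero_ne_one this
  have hn0 : (n : ℂ) ≠ 0 := by exact_mod_cast (by omega : n ≠ 0)
  have h := sum_pow_mul_sum_inv_pow hinj hR0 hroot
    (Pi.single (⟨0, by omega⟩ : Fin n) (n : ℂ)) ⟨1, by omega⟩
  have e : ∀ j, ∑ ν : Fin n, (R j)⁻¹ ^ (ν : ℕ) / n *
      (Pi.single (⟨0, by omega⟩ : Fin n) (n : ℂ) : Fin n → ℂ) ν = 1 := fun j => by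
    rw [Finset.sum_eq_single ⟨0, by omega⟩ (fun ν _ hν => by simp [hν]) (by simp)]
    simp [hn0]
  simp only [e, pow_one, mul_one] at h
  rw [h]; simp

/-- Three or more roots of unity, in any order, admit an obtuse angle between two increments. -/
theorem exists_re_mul_conj_neg (hn : 3 ≤ n) (hinj : Function.Injective R)
    (hroot : ∀ j, R j ^ n = 1) (hR : ∀ j, ‖R j‖ = 1) :
    ∃ i j k l : Fin n, i < j ∧ k < l ∧
      ((R j - R i) * (starRingEnd ℂ) (R l - R k)).re < 0 := by
  by_contra! H
  set i : Fin n := ⟨0, by omega⟩ with hi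
  set j : Fin n := ⟨1, by omega⟩ with hj
  have hij : i < j := by simp [hi, hj, Fin.lt_def]
  have hne : R j - R i ≠ 0 := sub_ne_zero.2 fun h => hij.ne' (hinj h)
  set c := R j - R i with hc
  have h0 : ∀ l, -(if l = i then ‖c‖ ^ 2 else 0) ≤ (c * (starRingEnd ℂ) (R l - R j)).re := by
    intro l
    rcases lt_trichotomy l j with h | h | h
    · have hl : l = i := by
        rw [Fin.lt_def] at h; rw [Fin.ext_iff]; simp [hj, hi] at h ⊢; omega
      have : R i - R j = -c := by rw [hc]; ring
      rw [hl, this, if_pos rfl, map_neg, mul_neg, Complex.mul_conj, Complex.neg_re,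
        Complex.ofReal_re, Complex.normSq_eq_norm_sq]
    · rw [h]; simp [hij.ne']
    · have := H i j j l hij h
      rw [if_neg (hij.trans h).ne', neg_zero]; exact this
  have h1 := Finset.sum_le_sum fun l (_ : l ∈ Finset.univ) => h0 l
  rw [Finset.sum_neg_distrib, Finset.sum_ite_eq' Finset.univ i, if_pos (Finset.mem_univ _),
    ← Complex.re_sum, ← Finset.mul_sum, ← map_sum, Finset.sum_sub_distrib,
    sum_eq_zero_of_pow_eq_one (by omega) hinj hroot] at h1
  simp only [Finset.sum_const, Finset.card_univ, Fintype.card_fin, nsmul_eq_mul] at h1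
  have e1 : ‖c‖ ^ 2 = 2 * (c * (starRingEnd ℂ) (R j)).re := by
    have a1 : ∀ k, (R k).re * (R k).re + (R k).im * (R k).im = 1 := fun k => by
      rw [← Complex.normSq_apply, Complex.normSq_eq_norm_sq, hR, one_pow]
    rw [← Complex.normSq_eq_norm_sq, Complex.normSq_apply, hc]
    simp only [Complex.sub_re, Complex.sub_im, Complex.mul_re, Complex.conj_re, Complex.conj_im]
    linear_combination a1 i - a1 j
  have e2 : (c * (starRingEnd ℂ) (0 - (n : ℂ) * R j)).re =
      -(n * (c * (starRingEnd ℂ) (R j)).re) := by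
    simp [Complex.mul_re]; ring
  rw [e2] at h1
  have hpos : 0 < ‖c‖ ^ 2 := by positivity
  have hn3 : (3 : ℝ) ≤ n := by exact_mod_cast hn
  nlinarith

end roots

theorem norm_pow_sub_pow_le {x y : ℂ} {M : ℝ} (hM : 1 ≤ M) (hx : ‖x‖ ≤ M) (hy : ‖y‖ ≤ M) (n : ℕ) :
    ‖x ^ n - y ^ n‖ ≤ n * M ^ n * ‖x - y‖ := by
  induction n with
  | zero => simp
  | succ n ih =>
    have e : x ^ (n + 1) - y ^ (n + 1) = x * (x ^ n - y ^ n) + (x - y) * y ^ n := by ring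
    have h0 : 0 ≤ M := by linarith
    have h1 : M ^ n ≤ M ^ (n + 1) := pow_le_pow_right₀ hM (Nat.le_succ n)
    rw [e]
    calc _ ≤ ‖x‖ * ‖x ^ n - y ^ n‖ + ‖x - y‖ * ‖y‖ ^ n :=
          (norm_add_le _ _).trans (by rw [norm_mul, norm_mul, norm_pow])
      _ ≤ M * (n * M ^ n * ‖x - y‖) + ‖x - y‖ * M ^ (n + 1) := by
          gcongr
          exact (pow_le_pow_left₀ (norm_nonneg _) hy n).trans h1
      _ = _ := by push_cast; ring

open Filter Topology in
theorem tendsto_exp_linear_sub_sq {c : ℝ} (hc : 0 < c) (A B K : ℝ) :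
    Tendsto (fun r : ℝ => K * Real.exp (B * (r + A) - c * r ^ 2)) atTop (𝓝 0) := by
  have h1 : Tendsto (fun r : ℝ => B - c * r) atTop atBot :=
    tendsto_atBot_add_const_left _ B (tendsto_neg_atTop_atBot.comp
      (tendsto_id.const_mul_atTop hc))
  have h2 : Tendsto (fun r : ℝ => B * (r + A) - c * r ^ 2) atTop atBot := by
    refine (tendsto_atBot_add_const_left _ (B * A) (tendsto_id.atTop_mul_atBot₀ h1)).congr ?_
    intro r; simp only [id]; ring
  simpa using (Real.tendsto_exp_atBot.comp h2).const_mul K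

section
variable {n : ℕ} {R : Fin n → ℂ} {T : ℝ}

/-- For `‖μ‖` large only the ordering condition in `BirkGood` matters. -/
theorem exists_birkGood_of_norm_ge (R : Fin n → ℂ) {P : Fin (n - 1) → ℝ} (hP0 : ∀ m, 0 ≤ P m)
    (T : ℝ) {C : ℝ} (hC : 0 ≤ C) :
    ∃ N : ℝ, 0 < N ∧ ∀ μ : ℂ, N ≤ ‖μ‖ → (∀ j l : Fin n, j < l → (μ * (R j - R l)).re ≤ C) →
      BirkGood R T P C μ := by
  have hS : 0 ≤ ∑ m, P m := Finset.sum_nonneg fun m _ => hP0 m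
  refine ⟨1 + 2 * (Real.exp (C * T) * ∑ m, P m), by positivity, fun μ hμ ho => ?_⟩
  have h0 : 0 ≤ Real.exp (C * T) * ∑ m, P m := by positivity
  have hμ1 : 1 ≤ ‖μ‖ := by linarith
  refine ⟨norm_pos_iff.1 (by linarith), hC, ho, ?_⟩
  calc _ ≤ Real.exp (C * T) * ∑ m, P m * ‖μ‖⁻¹ := by
        gcongr with m
        · exact hP0 m
        · exact pow_sub_le_self hμ1 m
    _ = (Real.exp (C * T) * ∑ m, P m) / ‖μ‖ := by
        rw [← Finset.sum_mul, ← mul_assoc, div_eq_mul_inv]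
    _ ≤ 1 / 2 := by rw [div_le_iff₀ (by linarith)]; linarith

theorem re_mul_sub_le_of_mem_closure {S : Set ℂ}
    (hord : ∀ ρ ∈ S, ∀ k l : Fin n, k < l → (ρ * R k).re < (ρ * R l).re) {ρ : ℂ}
    (hρ : ρ ∈ closure S) {j l : Fin n} (h : j < l) : (ρ * (R j - R l)).re ≤ 0 := by
  have hc : IsClosed {ρ : ℂ | (ρ * (R j - R l)).re ≤ 0} :=
    isClosed_le (by fun_prop) continuous_const
  refine closure_minimal (fun ρ hρ => ?_) hc hρ
  have := hord ρ hρ j l h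
  change (ρ * (R j - R l)).re ≤ 0
  rw [mul_sub, Complex.sub_re]; linarith

/-- For `n ≥ 3` an exponentially small entire perturbation of the spectral parameter moves all of
`closure S` into the region where the Birkhoff system is uniquely solvable. -/
theorem exists_differentiable_birkGood (hn : 3 ≤ n) (hinj : Function.Injective R)
    (hroot : ∀ j, R j ^ n = 1) (hR : ∀ j, ‖R j‖ = 1) {P : Fin (n - 1) → ℝ} (hP0 : ∀ m, 0 ≤ P m)
    (T : ℝ) {S : Set ℂ} (hne : S.Nonempty)
    (hord : ∀ ρ ∈ S, ∀ k l : Fin n, k < l → (ρ * R k).re < (ρ * R l).re) :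
    ∃ (φ : ℂ → ℂ) (A c C N : ℝ), 0 < A ∧ 0 < c ∧ Differentiable ℂ φ ∧
      (∀ ρ ∈ closure S, ‖φ ρ - ρ‖ ≤ A * Real.exp (-(c * ‖ρ‖ ^ 2))) ∧
      (∀ ρ ∈ closure S, N ≤ ‖ρ‖ → BirkGood R T P C (φ ρ)) ∧
      ∀ ρ ∈ closure S, ∃ C, BirkGood R T P C (φ ρ) := by
  obtain ⟨ω, hω⟩ := hne
  obtain ⟨i₁, j₁, i₂, j₂, h₁, h₂, hneg⟩ := exists_re_mul_conj_neg hn hinj hroot hR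
  set D₁ := R j₁ - R i₁ with hD₁
  set D₂ := R j₂ - R i₂ with hD₂
  have hDn : ∀ i j, ‖R i - R j‖ ≤ 2 := fun i j =>
    (norm_sub_le _ _).trans (by rw [hR, hR]; norm_num)
  set c := -(D₁ * (starRingEnd ℂ) D₂).re with hc
  have hc0 : 0 < c := by linarith
  have hz : ∀ ρ ∈ closure S, c * ‖ρ‖ ^ 2 ≤ (ρ ^ 2 * D₁ * D₂).re := fun ρ hρ => by
    have a1 : 0 ≤ (ρ * D₁).re := by
      have := re_mul_sub_le_of_mem_closure hord hρ h₁
      rw [← neg_sub, mul_neg, Complex.neg_re] at this; linarith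
    have a2 : 0 ≤ (ρ * D₂).re := by
      have := re_mul_sub_le_of_mem_closure hord hρ h₂
      rw [← neg_sub, mul_neg, Complex.neg_re] at this; linarith
    have e : (ρ ^ 2 * D₁ * D₂).re = 2 * ((ρ * D₁).re * (ρ * D₂).re) + c * ‖ρ‖ ^ 2 := by
      rw [← Complex.normSq_eq_norm_sq, Complex.normSq_apply, hc]
      simp only [Complex.mul_re, Complex.mul_im, Complex.conj_re, Complex.conj_im, pow_two]
      ring
    rw [e]; have := mul_nonneg a1 a2; linarith
  obtain ⟨κ, hκ0, hκ⟩ : ∃ κ > 0, ∀ j l : Fin n, j < l → (ω * (R j - R l)).re ≤ -κ := by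
    have hf : ∀ x : Fin n × Fin n, ∃ κ > 0, x.1 < x.2 → (ω * (R x.1 - R x.2)).re ≤ -κ := by
      intro x
      by_cases hx : x.1 < x.2
      · refine ⟨(ω * R x.2).re - (ω * R x.1).re, sub_pos.2 (hord ω hω _ _ hx), fun _ => ?_⟩
        rw [mul_sub, Complex.sub_re]; linarith
      · exact ⟨1, one_pos, fun h => absurd h hx⟩
    choose f hf0 hf using hf
    have : Nonempty (Fin n × Fin n) := ⟨(i₁, i₁)⟩
    obtain ⟨x₀, -, hx₀⟩ := Finset.exists_min_image Finset.univ f Finset.univ_nonempty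
    exact ⟨f x₀, hf0 x₀, fun j l h => (hf (j, l) h).trans
      (neg_le_neg (hx₀ (j, l) (Finset.mem_univ _)))⟩
  have hω0 : 0 < ‖ω‖ := by
    rw [norm_pos_iff]; rintro rfl
    have := hord 0 hω _ _ h₁
    simp at this
  obtain ⟨N₁, hN₁, hgood₁⟩ := exists_birkGood_of_norm_ge R hP0 T le_rfl
  set δ := 4 * N₁ / κ with hδ
  have hδ0 : 0 < δ := by positivity
  have hδκ : δ * κ = 4 * N₁ := by rw [hδ]; field_simp
  obtain ⟨N₂, hN₂, hgood₂⟩ := exists_birkGood_of_norm_ge R hP0 T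
    (show 0 ≤ 2 * (δ * ‖ω‖) by positivity)
  set M := N₂ + δ * ‖ω‖ with hM
  have hM0 : 0 < M := by positivity
  set θ := min 1 (κ / (8 * ‖ω‖)) with hθ
  have hθ0 : 0 < θ := by positivity
  set a := θ / (4 * M ^ 2) with ha
  have ha0 : 0 < a := by positivity
  have hexp : ∀ ρ ∈ closure S, ‖Complex.exp (-(a * (ρ ^ 2 * D₁ * D₂)))‖ ≤
      Real.exp (-(a * c * ‖ρ‖ ^ 2)) := fun ρ hρ => by
    rw [Complex.norm_exp, Real.exp_le_exp, Complex.neg_re, Complex.re_ofReal_mul, neg_le_neg_iff,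
      mul_assoc]
    exact mul_le_mul_of_nonneg_left (hz ρ hρ) ha0.le
  set φ : ℂ → ℂ := fun ρ => ρ + δ * ω * Complex.exp (-(a * (ρ ^ 2 * D₁ * D₂))) with hφ
  have hdist : ∀ ρ ∈ closure S, ‖φ ρ - ρ‖ ≤ δ * ‖ω‖ * Real.exp (-(a * c * ‖ρ‖ ^ 2)) := by
    intro ρ hρ
    rw [hφ]
    simp only [add_sub_cancel_left]
    rw [norm_mul, norm_mul, Complex.norm_real, Real.norm_of_nonneg hδ0.le]
    exact mul_le_mul_of_nonneg_left (hexp ρ hρ) (by positivity)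
  have hdist' : ∀ ρ ∈ closure S, ‖φ ρ - ρ‖ ≤ δ * ‖ω‖ := fun ρ hρ =>
    (hdist ρ hρ).trans (mul_le_of_le_one_right (by positivity)
      (Real.exp_le_one_iff.2 (by rw [neg_nonpos]; positivity)))
  have hfar : ∀ ρ ∈ closure S, M ≤ ‖ρ‖ → BirkGood R T P (2 * (δ * ‖ω‖)) (φ ρ) := by
    intro ρ hρ hMρ
    have hd := hdist' ρ hρ
    refine hgood₂ _ ?_ fun j l hjl => ?_
    · have := norm_sub_norm_le ρ (φ ρ)
      rw [norm_sub_rev] at this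
      linarith
    · have e : (φ ρ * (R j - R l)).re =
          (ρ * (R j - R l)).re + ((φ ρ - ρ) * (R j - R l)).re := by
        rw [← Complex.add_re]; congr 1; ring
      rw [e]
      have h1 := re_mul_sub_le_of_mem_closure hord hρ hjl
      have h2 : ((φ ρ - ρ) * (R j - R l)).re ≤ δ * ‖ω‖ * 2 :=
        (Complex.re_le_norm _).trans (by rw [norm_mul]; gcongr; exact hDn j l)
      linarith
  refine ⟨φ, δ * ‖ω‖, a * c, _, M, by positivity, by positivity, by fun_prop, hdist, hfar,
    fun ρ hρ => ?_⟩
  rcases le_or_gt M ‖ρ‖ with hMρ | hMρ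
  · exact ⟨_, hfar ρ hρ hMρ⟩
  · have hzn : ‖-(a * (ρ ^ 2 * D₁ * D₂))‖ ≤ θ := by
      rw [norm_neg, norm_mul, norm_mul, norm_mul, norm_pow, Complex.norm_real,
        Real.norm_of_nonneg ha0.le]
      calc a * (‖ρ‖ ^ 2 * ‖D₁‖ * ‖D₂‖) ≤ a * (M ^ 2 * 2 * 2) := by
            gcongr
            · exact hDn _ _
            · exact hDn _ _
        _ = θ := by rw [ha]; field_simp; norm_num
    have h1 := Complex.norm_exp_sub_one_le (hzn.trans (min_le_left _ _))
    set w := Complex.exp (-(a * (ρ ^ 2 * D₁ * D₂))) with hw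
    have h2 : ‖w - 1‖ * ‖ω‖ ≤ κ / 4 := by
      have : ‖w - 1‖ ≤ 2 * (κ / (8 * ‖ω‖)) :=
        h1.trans (by linarith [hzn.trans (min_le_right 1 (κ / (8 * ‖ω‖)))])
      calc _ ≤ 2 * (κ / (8 * ‖ω‖)) * ‖ω‖ := by gcongr
        _ = κ / 4 := by field_simp; norm_num
    have h3 : ∀ j l : Fin n, j < l → (φ ρ * (R j - R l)).re ≤ -(2 * N₁) := by
      intro j l hjl
      have e : (φ ρ * (R j - R l)).re = (ρ * (R j - R l)).re +
          δ * ((ω * (R j - R l)).re + ((w - 1) * ω * (R j - R l)).re) := by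
        rw [← Complex.add_re, ← Complex.re_ofReal_mul, ← Complex.add_re]
        congr 1; simp only [hφ, ← hw]; ring
      have h4 := re_mul_sub_le_of_mem_closure hord hρ hjl
      have h5 : ((w - 1) * ω * (R j - R l)).re ≤ κ / 2 := by
        refine (Complex.re_le_norm _).trans ?_
        rw [norm_mul, norm_mul]
        calc _ ≤ κ / 4 * 2 := mul_le_mul h2 (hDn j l) (norm_nonneg _) (by positivity)
          _ = κ / 2 := by ring
      rw [e]
      have h6 : δ * ((ω * (R j - R l)).re + ((w - 1) * ω * (R j - R l)).re) ≤ δ * (-(κ / 2)) :=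
        mul_le_mul_of_nonneg_left (by linarith [hκ j l hjl]) hδ0.le
      linarith
    refine ⟨0, hgood₁ _ ?_ fun j l hjl => (h3 j l hjl).trans (by linarith)⟩
    have h4 := (Complex.abs_re_le_norm (φ ρ * (R i₁ - R j₁)))
    have h5 := (neg_le_abs _).trans h4
    rw [norm_mul] at h5
    have h6 := mul_le_mul_of_nonneg_left (hDn i₁ j₁) (norm_nonneg (φ ρ))
    linarith [h3 i₁ j₁ h₁]

end

section
variable {n : ℕ} {R : Fin n → ℂ} {T : ℝ} (hT : 0 ≤ T) {p : Fin (n - 1) → ℝ → ℂ}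
  (hp : ∀ m, IntervalIntegrable (p m) volume 0 T) {a : Icc (0 : ℝ) T}

theorem IntervalIntegrable.indicator_Ici {f : ℝ → ℂ} {T : ℝ} (hf : IntervalIntegrable f volume 0 T)
    (a : ℝ) : IntervalIntegrable ((Ici a).indicator f) volume 0 T :=
  ⟨hf.1.indicator measurableSet_Ici, hf.2.indicator measurableSet_Ici⟩

theorem integral_norm_indicator_Ici {T : ℝ} (hT : 0 ≤ T) {f : ℝ → ℂ}
    (hf : IntervalIntegrable f volume 0 T) (a : Icc (0 : ℝ) T) :
    ∫ t in (0 : ℝ)..T, ‖(Ici (a : ℝ)).indicator f t‖ = ∫ t in (a : ℝ)..T, ‖f t‖ := by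
  have hm : (a : ℝ) ∈ uIcc 0 T := by rw [uIcc_of_le hT]; exact a.2
  have hi := (hf.indicator_Ici a).norm
  rw [← intervalIntegral.integral_add_adjacent_intervals (hi.mono_mem left_mem_uIcc hm)
    (hi.mono_mem hm right_mem_uIcc)]
  have e1 : ∫ t in (0 : ℝ)..a, ‖(Ici (a : ℝ)).indicator f t‖ = 0 := by
    refine intervalIntegral.integral_zero_ae ?_
    have : ∀ᵐ t : ℝ, t ≠ a := by simp [ae_iff, measure_singleton]
    filter_upwards [this] with t ht ht'
    rw [uIoc_of_le a.2.1] at ht'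
    have : t ∉ Ici (a : ℝ) := fun h => ht (le_antisymm ht'.2 h)
    rw [indicator_of_notMem this, norm_zero]
  rw [e1, zero_add]
  refine intervalIntegral.integral_congr fun t ht => ?_
  rw [uIcc_of_le a.2.2] at ht
  simp only [indicator_of_mem (show t ∈ Ici (a : ℝ) from ht.1)]

open Filter Topology in
/-- Cauchy data at `a`, analytic in `ρ` near `D`, for a fundamental system of solutions with the
Birkhoff asymptotics along `l`. -/
structure IsBirkhoffData (R : Fin n → ℂ) (hT : 0 ≤ T)
    (hp : ∀ m, IntervalIntegrable (p m) volume 0 T) (hn : 2 ≤ n) (a : Icc (0 : ℝ) T) (D : Set ℂ)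
    (l : Filter ℂ) (b : Fin n → ℂ → Fin n → ℂ) : Prop where
  analyticAt : ∀ k, ∀ ρ ∈ D, AnalyticAt ℂ (b k) ρ
  det_ne_zero : ∀ ρ ∈ D, (Matrix.of fun ν k : Fin n => b k ρ ν).det ≠ 0
  asymptotics : ∀ ε > 0, ∀ᶠ ρ in l, ∀ k : Fin n, ∀ ν < n, ∀ x ∈ Icc (a : ℝ) T,
    ‖odeTower hT a hp (ρ ^ n) (b k ρ) ν x - (ρ * R k) ^ ν * Complex.exp (ρ * R k * x) *
      (1 + (-(1 / (n : ℂ)) * ∫ t in (a : ℝ)..x, p ⟨n - 2, sub_two_lt_sub_one hn⟩ t) / (ρ * R k))‖ ≤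
    ε * ‖(ρ * R k) ^ ν * Complex.exp (ρ * R k * x)‖ / ‖ρ‖

theorem re_mul_sub_le_two_mul (hR : ∀ j, ‖R j‖ = 1) (μ : ℂ) (j k : Fin n) :
    (μ * (R j - R k)).re ≤ 2 * ‖μ‖ := by
  refine (Complex.re_le_norm _).trans ?_
  rw [norm_mul, mul_comm]
  exact mul_le_mul_of_nonneg_right
    ((norm_sub_le _ _).trans (by rw [hR, hR]; norm_num)) (norm_nonneg _)

variable {S : Set ℂ}

open Filter Topology in
theorem exists_isBirkhoffData_of_three_le (hn : 3 ≤ n) (hinj : Function.Injective R)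
    (hroot : ∀ j, R j ^ n = 1) (hR : ∀ j, ‖R j‖ = 1) (hne : S.Nonempty)
    (hord : ∀ ρ ∈ S, ∀ k l : Fin n, k < l → (ρ * R k).re < (ρ * R l).re) (a : Icc (0 : ℝ) T) :
    ∃ b, IsBirkhoffData R hT hp (by omega) a (closure S)
      (comap (fun ρ : ℂ => ‖ρ‖) atTop ⊓ 𝓟 (closure S)) b := by
  set q : Fin (n - 1) → ℝ → ℂ := fun m => (Ici (a : ℝ)).indicator (p m) with hqdef
  have hq : ∀ m, IntervalIntegrable (q m) volume 0 T := fun m => (hp m).indicator_Ici a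
  set P : Fin (n - 1) → ℝ := fun m => ∫ t in (0 : ℝ)..T, ‖q m t‖ with hPdef
  have hP : ∀ m, ∫ t in (0 : ℝ)..T, ‖q m t‖ ≤ P m := fun m => le_rfl
  have hP0 : ∀ m, 0 ≤ P m := fun m => intervalIntegral.integral_nonneg hT fun _ _ => norm_nonneg _
  have ha : ∀ m, ∀ t < (a : ℝ), q m t = 0 := fun m t ht => by
    simp only [hqdef]; exact indicator_of_notMem (fun h => not_le.2 ht h) _
  have hpq : ∀ m, ∀ t ∈ Icc (a : ℝ) T, q m t = p m t := fun m t ht =>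
    indicator_of_mem (show t ∈ Ici (a : ℝ) from ht.1) _
  obtain ⟨φ, A, c, C, N, hA, hc, hφd, hφ, hfar, hgood⟩ :=
    exists_differentiable_birkGood hn hinj hroot hR hP0 T hne hord
  have hl : Tendsto (fun ρ : ℂ => ‖ρ‖) (comap (fun ρ : ℂ => ‖ρ‖) atTop ⊓ 𝓟 (closure S)) atTop :=
    tendsto_comap.mono_left inf_le_left
  have hS : ∀ᶠ ρ in comap (fun ρ : ℂ => ‖ρ‖) atTop ⊓ 𝓟 (closure S), ρ ∈ closure S :=
    eventually_inf_principal.2 (Eventually.of_forall fun _ h => h)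
  have hn1 : (1 : ℝ) ≤ n := by exact_mod_cast (by omega : 1 ≤ n)
  have hlim : Tendsto (fun ρ : ℂ => n * A * Real.exp ((2 * T + (n + 1)) * (‖ρ‖ + A) -
      c * ‖ρ‖ ^ 2)) (comap (fun ρ : ℂ => ‖ρ‖) atTop ⊓ 𝓟 (closure S)) (𝓝 0) :=
    (tendsto_exp_linear_sub_sq hc A (2 * T + (n + 1)) (n * A)).comp hl
  have key : ∀ ρ ∈ closure S, ‖ρ‖ * (Real.exp (2 * ‖φ ρ‖ * T) *
      ((n * Real.exp (n * (‖ρ‖ + A))) * ‖φ ρ - ρ‖)) ≤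
      n * A * Real.exp ((2 * T + (n + 1)) * (‖ρ‖ + A) - c * ‖ρ‖ ^ 2) := by
    intro ρ hρ
    have h1 := hφ ρ hρ
    have h2 : ‖φ ρ‖ ≤ ‖ρ‖ + A := by
      have h3 := norm_sub_norm_le (φ ρ) ρ
      have h4 : A * Real.exp (-(c * ‖ρ‖ ^ 2)) ≤ A := mul_le_of_le_one_right hA.le
        (Real.exp_le_one_iff.2 (by rw [neg_nonpos]; positivity))
      linarith
    have h5 : ‖ρ‖ ≤ Real.exp (‖ρ‖ + A) := by linarith [Real.add_one_le_exp (‖ρ‖ + A)]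
    have h6 : Real.exp (2 * ‖φ ρ‖ * T) ≤ Real.exp (2 * (‖ρ‖ + A) * T) := by gcongr
    calc _ ≤ Real.exp (‖ρ‖ + A) * (Real.exp (2 * (‖ρ‖ + A) * T) *
          ((n * Real.exp (n * (‖ρ‖ + A))) * (A * Real.exp (-(c * ‖ρ‖ ^ 2))))) := by gcongr
      _ = n * A * (Real.exp (‖ρ‖ + A) * Real.exp (2 * (‖ρ‖ + A) * T) *
          Real.exp (n * (‖ρ‖ + A)) * Real.exp (-(c * ‖ρ‖ ^ 2))) := by ring
      _ = _ := by rw [← Real.exp_add, ← Real.exp_add, ← Real.exp_add]; congr 2; ring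
  refine ⟨fun k ρ => birkData R hT hq k a (φ ρ), fun k ρ hρ => ?_, fun ρ hρ => ?_, fun ε hε => ?_⟩
  · obtain ⟨C, h⟩ := hgood ρ hρ
    exact (h.analyticAt_birkData hT hq k hR hP a).comp (hφd.analyticAt ρ)
  · obtain ⟨C, h⟩ := hgood ρ hρ
    exact h.det_birkData_ne_zero hT hq hR hinj hP ha
  · refine eventually_norm_odeTower_sub_le hT hp hq (by omega) hinj hroot hR hP hpq ha hl
      (φ := φ) (C := C) (d := fun _ _ _ => 0) (g := fun _ ρ => 2 * ‖φ ρ‖) (δ := fun _ _ => 0)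
      ?_ ?_ (fun k => Eventually.of_forall fun ρ => ⟨by positivity,
        fun j => re_mul_sub_le_two_mul hR _ j k, fun j => by simp, fun ν => by
          simp only [add_zero]; rfl⟩) (fun k => ?_) hε
    · filter_upwards [hS, hl.eventually_ge_atTop N] with ρ h1 h2 using hfar ρ h1 h2
    · refine squeeze_zero' (Eventually.of_forall fun ρ => by positivity) ?_ hlim
      filter_upwards [hS] with ρ hρ
      refine le_trans (mul_le_mul_of_nonneg_left ?_ (norm_nonneg _)) (key ρ hρ)
      refine le_trans ?_ (le_mul_of_one_le_left (by positivity)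
        (Real.one_le_exp (by positivity)))
      exact le_mul_of_one_le_left (norm_nonneg _)
        (one_le_mul_of_one_le_of_one_le hn1 (Real.one_le_exp (by positivity)))
    · refine squeeze_zero' (Eventually.of_forall fun ρ => by positivity) ?_ hlim
      filter_upwards [hS] with ρ hρ
      refine le_trans ?_ (key ρ hρ)
      have h4 : A * Real.exp (-(c * ‖ρ‖ ^ 2)) ≤ A := mul_le_of_le_one_right hA.le
        (Real.exp_le_one_iff.2 (by rw [neg_nonpos]; positivity))
      have h3 := norm_sub_norm_le (φ ρ) ρ
      have h5 := hφ ρ hρ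
      have h6 := Real.add_one_le_exp (‖ρ‖ + A)
      have h7 := norm_pow_sub_pow_le (x := ρ) (y := φ ρ) (M := Real.exp (‖ρ‖ + A))
        (Real.one_le_exp (by positivity)) (by linarith) (by linarith) n
      rw [← Real.exp_nat_mul, norm_sub_rev ρ (φ ρ)] at h7
      rw [zero_add]
      gcongr

end

section
variable {R : Fin 2 → ℂ} {T : ℝ} (hT : 0 ≤ T) {p : Fin (2 - 1) → ℝ → ℂ}
  (hp : ∀ m, IntervalIntegrable (p m) volume 0 T) {S : Set ℂ}

theorem two_mul_integral_le_rhoAlpha_two (α : ℝ) (p : Fin (2 - 1) → ℝ → ℂ) (m : Fin (2 - 1)) :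
    2 * ∫ t in α..T, ‖p m t‖ ≤ rhoAlpha 2 T α p := by
  have h := le_ciSup (f := fun m : Fin (2 - 1) =>
    (2 * ∫ t in α..T, ‖p m t‖) ^ ((((2 : ℕ) : ℝ) - 1 - (m : ℕ))⁻¹)) (Set.finite_range _).bddAbove m
  have hm : (m : ℕ) = 0 := by omega
  have e : (((2 : ℕ) : ℝ) - 1 - (m : ℕ))⁻¹ = 1 := by rw [hm]; norm_num
  simp only [e, Real.rpow_one] at h
  exact h

theorem birkGood_two {P : Fin (2 - 1) → ℝ} {ρ : ℂ} (h0 : ρ ≠ 0)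
    (ho : ∀ j l : Fin 2, j < l → (ρ * (R j - R l)).re ≤ 0) (hP : ∀ m, 2 * P m ≤ ‖ρ‖) :
    BirkGood R T P 0 ρ := by
  refine ⟨h0, le_rfl, ho, ?_⟩
  have h1 : 0 < ‖ρ‖ := norm_pos_iff.2 h0
  have e : ∑ m : Fin (2 - 1), P m * ‖ρ⁻¹‖ ^ (2 - 1 - (m : ℕ)) = P 0 / ‖ρ‖ := by
    rw [Finset.sum_eq_single (0 : Fin (2 - 1))
      (fun m _ hm => absurd (Fin.ext (by omega)) hm) (by simp), norm_inv, div_eq_mul_inv]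
    simp
  rw [e, zero_mul, Real.exp_zero, one_mul, div_le_iff₀ h1]
  linarith [hP 0]

open Filter Topology in
theorem exists_isBirkhoffData_two_of_pos (hinj : Function.Injective R)
    (hroot : ∀ j, R j ^ 2 = 1) (hR : ∀ j, ‖R j‖ = 1)
    (hord : ∀ ρ ∈ S, ∀ k l : Fin 2, k < l → (ρ * R k).re < (ρ * R l).re) (a : Icc (0 : ℝ) T)
    (hpos : 0 < rhoAlpha 2 T a p) :
    ∃ b, IsBirkhoffData R hT hp le_rfl a {ρ | ρ ∈ closure S ∧ rhoAlpha 2 T a p ≤ ‖ρ‖}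
      (comap (fun ρ : ℂ => ‖ρ‖) atTop ⊓ 𝓟 (closure S)) b := by
  set q : Fin (2 - 1) → ℝ → ℂ := fun m => (Ici (a : ℝ)).indicator (p m) with hqdef
  have hq : ∀ m, IntervalIntegrable (q m) volume 0 T := fun m => (hp m).indicator_Ici a
  set P : Fin (2 - 1) → ℝ := fun m => ∫ t in (a : ℝ)..T, ‖p m t‖ with hPdef
  have hP : ∀ m, ∫ t in (0 : ℝ)..T, ‖q m t‖ ≤ P m := fun m =>
    (integral_norm_indicator_Ici hT (hp m) a).le
  have ha : ∀ m, ∀ t < (a : ℝ), q m t = 0 := fun m t ht => by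
    simp only [hqdef]; exact indicator_of_notMem (fun h => not_le.2 ht h) _
  have hpq : ∀ m, ∀ t ∈ Icc (a : ℝ) T, q m t = p m t := fun m t ht =>
    indicator_of_mem (show t ∈ Ici (a : ℝ) from ht.1) _
  have hl : Tendsto (fun ρ : ℂ => ‖ρ‖) (comap (fun ρ : ℂ => ‖ρ‖) atTop ⊓ 𝓟 (closure S)) atTop :=
    tendsto_comap.mono_left inf_le_left
  have hS : ∀ᶠ ρ in comap (fun ρ : ℂ => ‖ρ‖) atTop ⊓ 𝓟 (closure S), ρ ∈ closure S :=
    eventually_inf_principal.2 (Eventually.of_forall fun _ h => h)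
  have hgood : ∀ ρ, ρ ∈ closure S → rhoAlpha 2 T a p ≤ ‖ρ‖ → BirkGood R T P 0 ρ := fun ρ h1 h2 =>
    birkGood_two (norm_pos_iff.1 (hpos.trans_le h2))
      (fun j l h => re_mul_sub_le_of_mem_closure hord h1 h)
      fun m => (two_mul_integral_le_rhoAlpha_two a p m).trans h2
  refine ⟨fun k ρ => birkData R hT hq k a ρ,
    fun k ρ hρ => (hgood ρ hρ.1 hρ.2).analyticAt_birkData hT hq k hR hP a,
    fun ρ hρ => (hgood ρ hρ.1 hρ.2).det_birkData_ne_zero hT hq hR hinj hP ha, fun ε hε => ?_⟩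
  refine eventually_norm_odeTower_sub_le hT hp hq le_rfl hinj hroot hR hP hpq ha hl
    (φ := id) (C := 0) (d := fun _ _ _ => 0) (g := fun _ ρ => 2 * ‖ρ‖) (δ := fun _ _ => 0)
    ?_ (by simpa using tendsto_const_nhds) (fun k => Eventually.of_forall fun ρ => ⟨by positivity,
      fun j => re_mul_sub_le_two_mul hR _ j k, fun j => by simp, fun ν => by
        simp only [add_zero]; rfl⟩) (fun k => by simpa using tendsto_const_nhds)
    hε
  filter_upwards [hS, hl.eventually_ge_atTop _] with ρ h1 h2 using hgood ρ h1 h2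

theorem BirkGood.birkSol_eq_single {n : ℕ} {R : Fin n → ℂ} {q : Fin (n - 1) → ℝ → ℂ}
    (hq : ∀ m, IntervalIntegrable (q m) volume 0 T) (k : Fin n) {P : Fin (n - 1) → ℝ} {C : ℝ}
    {μ : ℂ} (h : BirkGood R T P C μ) (hR : ∀ j, ‖R j‖ = 1)
    (hP : ∀ m, ∫ t in (0 : ℝ)..T, ‖q m t‖ ≤ P m) (h0 : ∀ m, P m = 0) :
    birkSol R hT hq k μ = Pi.single k 1 := by
  have h1 := h.norm_birkOp_apply_le hT hq k hR hP (birkSol R hT hq k μ)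
  simp only [h0, zero_mul, Finset.sum_const_zero, mul_zero] at h1
  rw [h.birkSol_eq hT hq k hR hP, norm_le_zero_iff.1 h1, add_zero]

open Filter Topology in
theorem exists_isBirkhoffData_two_of_nonpos (hinj : Function.Injective R)
    (hroot : ∀ j, R j ^ 2 = 1) (hR : ∀ j, ‖R j‖ = 1)
    (hord : ∀ ρ ∈ S, ∀ k l : Fin 2, k < l → (ρ * R k).re < (ρ * R l).re) (a : Icc (0 : ℝ) T)
    (hpos : rhoAlpha 2 T a p ≤ 0) :
    ∃ b, IsBirkhoffData R hT hp le_rfl a (closure S)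
      (comap (fun ρ : ℂ => ‖ρ‖) atTop ⊓ 𝓟 (closure S)) b := by
  set q : Fin (2 - 1) → ℝ → ℂ := fun m => (Ici (a : ℝ)).indicator (p m) with hqdef
  have hq : ∀ m, IntervalIntegrable (q m) volume 0 T := fun m => (hp m).indicator_Ici a
  have hP : ∀ m, ∫ t in (0 : ℝ)..T, ‖q m t‖ ≤ (fun _ : Fin (2 - 1) => (0 : ℝ)) m := fun m => by
    rw [integral_norm_indicator_Ici hT (hp m) a]
    linarith [two_mul_integral_le_rhoAlpha_two (T := T) a p m]
  have ha : ∀ m, ∀ t < (a : ℝ), q m t = 0 := fun m t ht => by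
    simp only [hqdef]; exact indicator_of_notMem (fun h => not_le.2 ht h) _
  have hpq : ∀ m, ∀ t ∈ Icc (a : ℝ) T, q m t = p m t := fun m t ht =>
    indicator_of_mem (show t ∈ Ici (a : ℝ) from ht.1) _
  have hl : Tendsto (fun ρ : ℂ => ‖ρ‖) (comap (fun ρ : ℂ => ‖ρ‖) atTop ⊓ 𝓟 (closure S)) atTop :=
    tendsto_comap.mono_left inf_le_left
  have hS : ∀ᶠ ρ in comap (fun ρ : ℂ => ‖ρ‖) atTop ⊓ 𝓟 (closure S), ρ ∈ closure S :=
    eventually_inf_principal.2 (Eventually.of_forall fun _ h => h)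
  have hgood : ∀ ρ, ρ ∈ closure S → ρ ≠ 0 → BirkGood R T (fun _ => 0) 0 ρ := fun ρ h1 h2 =>
    birkGood_two h2 (fun j l h => re_mul_sub_le_of_mem_closure hord h1 h) fun m => by simp
  have hR01 : R 0 = -R 1 := by
    have := sum_eq_zero_of_pow_eq_one le_rfl hinj hroot
    rw [Fin.sum_univ_two] at this
    exact eq_neg_of_add_eq_zero_left this
  have hR1 : R 1 ≠ 0 := norm_pos_iff.1 (by rw [hR]; exact one_pos)
  have hre : ∀ ρ ∈ closure S, 0 ≤ (ρ * R 1).re := fun ρ hρ => by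
    have h1 := re_mul_sub_le_of_mem_closure hord hρ (show (0 : Fin 2) < 1 by decide)
    have e : ρ * (R 0 - R 1) = -(2 * (ρ * R 1)) := by rw [hR01]; ring
    rw [e] at h1
    simp only [Complex.neg_re, Complex.mul_re (2 : ℂ), Complex.re_ofNat, Complex.im_ofNat] at h1
    linarith
  have hne : ∀ ρ ∈ closure S, 1 + ρ * R 1 ≠ 0 := fun ρ hρ h => by
    have := congrArg Complex.re h
    rw [Complex.add_re, Complex.one_re, Complex.zero_re] at this
    linarith [hre ρ hρ]
  have hnorm : ∀ ρ ∈ closure S, ‖ρ‖ ≤ ‖1 + ρ * R 1‖ := fun ρ hρ => by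
    have e : ‖ρ‖ = ‖ρ * R 1‖ := by rw [norm_mul, hR, mul_one]
    rw [e, ← abs_norm, ← abs_norm (1 + _), ← sq_le_sq, ← Complex.normSq_eq_norm_sq,
      ← Complex.normSq_eq_norm_sq, Complex.normSq_apply, Complex.normSq_apply]
    simp only [Complex.add_re, Complex.add_im, Complex.one_re, Complex.one_im]
    nlinarith [hre ρ hρ]
  let E : Fin 2 → ℂ → ℂ := fun k ρ => if k = 1 then (1 + ρ * R 1)⁻¹ else 0
  let b : Fin 2 → ℂ → Fin 2 → ℂ := fun k ρ ν => Complex.exp (ρ * R k * (a : ℝ)) *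
    if ν = 0 then 1 else ρ * R k + E k ρ
  let d : Fin 2 → ℂ → Fin 2 → ℂ := fun k ρ j =>
    (if j = 1 then 1 else -1) * (E k ρ / (2 * (ρ * R 1)))
  refine ⟨b, fun k ρ hρ => ?_, fun ρ hρ => ?_, fun ε hε => ?_⟩
  · refine AnalyticAt.pi fun ν => ?_
    have hlin : ∀ k, AnalyticAt ℂ (fun ρ => ρ * R k) ρ := fun k => analyticAt_id.mul analyticAt_const
    refine AnalyticAt.mul ((hlin k).mul analyticAt_const).cexp ?_
    split_ifs
    · exact analyticAt_const
    · refine (hlin k).add ?_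
      by_cases hk : k = 1
      · simp only [E, hk, if_true]
        exact (analyticAt_const.add (hlin 1)).inv (hne ρ hρ)
      · simp only [E, hk, if_false]
        exact analyticAt_const
  · have e : (Matrix.of fun ν k : Fin 2 => b k ρ ν).det =
        Complex.exp (ρ * R 0 * (a : ℝ)) * Complex.exp (ρ * R 1 * (a : ℝ)) *
          (2 * (ρ * R 1) + (1 + ρ * R 1)⁻¹) := by
      rw [Matrix.det_fin_two]
      simp only [Matrix.of_apply, b, E, hR01, if_true, zero_ne_one, one_ne_zero, if_false]
      ring
    rw [e]
    refine mul_ne_zero (mul_ne_zero (Complex.exp_ne_zero _) (Complex.exp_ne_zero _)) fun h => ?_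
    have h1 := congrArg Complex.re h
    have h2 : 0 < ((1 + ρ * R 1)⁻¹).re := by
      rw [Complex.inv_re]
      refine div_pos ?_ (Complex.normSq_pos.2 (hne ρ hρ))
      rw [Complex.add_re, Complex.one_re]; linarith [hre ρ hρ]
    simp only [Complex.add_re, Complex.mul_re (2 : ℂ), Complex.re_ofNat, Complex.im_ofNat,
      Complex.zero_re] at h1 h2
    linarith [hre ρ hρ]
  · refine eventually_norm_odeTower_sub_le hT hp hq le_rfl hinj hroot hR hP hpq ha hl
      (φ := id) (C := 0) (d := d) (g := fun k ρ => if k = 1 then 0 else 2 * ‖ρ‖)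
      (δ := fun k ρ => ‖E k ρ / (2 * (ρ * R 1))‖) ?_ (by simpa using tendsto_const_nhds) (fun k => ?_) (fun k => ?_) hε
    · filter_upwards [hS, hl.eventually_gt_atTop 0] with ρ h1 h2
      exact hgood ρ h1 (norm_pos_iff.1 h2)
    · filter_upwards [hS, hl.eventually_gt_atTop 0] with ρ h1 h2
      have hρ0 := norm_pos_iff.1 h2
      refine ⟨by split_ifs <;> positivity, fun j => ?_, fun j => ?_, fun ν => ?_⟩
      · split_ifs with hk
        · rcases (show j = 0 ∨ j = 1 by omega) with rfl | rfl
          · rw [hk]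
            exact re_mul_sub_le_of_mem_closure hord h1 (by decide)
          · simp [hk]
        · exact re_mul_sub_le_two_mul hR _ j k
      · simp only [d]
        rw [norm_mul]
        split_ifs <;> simp
      · rw [id, (hgood ρ h1 hρ0).birkSol_eq_single hT hq k hR hP fun _ => rfl]
        simp only [b, d]
        congr 1
        rw [Fin.sum_univ_two]
        have hk : k = 0 ∨ k = 1 := by omega
        have hν : ν = 0 ∨ ν = 1 := by omega
        rcases hν with rfl | rfl
        · rcases hk with rfl | rfl <;> simp [E]
        · rcases hk with rfl | rfl
          · simp [E]
          · simp [E, hR01]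
            field_simp
            ring
    · by_cases hk : k = 1
      · have hlim : Tendsto (fun ρ : ℂ => (2 * ‖ρ‖)⁻¹)
            (comap (fun ρ : ℂ => ‖ρ‖) atTop ⊓ 𝓟 (closure S)) (𝓝 0) :=
          (hl.const_mul_atTop two_pos).inv_tendsto_atTop
        refine squeeze_zero' (Eventually.of_forall fun ρ => by positivity) ?_ hlim
        filter_upwards [hS, hl.eventually_gt_atTop 0] with ρ h1 h2
        simp only [hk, E, if_true, zero_mul, Real.exp_zero, one_mul, id, sub_self, norm_zero,
          add_zero, norm_div, norm_mul, norm_inv, hR, mul_one, Complex.norm_ofNat]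
        have := inv_anti₀ h2 (hnorm ρ h1)
        calc _ ≤ ‖ρ‖ * (‖ρ‖⁻¹ / (2 * ‖ρ‖)) := by gcongr
          _ = _ := by field_simp
      · simpa [E, hk] using tendsto_const_nhds

end

/-- Theorem 1.1, items 1–3.  There is a family
`Y k ρ ν x = y_k^{(ν)}(x,ρ)` such that for every `ρ ∈ S̄` with `|ρ| ≥ ρ_α` the
`y_k(·,ρ)` form a fundamental system of solutions of (1.1) (nonvanishing Wronskian),
the derivatives are jointly continuous in `(x,ρ)`, analytic in `ρ` on
`{ρ ∈ S : |ρ| > ρ_α}`, and uniformly in `x ∈ [α,T]`,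
`y_k^{(ν)}(x,ρ) = (ρR_k)^ν e^{ρR_k x}(1 + β₁(x)/(ρR_k) + o(1/ρ))` where
`β₁(x) = −(1/n)∫_α^x p_{n−2}(t) dt`. -/
theorem birkhoff_fss_first_order (n : ℕ) (hn : 2 ≤ n) (T α : ℝ) (hT : 0 < T)
    (hα : α ∈ Set.Ico 0 T)
    (R : Fin n → ℂ) (hinj : Function.Injective R) (hroot : ∀ j, R j ^ n = 1)
    (p : Fin (n - 1) → ℝ → ℂ)
    (hp : ∀ m, IntervalIntegrable (p m) volume 0 T)
    (S : Set ℂ) (hS : IsOpen S)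
    (hord : ∀ ρ ∈ S, ∀ k l : Fin n, k < l → (ρ * R k).re < (ρ * R l).re) :
    ∃ Y : Fin n → ℂ → ℕ → ℝ → ℂ,
      -- each `y_k(·,ρ)` is a solution of (1.1)
      (∀ k : Fin n, ∀ ρ ∈ closure S, rhoAlpha n T α p ≤ ‖ρ‖ →
          IsSolutionODE n T p ρ (Y k ρ)) ∧
      -- fundamental system: the Wronskian does not vanish
      (∀ ρ ∈ closure S, rhoAlpha n T α p ≤ ‖ρ‖ → ∀ x ∈ Set.Icc (0 : ℝ) T,
          (Matrix.of fun ν k : Fin n => Y k ρ (ν : ℕ) x).det ≠ 0) ∧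
      -- (1) joint continuity
      (∀ k : Fin n, ∀ ν < n, ContinuousOn (fun q : ℝ × ℂ => Y k q.2 ν q.1)
          (Set.Icc (0 : ℝ) T ×ˢ {ρ | ρ ∈ closure S ∧ rhoAlpha n T α p ≤ ‖ρ‖})) ∧
      -- (2) analyticity in `ρ`
      (∀ k : Fin n, ∀ ν < n, ∀ x ∈ Set.Icc (0 : ℝ) T,
          AnalyticOnNhd ℂ (fun ρ => Y k ρ ν x) {ρ | ρ ∈ S ∧ rhoAlpha n T α p < ‖ρ‖}) ∧
      -- (3) the asymptotics (1.13), uniformly in `x ∈ [α,T]`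
      (∀ ε > (0 : ℝ), ∃ ρ₀ : ℝ, ∀ ρ ∈ closure S, rhoAlpha n T α p ≤ ‖ρ‖ → ρ₀ ≤ ‖ρ‖ →
          ∀ k : Fin n, ∀ ν < n, ∀ x ∈ Set.Icc α T,
            ‖Y k ρ ν x - (ρ * R k) ^ ν * Complex.exp (ρ * R k * x) *
                (1 + (-(1 / (n : ℂ)) * ∫ t in α..x, p ⟨n - 2, by omega⟩ t) / (ρ * R k))‖
              ≤ ε * ‖(ρ * R k) ^ ν * Complex.exp (ρ * R k * x)‖ / ‖ρ‖) := by
  have hR : ∀ j, ‖R j‖ = 1 := fun j => by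
    have := congrArg norm (hroot j)
    rw [norm_pow, norm_one] at this
    exact (pow_eq_one_iff_of_nonneg (norm_nonneg _) (by omega)).1 this
  set a : Icc (0 : ℝ) T := ⟨α, hα.1, hα.2.le⟩ with ha
  obtain ⟨b, hb⟩ : ∃ b, IsBirkhoffData R hT.le hp hn a
      {ρ | ρ ∈ closure S ∧ rhoAlpha n T α p ≤ ‖ρ‖}
      (Filter.comap (fun ρ : ℂ => ‖ρ‖) Filter.atTop ⊓ Filter.principal (closure S)) b := by
    rcases S.eq_empty_or_nonempty with rfl | hne
    · simp only [closure_empty, Filter.principal_empty, inf_bot_eq]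
      exact ⟨fun _ _ _ => 0, fun _ _ h => h.1.elim, fun _ h => h.1.elim, fun _ _ => by simp⟩
    · rcases hn.eq_or_lt with rfl | hn3
      · rcases lt_or_ge 0 (rhoAlpha 2 T α p) with hpos | hpos
        · exact exists_isBirkhoffData_two_of_pos hT.le hp hinj hroot hR hord a hpos
        · obtain ⟨b, hb⟩ :=
            exists_isBirkhoffData_two_of_nonpos hT.le hp hinj hroot hR hord a hpos
          exact ⟨b, fun k ρ hρ => hb.analyticAt k ρ hρ.1, fun ρ hρ => hb.det_ne_zero ρ hρ.1,
            hb.asymptotics⟩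
      · obtain ⟨b, hb⟩ :=
          exists_isBirkhoffData_of_three_le hT.le hp hn3 hinj hroot hR hne hord a
        exact ⟨b, fun k ρ hρ => hb.analyticAt k ρ hρ.1, fun ρ hρ => hb.det_ne_zero ρ hρ.1,
          hb.asymptotics⟩
  refine ⟨fun k ρ => odeTower hT.le a hp (ρ ^ n) (b k ρ),
    fun k ρ _ _ => isSolutionODE_odeTower hT.le a hp hn ρ (b k ρ),
    fun ρ h1 h2 x _ => det_odeTower_ne_zero hT.le a hp (ρ ^ n) (fun k => b k ρ)
      (hb.det_ne_zero ρ ⟨h1, h2⟩) x,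
    fun k ν hν => continuousOn_odeTower hT.le a hp (hb.analyticAt k) hν _,
    fun k ν hν x _ ρ hρ => analyticAt_odeTower hT.le a hp
      (hb.analyticAt k ρ ⟨subset_closure hρ.1, hρ.2.le⟩) hν x, fun ε hε => ?_⟩
  have h := Filter.eventually_inf_principal.1 (hb.asymptotics ε hε)
  obtain ⟨ρ₀, h⟩ := Filter.eventually_atTop.1 (Filter.eventually_comap.1 h)
  exact ⟨ρ₀, fun ρ hρ _ hρ₀ => h ‖ρ‖ hρ₀ ρ rfl hρ⟩
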